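/- arXiv:2407.11145 — 2 statements merged into one kernel-verified Lean document; each statement's English description precedes it below -/
import Mathlib

section
/- Every non-identity element of the braid group B_n is either σ-positive or σ-negative; that is, for every braid β ≠ 1 in B_n, either β or β⁻¹ admits a word in the Artin generators in which the generator of lowest index appearing occurs only with positive exponents. -/
/-- The braid relations on `n` strands, as elements of the free group on the
Artin generators `σ_1, …, σ_{n-1}` (indexed by `Fin (n-1)`). -/
def braidRels (n : ℕ) : Set (FreeGroup (Fin (n - 1))) :=
  {r | (∃ i j : Fin (n - 1), (i : ℕ) + 2 ≤ (j : ℕ) ∧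
        r = FreeGroup.of i * FreeGroup.of j * (FreeGroup.of i)⁻¹ * (FreeGroup.of j)⁻¹) ∨
       (∃ i j : Fin (n - 1), (i : ℕ) + 1 = (j : ℕ) ∧
        r = FreeGroup.of i * FreeGroup.of j * FreeGroup.of i *
            (FreeGroup.of j * FreeGroup.of i * FreeGroup.of j)⁻¹)}

/-- The braid group `B_n` with its standard Artin presentation. -/
abbrev BraidGroup (n : ℕ) := PresentedGroup (braidRels n)

/-- The Artin generator `σ_i` of the braid group. -/
def braidGen {n : ℕ} (i : Fin (n - 1)) : BraidGroup n := PresentedGroup.of i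

/-- The element of the braid group represented by a word in the Artin generators
and their inverses; a letter `(i, true)` denotes `σ_i`, and `(i, false)` denotes `σ_i⁻¹`. -/
def wordProd {n : ℕ} (w : List (Fin (n - 1) × Bool)) : BraidGroup n :=
  (w.map (fun p => if p.2 then braidGen p.1 else (braidGen p.1)⁻¹)).prod

/-- A word in the Artin generators and their inverses is σ-positive if among the letters
occurring, the generator of lowest index occurs only with positive exponents. -/
def SigmaPositive {n : ℕ} (w : List (Fin (n - 1) × Bool)) : Prop :=
  ∃ i₀ : Fin (n - 1),
    (∃ p ∈ w, p.1 = i₀) ∧ (∀ p ∈ w, i₀ ≤ p.1) ∧ (∀ p ∈ w, p.1 = i₀ → p.2 = true)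

namespace BraidOrder

open FreeGroup List

/-- A marked conjugate `P m P⁻¹` of the letter `m`, in a free group on `ℕ`. -/
abbrev Conj := List (ℕ × Bool) × (ℕ × Bool)

namespace Conj

/-- The reduced word spelled by a marked conjugate. -/
def word (c : Conj) : List (ℕ × Bool) := c.1 ++ c.2 :: invRev c.1

/-- The group element of a marked conjugate. -/
def val (c : Conj) : FreeGroup ℕ := FreeGroup.mk c.word

/-- In the product of `c` and `d`, neither marked letter is cancelled. -/
def Good (c d : Conj) : Prop :=
  ¬ c.1 ++ [(c.2.1, !c.2.2)] <+: d.1 ++ [d.2] ∧ ¬ d.1 ++ [d.2] <+: c.1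

end Conj

theorem exists_common_prefix (A B : List (ℕ × Bool)) :
    ∃ C U V, A = C ++ U ∧ B = C ++ V ∧
      ∀ u U' v V', U = u :: U' → V = v :: V' → u ≠ v := by
  induction A generalizing B with
  | nil => exact ⟨[], [], B, by simp⟩
  | cons a A ih =>
    cases B with
    | nil => exact ⟨[], a :: A, [], by simp⟩
    | cons b B =>
      by_cases hab : a = b
      · obtain ⟨C, U, V, rfl, rfl, h⟩ := ih B
        exact ⟨a :: C, U, V, by simp, by simp [hab], h⟩
      · refine ⟨[], a :: A, b :: B, rfl, rfl, ?_⟩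
        rintro u U' v V' hU hV
        simp only [cons.injEq] at hU hV
        rw [← hU.1, ← hV.1]
        exact hab

theorem isReduced_append {L₁ L₂ : List (ℕ × Bool)} :
    IsReduced (L₁ ++ L₂) ↔ IsReduced L₁ ∧ IsReduced L₂ ∧
      ∀ x ∈ L₁.getLast?, ∀ y ∈ L₂.head?, x.1 = y.1 → x.2 = y.2 :=
  List.isChain_append

theorem isReduced_cons_append_head {m h : ℕ × Bool} {L : List (ℕ × Bool)}
    (hL : IsReduced (h :: L)) (hh : h ≠ (m.1, !m.2)) : IsReduced (m :: h :: L) := by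
  rw [isReduced_cons_cons]
  refine ⟨fun h1 => ?_, hL⟩
  by_contra h2
  apply hh
  ext
  · exact h1.symm
  · simp only
    revert h2
    cases m.2 <;> cases h.2 <;> simp

/-- The marked letters of a product of admissible conjugates survive if no two adjacent
ones interact. -/
theorem exists_reduced_word_of_good (c : Conj) (l : List Conj)
    (hadm : ∀ d ∈ c :: l, IsReduced (Conj.word d)) (hgood : (c :: l).IsChain Conj.Good) :
    ∃ L, ((c :: l).map Conj.val).prod = FreeGroup.mk (c.1 ++ c.2 :: L) ∧
      IsReduced (c.1 ++ c.2 :: L) ∧ l.map Prod.snd <+ L := by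
  induction l generalizing c with
  | nil =>
    refine ⟨invRev c.1, by simp [Conj.val, Conj.word], hadm c (by simp), by simp⟩
  | cons d l ih =>
    rw [isChain_cons_cons] at hgood
    obtain ⟨L₂, hprod, hred, hsub⟩ := ih d (fun e he => hadm e (by simp [he])) hgood.2
    obtain ⟨hg1, hg2⟩ := hgood.1
    have hc : IsReduced (Conj.word c) := hadm c (by simp)
    obtain ⟨P, m⟩ := c
    obtain ⟨Q, k⟩ := d
    simp only at hprod hred hsub hg1 hg2 hc ⊢
    obtain ⟨C, U, V, rfl, rfl, hne⟩ := exists_common_prefix P Q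
    simp only [Conj.word] at hc
    have hV : IsReduced (V ++ k :: L₂) := hred.infix ⟨C, [], by simp⟩
    have hP : IsReduced ((C ++ U) ++ [m]) :=
      hc.infix ⟨[], invRev (C ++ U), by simp⟩
    refine ⟨invRev U ++ (V ++ k :: L₂), ?_, ?_, ?_⟩
    · rw [List.map_cons, List.prod_cons, hprod]
      have e1 : FreeGroup.mk (C ++ U ++ m :: (invRev U ++ (V ++ k :: L₂)))
          = FreeGroup.mk (C ++ U) * FreeGroup.mk [m] * (FreeGroup.mk U)⁻¹
              * FreeGroup.mk (V ++ k :: L₂) := by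
        rw [inv_mk, mul_mk, mul_mk, mul_mk]; simp
      have e2 : FreeGroup.mk (C ++ V ++ k :: L₂)
          = FreeGroup.mk C * FreeGroup.mk (V ++ k :: L₂) := by
        rw [mul_mk]; simp
      have e3 : Conj.val (C ++ U, m) = FreeGroup.mk (C ++ U) * FreeGroup.mk [m] *
          (FreeGroup.mk C * FreeGroup.mk U)⁻¹ := by
        rw [mul_mk, mul_mk, inv_mk, mul_mk]; simp [Conj.val, Conj.word]
      rw [e1, e2, e3]
      group
    · obtain ⟨h, V', hhV, hhV2⟩ : ∃ h V', V ++ k :: L₂ = h :: V' ∧ [h] <+: V ++ [k] := by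
        cases V with
        | nil => exact ⟨k, L₂, by simp⟩
        | cons v V => exact ⟨v, V ++ k :: L₂, by simp⟩
      rw [hhV] at hV ⊢
      rcases U with _ | ⟨u, U⟩
      · have : h ≠ (m.1, !m.2) := by
          rintro rfl
          apply hg1
          rw [append_nil, append_assoc, prefix_append_right_inj]
          exact hhV2
        have h2 := isReduced_cons_append_head hV this
        have := IsReduced.append_overlap (L₁ := C) (L₂ := [m]) (L₃ := h :: V')
          (by simpa using hP) h2 (by simp)
        simpa using this
      · have hu : h ≠ u := by
          rintro rfl
          rcases V with _ | ⟨v, V⟩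
          · apply hg2
            simp only [nil_append, cons.injEq] at hhV
            rw [append_nil, prefix_append_right_inj, hhV.1]
            simp
          · simp only [cons_append, cons.injEq] at hhV
            exact hne _ _ _ _ rfl rfl hhV.1.symm
        have hu' : h ≠ ((u.1, !u.2).1, !(u.1, !u.2).2) := by simpa using hu
        have h2 := isReduced_cons_append_head hV hu'
        have h3 : IsReduced (C ++ u :: U ++ m :: invRev (u :: U)) :=
          hc.infix ⟨[], invRev C, by simp⟩
        have hi : invRev (u :: U) = invRev U ++ [(u.1, !u.2)] := by simp [invRev]
        rw [hi] at h3 ⊢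
        have := IsReduced.append_overlap (L₁ := C ++ u :: U ++ m :: invRev U)
          (L₂ := [(u.1, !u.2)]) (L₃ := h :: V') (by simpa using h3) h2 (by simp)
        simpa using this
    · simp only [map_cons]
      exact ((hsub.cons_cons k).trans (sublist_append_right V _)).trans
        (sublist_append_right _ _)

theorem norm_mk_of_isReduced {L : List (ℕ × Bool)} (h : IsReduced L) :
    (FreeGroup.mk L).norm = L.length := by
  rw [FreeGroup.norm, toWord_mk, h.reduce_eq]

/-- Artin's lemma: a chain of non-interacting conjugates whose product is a word of the same
length is that word. -/
theorem eq_of_good_of_prod_eq (l : List Conj) (T : List (ℕ × Bool))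
    (hadm : ∀ d ∈ l, IsReduced (Conj.word d)) (hgood : l.IsChain Conj.Good)
    (hlen : T.length = l.length) (hprod : (l.map Conj.val).prod = FreeGroup.mk T) :
    l = T.map (fun t => ([], t)) := by
  induction l generalizing T with
  | nil =>
    rw [length_nil, length_eq_zero_iff] at hlen
    simp [hlen]
  | cons c l ih =>
    obtain ⟨L, hp, hr, hs⟩ := exists_reduced_word_of_good c l hadm hgood
    have hn := norm_mk_of_isReduced hr
    rw [← hp, hprod] at hn
    have hle := FreeGroup.norm_mk_le (L₁ := T)
    have hsl := hs.length_le
    simp only [length_append, length_cons, length_map] at hn hsl hlen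
    have hc1 : c.1 = [] := by rw [← length_eq_zero_iff]; omega
    have hT : IsReduced T := by
      apply IsReduced.of_reduce_eq
      apply (reduce.red (L := T)).sublist.eq_of_length
      rw [FreeGroup.norm, toWord_mk] at hn hle
      omega
    have hTL : T = c.1 ++ c.2 :: L := by
      rw [← hT.reduce_eq, ← hr.reduce_eq, ← toWord_mk, ← toWord_mk, ← hp, hprod]
    rw [hc1, nil_append] at hTL
    subst hTL
    have hval : Conj.val c = FreeGroup.mk [c.2] := by simp [Conj.val, Conj.word, hc1]
    rw [map_cons, prod_cons, hval, ← singleton_append (l := L), ← mul_mk, mul_right_inj] at hprod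
    rw [map_cons, ← ih L (fun d hd => hadm d (by simp [hd])) hgood.tail (by simpa using hlen) hprod,
      ← hc1]

theorem exists_strip_letter (s : ℕ × Bool) (P : List (ℕ × Bool)) (m : ℕ × Bool) (l : List Conj)
    (hadm : ∀ d ∈ (s :: P, m) :: l, IsReduced (Conj.word d))
    (hgood : ((s :: P, m) :: l).IsChain Conj.Good) :
    ∃ l' : List Conj, (∀ d ∈ (P, m) :: l', IsReduced (Conj.word d)) ∧
      ((P, m) :: l').IsChain Conj.Good ∧ l'.length = l.length + 1 ∧
      (((P, m) :: l').map Conj.val).prod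
        = (FreeGroup.mk [s])⁻¹ * (((s :: P, m) :: l).map Conj.val).prod := by
  have hval : ∀ (Q : List (ℕ × Bool)) (k : ℕ × Bool), Conj.val (s :: Q, k)
      = FreeGroup.mk [s] * Conj.val (Q, k) * (FreeGroup.mk [s])⁻¹ := by
    intro Q k
    simp [Conj.val, Conj.word, inv_mk, mul_mk, invRev]
  have hsv : Conj.val ([], (s.1, !s.2)) = (FreeGroup.mk [s])⁻¹ := by
    simp [Conj.val, Conj.word, inv_mk, invRev]
  have hsr : IsReduced (Conj.word ([], (s.1, !s.2))) := by
    simp [Conj.word, FreeGroup.IsReduced]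
  have hred : ∀ (Q : List (ℕ × Bool)) (k : ℕ × Bool), IsReduced (Conj.word (s :: Q, k)) →
      IsReduced (Conj.word (Q, k)) := fun Q k h =>
    h.infix ⟨[s], [(s.1, !s.2)], by simp [Conj.word, invRev]⟩
  have hgs : ∀ (Q : List (ℕ × Bool)) (k : ℕ × Bool), IsReduced (Conj.word (s :: Q, k)) →
      Conj.Good (Q, k) ([], (s.1, !s.2)) := by
    intro Q k hw
    rcases Q with _ | ⟨u, Q⟩
    · refine ⟨fun h => ?_, by simp⟩
      obtain ⟨s1, s2⟩ := s
      obtain ⟨k1, k2⟩ := k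
      simp [Conj.word, FreeGroup.IsReduced, invRev] at h hw
      grind
    · refine ⟨by simp, fun h => ?_⟩
      simp only [nil_append, cons_prefix_cons, nil_prefix, and_true] at h
      subst h
      simp [Conj.word, FreeGroup.IsReduced] at hw
  induction l generalizing P m with
  | nil =>
    have hw := hadm _ mem_cons_self
    refine ⟨[([], (s.1, !s.2))], by simp [hred P m hw, hsr], by simp [hgs P m hw], rfl, ?_⟩
    simp only [map_cons, map_nil, prod_cons, prod_nil, hval, hsv]
    group
  | cons d l ih =>
    obtain ⟨Q, k⟩ := d
    rw [isChain_cons_cons] at hgood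
    have hw := hadm _ mem_cons_self
    by_cases hQ : ∃ Q', Q = s :: Q'
    · obtain ⟨Q', rfl⟩ := hQ
      obtain ⟨l', h1, h2, h3, h4⟩ := ih Q' k (fun e he => hadm e (mem_cons_of_mem _ he)) hgood.2
      refine ⟨(Q', k) :: l', ?_, ?_, by simp [h3], ?_⟩
      · rw [forall_mem_cons]
        exact ⟨hred P m hw, h1⟩
      · rw [isChain_cons_cons]
        refine ⟨?_, h2⟩
        simpa only [Conj.Good, cons_append, cons_prefix_cons, true_and] using hgood.1
      · rw [map_cons, prod_cons, h4, map_cons (l := _ :: l), prod_cons, hval]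
        group
    · refine ⟨([], (s.1, !s.2)) :: (Q, k) :: l, ?_, ?_, by simp, ?_⟩
      · simp only [mem_cons, forall_eq_or_imp] at hadm ⊢
        exact ⟨hred P m hw, hsr, hadm.2⟩
      · rw [isChain_cons_cons, isChain_cons_cons]
        refine ⟨hgs P m hw, ⟨fun h => ?_, by simp⟩, hgood.2⟩
        rcases Q with _ | ⟨u, Q⟩
        · simp only [Bool.not_not, nil_append, cons_prefix_cons, nil_prefix, and_true] at h
          apply hgood.1.2
          simp [← h]
        · simp only [Bool.not_not, nil_append, cons_append, cons_prefix_cons, nil_prefix,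
            and_true] at h
          exact hQ ⟨Q, by rw [← h]⟩
      · simp only [map_cons, prod_cons, hval, hsv]
        group

theorem exists_strip (p P : List (ℕ × Bool)) (m : ℕ × Bool) (l : List Conj)
    (hadm : ∀ d ∈ (p ++ P, m) :: l, IsReduced (Conj.word d))
    (hgood : ((p ++ P, m) :: l).IsChain Conj.Good) :
    ∃ l' : List Conj, (∀ d ∈ (P, m) :: l', IsReduced (Conj.word d)) ∧
      ((P, m) :: l').IsChain Conj.Good ∧ l'.length = l.length + p.length ∧
      (((P, m) :: l').map Conj.val).prod
        = (FreeGroup.mk p)⁻¹ * (((p ++ P, m) :: l).map Conj.val).prod := by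
  induction p generalizing l with
  | nil => exact ⟨l, hadm, hgood, rfl, by simp [← one_eq_mk]⟩
  | cons s p ih =>
    obtain ⟨l₁, h1, h2, h3, h4⟩ := exists_strip_letter s (p ++ P) m l hadm hgood
    obtain ⟨l₂, g1, g2, g3, g4⟩ := ih l₁ h1 h2
    refine ⟨l₂, g1, g2, by simp [g3, h3]; omega, ?_⟩
    have e : FreeGroup.mk (s :: p) = FreeGroup.mk [s] * FreeGroup.mk p := by simp [mul_mk]
    rw [g4, h4, e, mul_inv_rev, mul_assoc]
    rfl

/-- In a product of conjugates equal to a short word beginning with `t`, a conjugator beginning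
with `t` is not absorbed by the conjugates to its right. -/
theorem not_absorbed_of_prod_eq (t : ℕ × Bool) (p q : List (ℕ × Bool)) (a m : ℕ × Bool)
    (l : List Conj) (T : List (ℕ × Bool))
    (hadm : ∀ d ∈ (t :: p ++ (a.1, !a.2) :: q, m) :: l, IsReduced (Conj.word d))
    (hgood : ((t :: p ++ (a.1, !a.2) :: q, m) :: l).IsChain Conj.Good)
    (hlen : T.length = l.length + 1)
    (hprod : Conj.val (t :: p, a) * (((t :: p ++ (a.1, !a.2) :: q, m) :: l).map Conj.val).prod
      = FreeGroup.mk (t :: T)) : False := by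
  obtain ⟨l', h1, h2, h3, h4⟩ := exists_strip _ _ m l hadm hgood
  obtain ⟨L, g1, g2, g3⟩ := exists_reduced_word_of_good _ l' h1 h2
  rw [h4, eq_inv_mul_of_mul_eq hprod] at g1
  have hn := norm_mk_of_isReduced g2
  have e : (FreeGroup.mk (t :: p))⁻¹ * ((Conj.val (t :: p, a))⁻¹ * FreeGroup.mk (t :: T))
      = FreeGroup.mk ((a.1, !a.2) :: (invRev p ++ T)) := by
    have e1 : Conj.val (t :: p, a) = FreeGroup.mk (t :: p) * FreeGroup.mk [a]
        * (FreeGroup.mk (t :: p))⁻¹ := by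
      simp [Conj.val, Conj.word, inv_mk, mul_mk]
    have e2 : ∀ u, FreeGroup.mk (t :: u) = FreeGroup.mk [t] * FreeGroup.mk u := by
      intro u; simp [mul_mk]
    have e3 : FreeGroup.mk ((a.1, !a.2) :: (invRev p ++ T))
        = (FreeGroup.mk [a])⁻¹ * (FreeGroup.mk p)⁻¹ * FreeGroup.mk T := by
      simp [inv_mk, mul_mk, invRev]
    rw [e1, e3, e2 p, e2 T]
    group
  rw [← g1, e] at hn
  have hle := FreeGroup.norm_mk_le (L₁ := (a.1, !a.2) :: (invRev p ++ T))
  have hL := g3.length_le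
  simp only [length_append, length_cons, length_map, invRev_length] at hn hle hL h3
  omega

/-- The Artin automorphism `t_i ↦ t_{i+1}`, `t_{i+1} ↦ t_{i+1}⁻¹ t_i t_{i+1}`. -/
def artin (i : ℕ) : MulAut (FreeGroup ℕ) :=
  MonoidHom.toMulEquiv
    (FreeGroup.lift fun j => if j = i then of (i + 1)
      else if j = i + 1 then (of (i + 1))⁻¹ * of i * of (i + 1) else of j)
    (FreeGroup.lift fun j => if j = i then of i * of (i + 1) * (of i)⁻¹
      else if j = i + 1 then of i else of j)
    (by
      ext j
      by_cases h : j = i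
      · simp [h]
      by_cases h' : j = i + 1
      · simp [h']; group
      · simp [h, h'])
    (by
      ext j
      by_cases h : j = i
      · simp [h]; group
      by_cases h' : j = i + 1
      · simp [h']
      · simp [h, h'])

@[simp]
theorem artin_of_self (i : ℕ) : artin i (of i) = of (i + 1) := by
  simp [artin]

@[simp]
theorem artin_of_succ (i : ℕ) :
    artin i (of (i + 1)) = (of (i + 1))⁻¹ * of i * of (i + 1) := by
  simp [artin]

theorem artin_of_of_ne {i j : ℕ} (h : j ≠ i) (h' : j ≠ i + 1) : artin i (of j) = of j := by
  simp [artin, h, h']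

theorem artin_inv_of_self (i : ℕ) :
    (artin i)⁻¹ (of i) = of i * of (i + 1) * (of i)⁻¹ := by
  rw [MulAut.inv_apply, MulEquiv.symm_apply_eq]
  simp; group

theorem artin_inv_of_succ (i : ℕ) : (artin i)⁻¹ (of (i + 1)) = of i := by
  rw [MulAut.inv_apply, MulEquiv.symm_apply_eq]
  simp

theorem artin_inv_of_of_ne {i j : ℕ} (h : j ≠ i) (h' : j ≠ i + 1) :
    (artin i)⁻¹ (of j) = of j := by
  rw [MulAut.inv_apply, MulEquiv.symm_apply_eq, artin_of_of_ne h h']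

theorem mulAut_ext {φ ψ : MulAut (FreeGroup ℕ)} (h : ∀ j, φ (of j) = ψ (of j)) : φ = ψ := by
  have : φ.toMonoidHom = ψ.toMonoidHom := FreeGroup.ext_hom _ _ h
  ext x
  exact DFunLike.congr_fun this x

theorem artin_comm {i j : ℕ} (h : i + 2 ≤ j) : artin i * artin j = artin j * artin i := by
  apply mulAut_ext
  intro k
  simp only [MulAut.mul_apply]
  by_cases h1 : k = i
  · subst h1
    rw [artin_of_of_ne (by omega) (by omega), artin_of_self,
      artin_of_of_ne (by omega) (by omega)]
  by_cases h2 : k = i + 1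
  · subst h2
    rw [artin_of_of_ne (by omega) (by omega), artin_of_succ, _root_.map_mul, _root_.map_mul,
      _root_.map_inv, artin_of_of_ne (by omega) (by omega), artin_of_of_ne (by omega) (by omega)]
  by_cases h3 : k = j
  · subst h3
    rw [artin_of_self, artin_of_of_ne (by omega) (by omega), artin_of_of_ne (by omega) (by omega),
      artin_of_self]
  by_cases h4 : k = j + 1
  · subst h4
    rw [artin_of_of_ne (i := i) (by omega) (by omega), artin_of_succ, _root_.map_mul,
      _root_.map_mul, _root_.map_inv, artin_of_of_ne (by omega) (by omega),
      artin_of_of_ne (by omega) (by omega)]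
  rw [artin_of_of_ne h3 h4, artin_of_of_ne h1 h2, artin_of_of_ne h3 h4]

theorem artin_braid (i : ℕ) :
    artin i * artin (i + 1) * artin i = artin (i + 1) * artin i * artin (i + 1) := by
  apply mulAut_ext
  intro k
  simp only [MulAut.mul_apply]
  have e1 : artin (i + 1) (of i) = of i := artin_of_of_ne (by omega) (by omega)
  have e2 : artin i (of (i + 1 + 1)) = of (i + 1 + 1) := artin_of_of_ne (by omega) (by omega)
  by_cases h1 : k = i
  · subst h1
    simp [e1, e2]
  by_cases h2 : k = i + 1
  · subst h2
    simp [e1, e2, mul_assoc]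
  by_cases h3 : k = i + 1 + 1
  · subst h3
    simp [e1, e2, mul_assoc]
  rw [artin_of_of_ne h1 h2, artin_of_of_ne h2 h3, artin_of_of_ne h1 h2]
  rw [artin_of_of_ne h2 h3]

/-- The Artin generator of index `i`, or `1` when there is no such generator. -/
def bg (n i : ℕ) : BraidGroup n := if h : i < n - 1 then braidGen ⟨i, h⟩ else 1

theorem bg_of_lt {n i : ℕ} (h : i < n - 1) : bg n i = braidGen ⟨i, h⟩ := dif_pos h

theorem braidGen_eq {n : ℕ} (i : Fin (n - 1)) : braidGen i = bg n i := (bg_of_lt i.2).symm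

theorem bg_comm {n i j : ℕ} (h : i + 2 ≤ j) : bg n i * bg n j = bg n j * bg n i := by
  by_cases hj : j < n - 1
  · have hi : i < n - 1 := by omega
    rw [bg_of_lt hi, bg_of_lt hj]
    have : braidGen ⟨i, hi⟩ * braidGen ⟨j, hj⟩ * (braidGen ⟨i, hi⟩)⁻¹ * (braidGen ⟨j, hj⟩)⁻¹
        = (1 : BraidGroup n) :=
      PresentedGroup.one_of_mem (rels := braidRels n) (Or.inl ⟨⟨i, hi⟩, ⟨j, hj⟩, h, rfl⟩)
    rw [mul_inv_eq_one, mul_inv_eq_iff_eq_mul] at this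
    exact this
  · simp [bg, hj]

theorem bg_braid {n i : ℕ} (h : i + 2 < n) :
    bg n i * bg n (i + 1) * bg n i = bg n (i + 1) * bg n i * bg n (i + 1) := by
  have hi : i < n - 1 := by omega
  have hj : i + 1 < n - 1 := by omega
  rw [bg_of_lt hi, bg_of_lt hj]
  have : braidGen ⟨i, hi⟩ * braidGen ⟨i + 1, hj⟩ * braidGen ⟨i, hi⟩ *
      (braidGen ⟨i + 1, hj⟩ * braidGen ⟨i, hi⟩ * braidGen ⟨i + 1, hj⟩)⁻¹ = (1 : BraidGroup n) :=
    PresentedGroup.one_of_mem (rels := braidRels n) (Or.inr ⟨⟨i, hi⟩, ⟨i + 1, hj⟩, rfl, rfl⟩)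
  rwa [mul_inv_eq_one] at this

/-- Homomorphisms out of the braid group. -/
theorem exists_hom {G : Type*} [Group G] (n : ℕ) (f : ℕ → G)
    (hc : ∀ i j, i + 2 ≤ j → j + 1 < n → f i * f j = f j * f i)
    (hb : ∀ i, i + 2 < n → f i * f (i + 1) * f i = f (i + 1) * f i * f (i + 1)) :
    ∃ φ : BraidGroup n →* G, ∀ i, i + 1 < n → φ (bg n i) = f i := by
  refine ⟨PresentedGroup.toGroup (f := fun i : Fin (n - 1) => f i) ?_, ?_⟩
  · rintro r (⟨i, j, h, rfl⟩ | ⟨i, j, h, rfl⟩)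
    · simp only [_root_.map_mul, _root_.map_inv, lift_apply_of]
      rw [hc i j h (by omega)]
      group
    · simp only [_root_.map_mul, _root_.map_inv, lift_apply_of]
      have := hb i (by omega)
      rw [← h, this]
      group
  · intro i hi
    rw [bg_of_lt (by omega), braidGen, PresentedGroup.toGroup.of]

/-- The subgroup generated by the Artin generators of index at least `k`. -/
def tailSubgroup (n k : ℕ) : Subgroup (BraidGroup n) :=
  Subgroup.closure {g | ∃ j, k ≤ j ∧ j + 1 < n ∧ g = bg n j}

theorem bg_mem_tailSubgroup {n k j : ℕ} (h : k ≤ j) : bg n j ∈ tailSubgroup n k := by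
  by_cases hj : j + 1 < n
  · exact Subgroup.subset_closure ⟨j, h, hj, rfl⟩
  · rw [bg, dif_neg (by omega)]
    exact one_mem _

@[elab_as_elim]
theorem tailSubgroup_induction {n k : ℕ} {p : ∀ γ : BraidGroup n, γ ∈ tailSubgroup n k → Prop}
    (one : p 1 (one_mem _))
    (mul : ∀ γ hγ j (hk : k ≤ j), j + 1 < n → p γ hγ →
      p (γ * bg n j) (mul_mem hγ (bg_mem_tailSubgroup hk)))
    (mul_inv : ∀ γ hγ j (hk : k ≤ j), j + 1 < n → p γ hγ →
      p (γ * (bg n j)⁻¹) (mul_mem hγ (inv_mem (bg_mem_tailSubgroup hk))))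
    {γ : BraidGroup n} (hγ : γ ∈ tailSubgroup n k) : p γ hγ := by
  unfold tailSubgroup at *
  induction hγ using Subgroup.closure_induction_right with
  | one => exact one
  | mul_right x hx y hy ih =>
    obtain ⟨j, h1, h2, rfl⟩ := hy
    exact mul x hx j h1 h2 ih
  | mul_inv_cancel x hx y hy ih =>
    obtain ⟨j, h1, h2, rfl⟩ := hy
    exact mul_inv x hx j h1 h2 ih

theorem tailSubgroup_zero (n : ℕ) : tailSubgroup n 0 = ⊤ := by
  rw [eq_top_iff, ← PresentedGroup.closure_range_of, Subgroup.closure_le]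
  rintro _ ⟨i, rfl⟩
  exact Subgroup.subset_closure ⟨i, by omega, by omega, braidGen_eq i⟩

theorem exists_action (n : ℕ) : ∃ φ : BraidGroup n →* MulAut (FreeGroup ℕ),
    ∀ i, i + 1 < n → φ (bg n i) = artin i :=
  exists_hom n artin (fun _ _ h _ => artin_comm h) (fun i _ => artin_braid i)

/-- The Artin representation. -/
noncomputable def action (n : ℕ) : BraidGroup n →* MulAut (FreeGroup ℕ) :=
  (exists_action n).choose

theorem action_bg {n i : ℕ} (h : i + 1 < n) : action n (bg n i) = artin i :=
  (exists_action n).choose_spec i h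

theorem action_fix_of_lt {n k : ℕ} {γ : BraidGroup n} (hγ : γ ∈ tailSubgroup n k) {i : ℕ}
    (hi : i < k) : action n γ (of i) = of i := by
  induction hγ using tailSubgroup_induction with
  | one => simp
  | mul γ _ j h1 h2 ih =>
    rw [_root_.map_mul, action_bg h2, MulAut.mul_apply, artin_of_of_ne (by omega) (by omega), ih]
  | mul_inv γ _ j h1 h2 ih =>
    rw [_root_.map_mul, _root_.map_inv, action_bg h2, MulAut.mul_apply,
      artin_inv_of_of_ne (by omega) (by omega), ih]

theorem action_fix_of_ge {n : ℕ} (γ : BraidGroup n) {i : ℕ}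
    (hi : n ≤ i) : action n γ (of i) = of i := by
  have hγ : γ ∈ tailSubgroup n 0 := by simp [tailSubgroup_zero]
  induction hγ using tailSubgroup_induction with
  | one => simp
  | mul γ _ j h1 h2 ih =>
    rw [_root_.map_mul, action_bg h2, MulAut.mul_apply, artin_of_of_ne (by omega) (by omega), ih]
  | mul_inv γ _ j h1 h2 ih =>
    rw [_root_.map_mul, _root_.map_inv, action_bg h2, MulAut.mul_apply,
      artin_inv_of_of_ne (by omega) (by omega), ih]

/-- The product `t_k t_{k+1} ⋯ t_{k+m-1}`. -/
def tprod (k m : ℕ) : FreeGroup ℕ := ((List.range' k m).map of).prod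

theorem tprod_succ (k m : ℕ) : tprod k (m + 1) = of k * tprod (k + 1) m := by
  simp [tprod, List.range'_succ]

theorem tprod_add (k l m : ℕ) : tprod k (l + m) = tprod k l * tprod (k + l) m := by
  rw [tprod, ← List.range'_append_1, map_append, prod_append, tprod, tprod]

theorem map_tprod_of_fix {φ : MulAut (FreeGroup ℕ)} {k m : ℕ}
    (h : ∀ i, k ≤ i → i < k + m → φ (of i) = of i) : φ (tprod k m) = tprod k m := by
  rw [tprod, map_list_prod, map_map]
  congr 1
  apply List.map_congr_left
  intro i hi
  rw [List.mem_range'_1] at hi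
  exact h i hi.1 hi.2

theorem artin_tprod {i k m : ℕ} (h : k ≤ i) (h' : i + 1 < k + m) :
    artin i (tprod k m) = tprod k m := by
  obtain ⟨a, rfl⟩ := Nat.exists_eq_add_of_le h
  obtain ⟨b, rfl⟩ : ∃ b, m = a + (b + 1 + 1) := ⟨m - a - 2, by omega⟩
  rw [tprod_add, tprod_succ, tprod_succ, _root_.map_mul, _root_.map_mul, _root_.map_mul,
    map_tprod_of_fix (k := k), map_tprod_of_fix (k := k + a + 1 + 1), artin_of_self,
    artin_of_succ]
  · group
  · exact fun j h1 h2 => artin_of_of_ne (by omega) (by omega)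
  · exact fun j h1 h2 => artin_of_of_ne (by omega) (by omega)

theorem action_tprod {n : ℕ} (γ : BraidGroup n) : action n γ (tprod 0 n) = tprod 0 n := by
  have hγ : γ ∈ tailSubgroup n 0 := by simp [tailSubgroup_zero]
  induction hγ using tailSubgroup_induction with
  | one => simp
  | mul γ _ j h1 h2 ih =>
    rw [_root_.map_mul, action_bg h2, MulAut.mul_apply, artin_tprod (by omega) (by omega), ih]
  | mul_inv γ _ j h1 h2 ih =>
    have : (artin j)⁻¹ (tprod 0 n) = tprod 0 n := by
      rw [MulAut.inv_apply, MulEquiv.symm_apply_eq, artin_tprod (by omega) (by omega)]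
    rw [_root_.map_mul, _root_.map_inv, action_bg h2, MulAut.mul_apply, this, ih]

theorem action_tprod_of_fix {n k : ℕ} {γ : BraidGroup n} (hk : k ≤ n)
    (h : ∀ i < k, action n γ (of i) = of i) :
    action n γ (tprod k (n - k)) = tprod k (n - k) := by
  have h1 := action_tprod γ
  have h2 := tprod_add 0 k (n - k)
  rw [show k + (n - k) = n by omega, zero_add] at h2
  rwa [h2, _root_.map_mul, map_tprod_of_fix (fun i _ hi => h i (by omega)), mul_right_inj] at h1

theorem action_of_isConj {n : ℕ} (γ : BraidGroup n) (i : ℕ) :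
    ∃ v a, action n γ (of i) = v * of a * v⁻¹ := by
  have hγ : γ ∈ tailSubgroup n 0 := by simp [tailSubgroup_zero]
  induction hγ using tailSubgroup_induction generalizing i with
  | one => exact ⟨1, i, by simp⟩
  | mul γ _ j h1 h2 ih =>
    rw [_root_.map_mul, action_bg h2, MulAut.mul_apply]
    by_cases hi : i = j
    · rw [hi, artin_of_self]
      exact ih _
    by_cases hi' : i = j + 1
    · obtain ⟨v, a, h⟩ := ih j
      refine ⟨(action n γ (of (j + 1)))⁻¹ * v, a, ?_⟩
      rw [hi', artin_of_succ, _root_.map_mul, _root_.map_mul, _root_.map_inv, h]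
      group
    · rw [artin_of_of_ne hi hi']
      exact ih _
  | mul_inv γ _ j h1 h2 ih =>
    rw [_root_.map_mul, _root_.map_inv, action_bg h2, MulAut.mul_apply]
    by_cases hi : i = j
    · obtain ⟨v, a, h⟩ := ih (j + 1)
      refine ⟨action n γ (of j) * v, a, ?_⟩
      rw [hi, artin_inv_of_self, _root_.map_mul, _root_.map_mul, _root_.map_inv, h]
      group
    by_cases hi' : i = j + 1
    · rw [hi', artin_inv_of_succ]
      exact ih _
    · rw [artin_inv_of_of_ne hi hi']
      exact ih _

theorem exists_reduced_conjugator (a : ℕ) (W : List (ℕ × Bool)) (hW : IsReduced W) :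
    ∃ P, ∃ e : ℤ, FreeGroup.mk W = FreeGroup.mk P * of a ^ e ∧
      IsReduced (Conj.word (P, (a, true))) := by
  induction W using List.reverseRecOn with
  | nil => exact ⟨[], 0, by simp, by simp [Conj.word, FreeGroup.IsReduced]⟩
  | append_singleton W x ih =>
    by_cases hx : x.1 = a
    · obtain ⟨P, e, h1, h2⟩ := ih (hW.infix ⟨[], [x], by simp⟩)
      obtain ⟨x, b⟩ := x
      simp only at hx
      subst hx
      cases b
      · refine ⟨P, e - 1, ?_, h2⟩
        rw [← mul_mk, h1, zpow_sub_one, mul_assoc]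
        rfl
      · refine ⟨P, e + 1, ?_, h2⟩
        rw [← mul_mk, h1, zpow_add_one, mul_assoc]
        rfl
    · refine ⟨W ++ [x], 0, by simp, ?_⟩
      rw [Conj.word, isReduced_append]
      refine ⟨hW, ?_, ?_⟩
      · have : IsReduced (invRev (W ++ [x])) := by
          apply IsReduced.of_reduce_eq
          rw [reduce_invRev, hW.reduce_eq]
        rw [invRev_append] at this ⊢
        simp only [invRev, map_cons, map_nil, reverse_cons, reverse_nil, nil_append,
          singleton_append] at this ⊢
        rw [isReduced_cons_cons]
        exact ⟨fun h => absurd h.symm hx, this⟩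
      · simp only [getLast?_append, getLast?_singleton, Option.some_or, Option.mem_def,
          Option.some.injEq, head?_cons]
        rintro _ rfl _ rfl h
        exact absurd h hx

theorem exists_conj_of_isConj (v : FreeGroup ℕ) (a : ℕ) :
    ∃ P, Conj.val (P, (a, true)) = v * of a * v⁻¹ ∧ IsReduced (Conj.word (P, (a, true))) := by
  obtain ⟨P, e, h1, h2⟩ := exists_reduced_conjugator a v.toWord isReduced_toWord
  refine ⟨P, ?_, h2⟩
  rw [mk_toWord] at h1
  have : Conj.val (P, (a, true)) = FreeGroup.mk P * of a * (FreeGroup.mk P)⁻¹ := by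
    simp [Conj.val, Conj.word, inv_mk, mul_mk, FreeGroup.of]
  rw [this, h1]
  group

/-- The image of `t_i` as a reduced marked conjugate. -/
theorem exists_item {n : ℕ} (γ : BraidGroup n) (i : ℕ) :
    ∃ c : Conj, c.val = action n γ (of i) ∧ IsReduced c.word ∧ c.2.2 = true := by
  obtain ⟨v, a, h⟩ := action_of_isConj γ i
  obtain ⟨P, h1, h2⟩ := exists_conj_of_isConj v a
  exact ⟨(P, (a, true)), by rw [h1, h], h2, rfl⟩

/-- The total length of the images of the free generators. -/
noncomputable def weight {n : ℕ} (γ : BraidGroup n) : ℕ :=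
  ∑ i ∈ Finset.range n, (action n γ (of i)).norm

theorem sum_lt_sum_of_swap {s : Finset ℕ} {f g : ℕ → ℕ} {i j : ℕ} (hi : i ∈ s) (hj : j ∈ s)
    (hij : i ≠ j) (h1 : g i ≤ f j) (h2 : g j < f i) (h3 : ∀ k, k ≠ i → k ≠ j → g k = f k) :
    ∑ k ∈ s, g k < ∑ k ∈ s, f k := by
  have hj' : j ∈ s.erase i := Finset.mem_erase.2 ⟨hij.symm, hj⟩
  rw [← Finset.add_sum_erase s f hi, ← Finset.add_sum_erase s g hi,
    ← Finset.add_sum_erase _ f hj', ← Finset.add_sum_erase _ g hj']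
  have : ∑ k ∈ (s.erase i).erase j, g k = ∑ k ∈ (s.erase i).erase j, f k := by
    apply Finset.sum_congr rfl
    intro k hk
    simp only [Finset.mem_erase] at hk
    exact h3 k hk.2.1 hk.1
  omega

theorem Conj.val_eq (c : Conj) :
    c.val = FreeGroup.mk c.1 * FreeGroup.mk [c.2] * (FreeGroup.mk c.1)⁻¹ := by
  simp [Conj.val, Conj.word, inv_mk, mul_mk]

theorem mk_not (x : ℕ × Bool) : FreeGroup.mk [(x.1, !x.2)] = (FreeGroup.mk [x])⁻¹ := by
  simp [inv_mk, invRev]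

theorem Conj.norm_val_le (c : Conj) : c.val.norm ≤ 2 * c.1.length + 1 := by
  refine FreeGroup.norm_mk_le.trans ?_
  simp [Conj.word]
  omega

theorem Conj.norm_val {c : Conj} (hc : IsReduced c.word) : c.val.norm = 2 * c.1.length + 1 := by
  rw [Conj.val, norm_mk_of_isReduced hc]
  simp [Conj.word]
  omega

theorem weight_mul_bg_lt {n i : ℕ} (hi : i + 1 < n) (γ : BraidGroup n) {c d : Conj}
    (hc : c.val = action n γ (of i)) (hd : d.val = action n γ (of (i + 1)))
    (hr : IsReduced c.word) (h : d.1 ++ [d.2] <+: c.1) :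
    weight (γ * bg n i) < weight γ := by
  have hact : ∀ j, action n (γ * bg n i) (of j) = action n γ (artin i (of j)) := by
    intro j
    rw [_root_.map_mul, action_bg hi, MulAut.mul_apply]
  apply sum_lt_sum_of_swap (i := i) (j := i + 1) (by simp; omega) (by simp; omega) (by omega)
  · rw [hact, artin_of_self]
  · rw [hact, artin_of_succ, _root_.map_mul, _root_.map_mul, _root_.map_inv, ← hc, ← hd,
      Conj.norm_val hr]
    obtain ⟨R, hR⟩ := h
    have : d.val⁻¹ * c.val * d.val = Conj.val (d.1 ++ R, c.2) := by
      simp only [Conj.val_eq, ← hR, ← mul_mk]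
      group
    rw [this]
    refine (Conj.norm_val_le _).trans_lt ?_
    rw [← hR]
    simp
  · intro j h1 h2
    rw [hact, artin_of_of_ne h1 h2]

theorem weight_mul_bg_inv_lt {n i : ℕ} (hi : i + 1 < n) (γ : BraidGroup n) {c d : Conj}
    (hc : c.val = action n γ (of i)) (hd : d.val = action n γ (of (i + 1)))
    (hr : IsReduced d.word) (h : c.1 ++ [(c.2.1, !c.2.2)] <+: d.1) :
    weight (γ * (bg n i)⁻¹) < weight γ := by
  have hact : ∀ j, action n (γ * (bg n i)⁻¹) (of j) = action n γ ((artin i)⁻¹ (of j)) := by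
    intro j
    rw [_root_.map_mul, _root_.map_inv, action_bg hi, MulAut.mul_apply]
  apply sum_lt_sum_of_swap (i := i + 1) (j := i) (by simp; omega) (by simp; omega) (by omega)
  · rw [hact, artin_inv_of_succ]
  · rw [hact, artin_inv_of_self, _root_.map_mul, _root_.map_mul, _root_.map_inv, ← hc, ← hd,
      Conj.norm_val hr]
    obtain ⟨R, hR⟩ := h
    have : c.val * d.val * c.val⁻¹ = Conj.val (c.1 ++ R, d.2) := by
      simp only [Conj.val_eq, ← hR, ← mul_mk, mk_not]
      group
    rw [this]
    refine (Conj.norm_val_le _).trans_lt ?_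
    rw [← hR]
    simp
  · intro j h1 h2
    rw [hact, artin_inv_of_of_ne h2 h1]

/-- A reduced marked conjugate representing the image of `t_i`. -/
noncomputable def item {n : ℕ} (γ : BraidGroup n) (i : ℕ) : Conj := (exists_item γ i).choose

theorem item_val {n : ℕ} (γ : BraidGroup n) (i : ℕ) : (item γ i).val = action n γ (of i) :=
  (exists_item γ i).choose_spec.1

theorem item_isReduced {n : ℕ} (γ : BraidGroup n) (i : ℕ) : IsReduced (item γ i).word :=
  (exists_item γ i).choose_spec.2.1

theorem isReduced_of_mem_map_item {n : ℕ} (γ : BraidGroup n) (l : List ℕ) :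
    ∀ d ∈ l.map (item γ), IsReduced (Conj.word d) := by
  intro d hd
  obtain ⟨i, _, rfl⟩ := List.mem_map.1 hd
  exact item_isReduced γ i

theorem item_positive {n : ℕ} (γ : BraidGroup n) (i : ℕ) : (item γ i).2.2 = true :=
  (exists_item γ i).choose_spec.2.2

theorem prefix_or_prefix_of_not_good {c d : Conj} (hc : c.2.2 = true) (hd : d.2.2 = true)
    (h : ¬ Conj.Good c d) : c.1 ++ [(c.2.1, !c.2.2)] <+: d.1 ∨ d.1 ++ [d.2] <+: c.1 := by
  rw [Conj.Good, not_and_or, not_not, not_not] at h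
  refine h.imp_left fun h => ?_
  rw [List.prefix_concat_iff] at h
  refine h.resolve_left fun h => ?_
  have := (append_inj' h rfl).2
  simp only [cons.injEq, and_true] at this
  rw [← this, hc] at hd
  simp at hd

theorem isChain_range' {R : ℕ → ℕ → Prop} {k m : ℕ}
    (h : ∀ i, k ≤ i → i + 1 < k + m → R i (i + 1)) : (List.range' k m).IsChain R := by
  refine List.IsChain.imp_of_mem_imp (R := fun a b => b = a + 1) ?_ ?_
  · intro a b ha hb hab
    subst hab
    rw [List.mem_range'_1] at ha hb
    exact h a ha.1 hb.2
  · exact List.isChain_range' _ _ _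

theorem good_or_exists_weight_lt {n : ℕ} (γ : BraidGroup n) (k : ℕ) :
    (((List.range' k (n - k)).map (item γ)).IsChain Conj.Good) ∨
      ∃ g ∈ tailSubgroup n k, weight (γ * g) < weight γ := by
  by_cases h : ∀ i, k ≤ i → i + 1 < n → Conj.Good (item γ i) (item γ (i + 1))
  · left
    rw [List.isChain_map]
    exact isChain_range' fun i h1 h2 => h i h1 (by omega)
  · right
    push Not at h
    obtain ⟨i, h1, h2, h3⟩ := h
    rcases prefix_or_prefix_of_not_good (item_positive γ i) (item_positive γ (i + 1)) h3 with h | h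
    · exact ⟨_, inv_mem (bg_mem_tailSubgroup h1), weight_mul_bg_inv_lt h2 γ (item_val γ i)
        (item_val γ (i + 1)) (item_isReduced γ _) h⟩
    · exact ⟨_, bg_mem_tailSubgroup h1, weight_mul_bg_lt h2 γ (item_val γ i)
        (item_val γ (i + 1)) (item_isReduced γ _) h⟩

theorem tprod_eq_mk (k m : ℕ) :
    tprod k m = FreeGroup.mk ((List.range' k m).map fun i => (i, true)) := by
  induction m generalizing k with
  | zero => simp [tprod, ← one_eq_mk]
  | succ m ih => rw [tprod_succ, ih, List.range'_succ, FreeGroup.of, mul_mk]; rfl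

theorem prod_item {n k : ℕ} (γ : BraidGroup n) (hk : k ≤ n)
    (h : ∀ i < k, action n γ (of i) = of i) :
    (((List.range' k (n - k)).map (item γ)).map Conj.val).prod = tprod k (n - k) := by
  rw [← action_tprod_of_fix hk h, tprod, map_list_prod, map_map, map_map]
  congr 1
  apply List.map_congr_left
  intro i _
  exact item_val γ i

theorem action_fix_of_good {n k : ℕ} (γ : BraidGroup n) (hk : k ≤ n)
    (h : ∀ i < k, action n γ (of i) = of i)
    (hg : ((List.range' k (n - k)).map (item γ)).IsChain Conj.Good) : action n γ = 1 := by
  have hp := prod_item γ hk h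
  rw [tprod_eq_mk] at hp
  have := eq_of_good_of_prod_eq _ _ (isReduced_of_mem_map_item γ _) hg (by simp) hp
  rw [map_map, List.map_inj_left] at this
  apply mulAut_ext
  intro i
  rw [MulAut.one_apply]
  by_cases h1 : i < k
  · exact h i h1
  by_cases h2 : i < n
  · rw [← item_val, this i (by rw [List.mem_range'_1]; omega)]
    simp [Conj.val, Conj.word, FreeGroup.of]
  · exact action_fix_of_ge γ (by omega)

theorem action_mul_fix {n k i : ℕ} (γ : BraidGroup n) {g : BraidGroup n}
    (hg : g ∈ tailSubgroup n k) (hi : i < k) : action n (γ * g) (of i) = action n γ (of i) := by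
  rw [_root_.map_mul, MulAut.mul_apply, action_fix_of_lt hg hi]

theorem mem_tailSubgroup_of_fix {n k : ℕ} (hinj : ∀ γ : BraidGroup n, action n γ = 1 → γ = 1)
    (hk : k ≤ n) (γ : BraidGroup n) (h : ∀ i < k, action n γ (of i) = of i) :
    γ ∈ tailSubgroup n k := by
  induction hw : weight γ using Nat.strong_induction_on generalizing γ with
  | _ w ih =>
    subst hw
    rcases good_or_exists_weight_lt γ k with hg | ⟨g, hg, hlt⟩
    · rw [hinj γ (action_fix_of_good γ hk h hg)]
      exact one_mem _
    · have := ih _ hlt (γ * g) (fun i hi => by rw [action_mul_fix γ hg hi, h i hi]) rfl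
      exact (mul_mem_cancel_right hg).1 this

/-- The submonoid of words in which the lowest letter `σ_k` only occurs as `σ_k⁻¹`. -/
def negSubmonoid (n k : ℕ) : Submonoid (BraidGroup n) :=
  Submonoid.closure ((tailSubgroup n (k + 1) : Set (BraidGroup n)) ∪ {(bg n k)⁻¹})

theorem mem_negSubmonoid_of_mem_tail {n k : ℕ} {g : BraidGroup n}
    (hg : g ∈ tailSubgroup n (k + 1)) : g ∈ negSubmonoid n k :=
  Submonoid.subset_closure (Or.inl hg)

theorem tailSubgroup_anti {n k l : ℕ} (h : k ≤ l) : tailSubgroup n l ≤ tailSubgroup n k :=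
  Subgroup.closure_mono fun _ ⟨j, h1, h2, h3⟩ => ⟨j, h.trans h1, h2, h3⟩

theorem mem_negSubmonoid_of_head {n k : ℕ}
    (hinj : ∀ γ : BraidGroup n, action n γ = 1 → γ = 1) (hk : k < n) (γ : BraidGroup n)
    (h : ∀ i < k, action n γ (of i) = of i)
    (hh : ∃ W, (action n γ (of k)).toWord = (k, true) :: W) : γ ∈ negSubmonoid n k := by
  induction hw : weight γ using Nat.strong_induction_on generalizing γ with
  | _ w ih =>
    subst hw
    by_cases hfix : action n γ (of k) = of k
    · apply mem_negSubmonoid_of_mem_tail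
      apply mem_tailSubgroup_of_fix hinj hk
      intro i hi
      rcases Nat.lt_succ_iff_lt_or_eq.1 hi with hi | rfl
      · exact h i hi
      · exact hfix
    obtain ⟨W, hW⟩ := hh
    obtain ⟨p', hp'⟩ : ∃ p', (item γ k).1 = (k, true) :: p' := by
      rw [← item_val, Conj.val, toWord_mk, (item_isReduced γ k).reduce_eq, Conj.word] at hW
      rcases hp : (item γ k).1 with _ | ⟨u, p⟩
      · rw [hp] at hW
        simp only [nil_append, cons.injEq] at hW
        exfalso
        apply hfix
        rw [← item_val, Conj.val, Conj.word, hp, hW.1]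
        rfl
      · rw [hp, cons_append, cons.injEq] at hW
        exact ⟨p, by rw [hW.1]⟩
    rcases good_or_exists_weight_lt γ (k + 1) with hg | ⟨g, hg, hlt⟩
    swap
    · have hg' := tailSubgroup_anti (Nat.le_succ k) hg
      have := ih _ hlt (γ * g) (fun i hi => by rw [action_mul_fix γ hg' hi, h i hi])
        ⟨W, by rw [action_mul_fix γ hg (Nat.lt_succ_self k), hW]⟩ rfl
      have h2 := mul_mem this (mem_negSubmonoid_of_mem_tail (inv_mem hg))
      rwa [mul_inv_cancel_right] at h2
    by_cases hk1 : k + 1 < n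
    swap
    · exfalso
      have := action_tprod_of_fix hk.le h
      rw [show n - k = 0 + 1 by omega, tprod_succ] at this
      simp [tprod, hfix] at this
    obtain ⟨m, hm⟩ : ∃ m, n - (k + 1) = m + 1 := ⟨n - k - 2, by omega⟩
    have hm' : n - k = m + 1 + 1 := by omega
    rw [hm, List.range'_succ, map_cons] at hg
    have hp := prod_item γ hk.le h
    rw [tprod_eq_mk, hm', List.range'_succ, List.range'_succ] at hp
    simp only [map_cons] at hp
    rw [prod_cons] at hp
    by_cases hG : Conj.Good (item γ k) (item γ (k + 1))
    · exfalso
      apply hfix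
      rw [action_fix_of_good γ hk.le h, MulAut.one_apply]
      rw [hm', List.range'_succ, List.range'_succ, map_cons, map_cons, isChain_cons_cons]
      exact ⟨hG, hg⟩
    rcases prefix_or_prefix_of_not_good (item_positive γ k) (item_positive γ (k + 1)) hG
      with hpre | hpre
    · exfalso
      obtain ⟨q, hq⟩ := hpre
      rw [hp'] at hq
      have he : item γ (k + 1) = ((k, true) :: p' ++
          ((item γ k).2.1, !(item γ k).2.2) :: q, (item γ (k + 1)).2) := by
        rw [Prod.ext_iff]
        exact ⟨by rw [← hq]; simp, rfl⟩
      have he' : item γ k = ((k, true) :: p', (item γ k).2) := by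
        rw [← hp']
      rw [he] at hg
      refine not_absorbed_of_prod_eq (k, true) p' q (item γ k).2 (item γ (k + 1)).2
        ((List.range' (k + 1 + 1) m).map (item γ))
        ((k + 1, true) :: (List.range' (k + 1 + 1) m).map fun i => (i, true)) ?_ hg ?_ ?_
      · rw [← he]
        exact isReduced_of_mem_map_item γ (_ :: _)
      · simp
      · rw [← hp, ← he, ← he']
        rfl
    · have hlt := weight_mul_bg_lt hk1 γ (item_val γ k) (item_val γ (k + 1))
        (item_isReduced γ _) hpre
      have hg' : bg n k ∈ tailSubgroup n k := bg_mem_tailSubgroup le_rfl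
      have := ih _ hlt (γ * bg n k) (fun i hi => by rw [action_mul_fix γ hg' hi, h i hi]) ?_ rfl
      · have h2 := mul_mem this (Submonoid.subset_closure (s :=
          (tailSubgroup n (k + 1) : Set (BraidGroup n)) ∪ {(bg n k)⁻¹}) (Or.inr rfl))
        rwa [mul_inv_cancel_right] at h2
      · rw [_root_.map_mul, action_bg hk1, MulAut.mul_apply, artin_of_self, ← item_val, Conj.val,
          toWord_mk, (item_isReduced γ _).reduce_eq, Conj.word]
        rw [hp'] at hpre
        rcases hd : (item γ (k + 1)).1 with _ | ⟨u, d⟩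
        · rw [hd, nil_append, cons_prefix_cons] at hpre
          exact ⟨_, by rw [nil_append, hpre.1]⟩
        · rw [hd, cons_append, cons_prefix_cons] at hpre
          exact ⟨_, by rw [cons_append, hpre.1]⟩

/-- The coset representative `σ_k⁻¹ σ_{k+1}⁻¹ ⋯ σ_{j-1}⁻¹`. -/
def rep (n k j : ℕ) : BraidGroup n := ((List.range' k (j - k)).map fun i => (bg n i)⁻¹).prod

theorem rep_self (n k : ℕ) : rep n k k = 1 := by simp [rep]

theorem rep_succ (n : ℕ) {k j : ℕ} (h : k ≤ j) : rep n k (j + 1) = rep n k j * (bg n j)⁻¹ := by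
  rw [rep, show j + 1 - k = (j - k) + 1 by omega, List.range'_concat, map_append, prod_append, rep]
  simp [show k + (j - k) = j by omega]

/-- The pure braid `c_j σ_j² c_j⁻¹`, where `c_j` is the coset representative. -/
def pureGen (n k j : ℕ) : BraidGroup n := rep n k j * bg n j * bg n j * (rep n k j)⁻¹

theorem bg_comm' {n i j : ℕ} (h : i + 2 ≤ j) : Commute (bg n i) (bg n j) := bg_comm h

theorem rep_commute {n k j i : ℕ} (h : k ≤ j) (hi : j < i) : Commute (rep n k j) (bg n i) := by
  induction j, h using Nat.le_induction with
  | base => rw [rep_self]; exact Commute.one_left _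
  | succ j h ih =>
    rw [rep_succ n h]
    exact (ih (by omega)).mul_left (bg_comm' (by omega)).inv_left

theorem rep_mul_bg {n k j i : ℕ} (hk : k ≤ i) (hij : i + 2 ≤ j) (hj : j < n) :
    rep n k j * bg n i = bg n (i + 1) * rep n k j := by
  induction j, hij using Nat.le_induction with
  | base =>
    have h1 := (rep_commute (n := n) hk (Nat.lt_succ_self i)).eq
    have h2 := bg_braid hj
    have h3 : (bg n i)⁻¹ * (bg n (i + 1))⁻¹ * bg n i
        = bg n (i + 1) * (bg n i)⁻¹ * (bg n (i + 1))⁻¹ := by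
      rw [← mul_inv_rev, inv_mul_eq_iff_eq_mul, ← mul_assoc, ← mul_assoc, eq_mul_inv_iff_mul_eq,
        eq_mul_inv_iff_mul_eq]
      rw [← h2]
    rw [rep_succ n (by omega), rep_succ n hk, mul_assoc, mul_assoc, ← mul_assoc (bg n i)⁻¹, h3,
      ← mul_assoc, ← mul_assoc, h1]
    simp only [mul_assoc]
  | succ j h ih =>
    have h1 : Commute (bg n i) (bg n j)⁻¹ := (bg_comm' h).inv_right
    rw [rep_succ n (by omega), mul_assoc, ← h1.eq, ← mul_assoc, ih (by omega), mul_assoc]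

theorem pureGen_commute {n k j i : ℕ} (hj : k ≤ j) (hjn : j + 1 < n) (hi : k < i)
    (hij : i < j ∨ j + 2 ≤ i) : Commute (pureGen n k j) (bg n i) := by
  rcases hij with hij | hij
  · obtain ⟨i, rfl⟩ : ∃ l, i = l + 1 := ⟨i - 1, by omega⟩
    have h1 : bg n (i + 1) = rep n k j * bg n i * (rep n k j)⁻¹ := by
      rw [rep_mul_bg (by omega) (by omega) (by omega), mul_inv_cancel_right]
    have h2 : Commute (bg n j * bg n j) (bg n i) :=
      ((bg_comm' (by omega)).mul_right (bg_comm' (by omega))).symm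
    rw [h1, pureGen, mul_assoc (rep n k j)]
    exact (Commute.conj_iff _).2 h2
  · have h1 : Commute (rep n k j) (bg n i) := rep_commute hj (by omega)
    have h2 : Commute (bg n j) (bg n i) := bg_comm' hij
    exact ((h1.mul_left h2).mul_left h2).mul_left h1.inv_left

theorem bg_conj_bg {n j : ℕ} (h : j + 2 < n) :
    (bg n (j + 1))⁻¹ * bg n j * bg n (j + 1) = bg n j * bg n (j + 1) * (bg n j)⁻¹ := by
  rw [eq_mul_inv_iff_mul_eq, mul_assoc, mul_assoc, inv_mul_eq_iff_eq_mul, ← mul_assoc,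
    ← mul_assoc, bg_braid h]

theorem conj_conj_of_commute {G : Type*} [Group G] {c t : G} (h : Commute c t) (y : G) :
    t⁻¹ * (c * y * c⁻¹) * t = c * (t⁻¹ * y * t) * c⁻¹ := by
  have e1 : c⁻¹ * t = t * c⁻¹ := h.inv_left.eq
  have e2 : t⁻¹ * c = c * t⁻¹ := h.inv_right.eq.symm
  calc t⁻¹ * (c * y * c⁻¹) * t = (t⁻¹ * c) * y * (c⁻¹ * t) := by group
    _ = c * (t⁻¹ * y * t) * c⁻¹ := by rw [e1, e2]; group

theorem conj_eq_of_conj_inv_eq {G : Type*} [Group G] {g a b : G} (h1 : g⁻¹ * b * g = a)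
    (h2 : g⁻¹ * a * g = a * b * a⁻¹) : g * b * g⁻¹ = b⁻¹ * a * b := by
  have e : g * a * g⁻¹ = b := by rw [← h1]; group
  have : a = b * (g * b * g⁻¹) * b⁻¹ := by
    calc a = g * (g⁻¹ * a * g) * g⁻¹ := by group
      _ = (g * a * g⁻¹) * (g * b * g⁻¹) * (g * a * g⁻¹)⁻¹ := by rw [h2]; group
      _ = b * (g * b * g⁻¹) * b⁻¹ := by rw [e]
  rw [this]
  group

theorem pureGen_conj_succ {n k j : ℕ} (hj : k ≤ j) (h : j + 2 < n) :
    (bg n (j + 1))⁻¹ * pureGen n k (j + 1) * bg n (j + 1) = pureGen n k j := by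
  have h3 : (bg n j)⁻¹ * bg n (j + 1) * bg n j
      = bg n (j + 1) * bg n j * (bg n (j + 1))⁻¹ := by
    rw [eq_mul_inv_iff_mul_eq, mul_assoc, mul_assoc, inv_mul_eq_iff_eq_mul, ← mul_assoc,
      ← mul_assoc, bg_braid h]
  have e : pureGen n k (j + 1)
      = rep n k j * (((bg n j)⁻¹ * bg n (j + 1) * bg n j) * ((bg n j)⁻¹ * bg n (j + 1) * bg n j))
        * (rep n k j)⁻¹ := by
    rw [pureGen, rep_succ n hj]
    group
  rw [e, h3, conj_conj_of_commute (rep_commute hj (Nat.lt_succ_self j)), pureGen]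
  group

theorem pureGen_conj {n k j : ℕ} (hj : k ≤ j) (h : j + 2 < n) :
    (bg n (j + 1))⁻¹ * pureGen n k j * bg n (j + 1)
      = pureGen n k j * pureGen n k (j + 1) * (pureGen n k j)⁻¹ := by
  have e : (bg n (j + 1))⁻¹ * (bg n j * bg n j) * bg n (j + 1)
      = (bg n j * bg n (j + 1) * (bg n j)⁻¹) * (bg n j * bg n (j + 1) * (bg n j)⁻¹) := by
    rw [← bg_conj_bg h]
    group
  rw [pureGen, pureGen, mul_assoc (rep n k j) (bg n j),
    conj_conj_of_commute (rep_commute hj (Nat.lt_succ_self j)), e, rep_succ n hj]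
  group

/-- The subgroup generated by the pure braids `c_j σ_j² c_j⁻¹`. -/
def pureSubgroup (n k : ℕ) : Subgroup (BraidGroup n) :=
  Subgroup.closure {g | ∃ j, k ≤ j ∧ j + 1 < n ∧ g = pureGen n k j}

theorem pureGen_mem {n k j : ℕ} (hj : k ≤ j) (h : j + 1 < n) : pureGen n k j ∈ pureSubgroup n k :=
  Subgroup.subset_closure ⟨j, hj, h, rfl⟩

theorem conj_mem_closure {G : Type*} [Group G] {S : Set G} {g : G}
    (h : ∀ x ∈ S, g * x * g⁻¹ ∈ Subgroup.closure S) {x : G} (hx : x ∈ Subgroup.closure S) :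
    g * x * g⁻¹ ∈ Subgroup.closure S := by
  have : Subgroup.closure S ≤ (Subgroup.closure S).comap (MulAut.conj g).toMonoidHom := by
    rw [Subgroup.closure_le]
    exact fun y hy => h y hy
  exact this hx

theorem bg_conj_mem_pureSubgroup {n k i : ℕ} (hi : k < i) (hin : i + 1 < n) {x : BraidGroup n}
    (hx : x ∈ pureSubgroup n k) :
    bg n i * x * (bg n i)⁻¹ ∈ pureSubgroup n k ∧
      (bg n i)⁻¹ * x * bg n i ∈ pureSubgroup n k := by
  have key : ∀ j, k ≤ j → j + 1 < n → bg n i * pureGen n k j * (bg n i)⁻¹ ∈ pureSubgroup n k ∧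
      (bg n i)⁻¹ * pureGen n k j * bg n i ∈ pureSubgroup n k := by
    intro j hj hjn
    by_cases hc : i < j ∨ j + 2 ≤ i
    · have h := pureGen_commute hj hjn hi hc
      rw [← h.eq, mul_inv_cancel_right, mul_assoc, h.eq, inv_mul_cancel_left]
      exact ⟨pureGen_mem hj hjn, pureGen_mem hj hjn⟩
    obtain rfl | rfl : i = j ∨ i = j + 1 := by omega
    · obtain ⟨j, rfl⟩ : ∃ l, i = l + 1 := ⟨i - 1, by omega⟩
      have m1 := pureGen_mem (n := n) (show k ≤ j by omega) (show j + 1 < n by omega)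
      have m2 := pureGen_mem hj hjn
      have h1 := pureGen_conj_succ (n := n) (show k ≤ j by omega) (by omega)
      have h2 := pureGen_conj (n := n) (show k ≤ j by omega) (by omega)
      rw [h1, conj_eq_of_conj_inv_eq h1 h2]
      refine ⟨?_, m1⟩
      exact mul_mem (mul_mem (inv_mem m2) m1) m2
    · have m1 := pureGen_mem hj hjn
      have m2 := pureGen_mem (n := n) (show k ≤ j + 1 by omega) hin
      have h1 := pureGen_conj_succ hj hin
      rw [pureGen_conj hj hin]
      refine ⟨?_, mul_mem (mul_mem m1 m2) (inv_mem m1)⟩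
      rw [← h1]
      simpa [mul_assoc] using m2
  constructor
  · refine conj_mem_closure ?_ hx
    rintro _ ⟨j, h1, h2, rfl⟩
    exact (key j h1 h2).1
  · have := conj_mem_closure (g := (bg n i)⁻¹) ?_ hx
    · rwa [inv_inv] at this
    rintro _ ⟨j, h1, h2, rfl⟩
    rw [inv_inv]
    exact (key j h1 h2).2

theorem conj_mem_pureSubgroup {n k : ℕ} {h x : BraidGroup n} (hh : h ∈ tailSubgroup n (k + 1))
    (hx : x ∈ pureSubgroup n k) : h * x * h⁻¹ ∈ pureSubgroup n k := by
  induction hh using tailSubgroup_induction generalizing x with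
  | one => simpa using hx
  | mul γ _ j h1 h2 ih =>
    have := ih (bg_conj_mem_pureSubgroup h1 h2 hx).1
    simpa [mul_assoc] using this
  | mul_inv γ _ j h1 h2 ih =>
    have := ih (bg_conj_mem_pureSubgroup h1 h2 hx).2
    simpa [mul_assoc] using this

theorem exists_coset {n k : ℕ} (hk : k < n) {γ : BraidGroup n} (hγ : γ ∈ tailSubgroup n k) :
    ∃ x ∈ pureSubgroup n k, ∃ h ∈ tailSubgroup n (k + 1), ∃ j, k ≤ j ∧ j < n ∧
      γ = x * h * rep n k j := by
  induction hγ using tailSubgroup_induction with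
  | one => exact ⟨1, one_mem _, 1, one_mem _, k, le_rfl, hk, by simp [rep_self]⟩
  | mul γ _ i h1 h2 ih =>
    obtain ⟨x, hx, h, hh, j, hj, hjn, rfl⟩ := ih
    by_cases c1 : j < i
    · refine ⟨x, hx, h * bg n i, mul_mem hh (bg_mem_tailSubgroup (by omega)), j, hj, hjn, ?_⟩
      rw [mul_assoc, (rep_commute hj c1).eq]
      simp only [mul_assoc]
    by_cases c2 : i = j
    · subst c2
      refine ⟨x * (h * pureGen n k i * h⁻¹),
        mul_mem hx (conj_mem_pureSubgroup hh (pureGen_mem h1 h2)), h, hh, i + 1, by omega, h2, ?_⟩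
      rw [rep_succ n h1, pureGen]
      group
    by_cases c3 : j = i + 1
    · subst c3
      refine ⟨x, hx, h, hh, i, h1, by omega, ?_⟩
      rw [rep_succ n h1]
      group
    · refine ⟨x, hx, h * bg n (i + 1), mul_mem hh (bg_mem_tailSubgroup (by omega)), j, hj, hjn, ?_⟩
      rw [mul_assoc, rep_mul_bg h1 (by omega) hjn]
      simp only [mul_assoc]
  | mul_inv γ _ i h1 h2 ih =>
    obtain ⟨x, hx, h, hh, j, hj, hjn, rfl⟩ := ih
    by_cases c1 : j < i
    · refine ⟨x, hx, h * (bg n i)⁻¹, mul_mem hh (inv_mem (bg_mem_tailSubgroup (by omega))),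
        j, hj, hjn, ?_⟩
      rw [mul_assoc, (rep_commute hj c1).inv_right.eq]
      simp only [mul_assoc]
    by_cases c2 : i = j
    · subst c2
      refine ⟨x, hx, h, hh, i + 1, by omega, h2, ?_⟩
      rw [rep_succ n h1]
      group
    by_cases c3 : j = i + 1
    · subst c3
      refine ⟨x * (h * (pureGen n k i)⁻¹ * h⁻¹),
        mul_mem hx (conj_mem_pureSubgroup hh (inv_mem (pureGen_mem h1 h2))), h, hh, i, h1,
        by omega, ?_⟩
      rw [rep_succ n h1, pureGen]
      group
    · refine ⟨x, hx, h * (bg n (i + 1))⁻¹,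
        mul_mem hh (inv_mem (bg_mem_tailSubgroup (by omega))), j, hj, hjn, ?_⟩
      have : rep n k j * (bg n i)⁻¹ = (bg n (i + 1))⁻¹ * rep n k j := by
        rw [mul_inv_eq_iff_eq_mul, mul_assoc, rep_mul_bg h1 (by omega) hjn, inv_mul_cancel_left]
      rw [mul_assoc, this]
      simp only [mul_assoc]

/-- The endomorphism of the free group which kills `t_k`. -/
def kill (k : ℕ) : FreeGroup ℕ →* FreeGroup ℕ := FreeGroup.lift fun j => if j = k then 1 else of j

theorem kill_of_self (k : ℕ) : kill k (of k) = 1 := by simp [kill]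

theorem kill_of_of_ne {k j : ℕ} (h : j ≠ k) : kill k (of j) = of j := by simp [kill, h]

theorem mulAut_inv_apply_self (φ : MulAut (FreeGroup ℕ)) (x : FreeGroup ℕ) : φ⁻¹ (φ x) = x :=
  φ.symm_apply_apply x

theorem mulAut_apply_inv_self (φ : MulAut (FreeGroup ℕ)) (x : FreeGroup ℕ) : φ (φ⁻¹ x) = x :=
  φ.apply_symm_apply x

theorem hom_eq_of_of {G : Type*} [Group G] {f g : FreeGroup ℕ →* G}
    (h : ∀ j, f (of j) = g (of j)) (x : FreeGroup ℕ) : f x = g x :=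
  DFunLike.congr_fun (FreeGroup.ext_hom f g h) x

theorem kill_artin_artin (j : ℕ) (x : FreeGroup ℕ) :
    kill j (artin j (artin j x)) = kill j x := by
  refine hom_eq_of_of (f := (kill j).comp ((artin j).toMonoidHom.comp (artin j).toMonoidHom))
    (g := kill j) (fun i => ?_) x
  change kill j (artin j (artin j (of i))) = kill j (of i)
  by_cases h1 : i = j
  · subst h1
    simp [kill_of_self]
  by_cases h2 : i = j + 1
  · subst h2
    simp [kill_of_self]
  · rw [artin_of_of_ne h1 h2, artin_of_of_ne h1 h2]

theorem kill_artin_inv_congr {j : ℕ} {x y : FreeGroup ℕ} (h : kill (j + 1) x = kill (j + 1) y) :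
    kill j ((artin j)⁻¹ x) = kill j ((artin j)⁻¹ y) := by
  have key : ∀ z, kill j ((artin j)⁻¹ z)
      = FreeGroup.lift (fun i => if i = j then of (j + 1) else of i) (kill (j + 1) z) := by
    refine hom_eq_of_of (f := (kill j).comp ((artin j)⁻¹ : MulAut _).toMonoidHom)
      (g := (FreeGroup.lift fun i => if i = j then of (j + 1) else of i).comp (kill (j + 1)))
      (fun i => ?_)
    change kill j ((artin j)⁻¹ (of i)) = FreeGroup.lift _ (kill (j + 1) (of i))
    by_cases h1 : i = j
    · subst h1
      rw [artin_inv_of_self, kill_of_of_ne (by omega)]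
      simp [kill]
    by_cases h2 : i = j + 1
    · subst h2
      rw [artin_inv_of_succ, kill_of_self, kill_of_self, _root_.map_one]
    · rw [artin_inv_of_of_ne h1 h2, kill_of_of_ne h1, kill_of_of_ne h2]
      simp [h1]
  rw [key, key, h]

theorem action_rep_succ {n k j : ℕ} (hj : k ≤ j) (hjn : j + 1 < n) (x : FreeGroup ℕ) :
    action n (rep n k (j + 1)) x = action n (rep n k j) ((artin j)⁻¹ x) := by
  rw [rep_succ n hj, _root_.map_mul, _root_.map_inv, action_bg hjn, MulAut.mul_apply]

theorem kill_action_rep_congr {n k j : ℕ} (hj : k ≤ j) (hjn : j < n) {x y : FreeGroup ℕ}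
    (h : kill j x = kill j y) :
    kill k (action n (rep n k j) x) = kill k (action n (rep n k j) y) := by
  induction j, hj using Nat.le_induction generalizing x y with
  | base => simpa [rep_self] using h
  | succ j hj ih =>
    rw [action_rep_succ hj hjn, action_rep_succ hj hjn]
    exact ih (by omega) (kill_artin_inv_congr h)

theorem action_rep_of {n k j : ℕ} (hj : k ≤ j) (hjn : j < n) :
    action n (rep n k j) (of j) = of k := by
  induction j, hj using Nat.le_induction with
  | base => simp [rep_self]
  | succ j hj ih => rw [action_rep_succ hj hjn, artin_inv_of_succ, ih (by omega)]

theorem action_rep_of_lt {n k j i : ℕ} (hj : k ≤ j) (hjn : j < n) (hi : j < i) :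
    action n (rep n k j) (of i) = of i := by
  induction j, hj using Nat.le_induction with
  | base => simp [rep_self]
  | succ j hj ih =>
    rw [action_rep_succ hj hjn, artin_inv_of_of_ne (by omega) (by omega),
      ih (by omega) (by omega)]

theorem action_pureGen {n k j : ℕ} (hjn : j + 1 < n) (x : FreeGroup ℕ) :
    action n (pureGen n k j) x
      = action n (rep n k j) (artin j (artin j ((action n (rep n k j))⁻¹ x))) := by
  simp only [pureGen, _root_.map_mul, _root_.map_inv, action_bg hjn, MulAut.mul_apply]

theorem action_pureGen_of {n k j : ℕ} (hj : k ≤ j) (hjn : j + 1 < n) :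
    action n (pureGen n k j) (of k) = (of (j + 1))⁻¹ * of k * of (j + 1) := by
  rw [action_pureGen hjn]
  nth_rw 1 [← action_rep_of hj (by omega : j < n)]
  rw [mulAut_inv_apply_self, artin_of_self, artin_of_succ, _root_.map_mul, _root_.map_mul,
    _root_.map_inv, action_rep_of hj (by omega), action_rep_of_lt hj (by omega) (by omega)]

theorem kill_action_pureGen {n k j : ℕ} (hj : k ≤ j) (hjn : j + 1 < n) (x : FreeGroup ℕ) :
    kill k (action n (pureGen n k j) x) = kill k x := by
  rw [action_pureGen hjn, kill_action_rep_congr hj (by omega) (kill_artin_artin j _),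
    mulAut_apply_inv_self]

theorem kill_artin {k i : ℕ} (h : k < i) (x : FreeGroup ℕ) :
    kill k (artin i x) = artin i (kill k x) := by
  refine hom_eq_of_of (f := (kill k).comp (artin i).toMonoidHom)
    (g := (artin i).toMonoidHom.comp (kill k)) (fun j => ?_) x
  change kill k (artin i (of j)) = artin i (kill k (of j))
  by_cases h1 : j = k
  · subst h1
    rw [artin_of_of_ne (by omega) (by omega), kill_of_self, _root_.map_one]
  rw [kill_of_of_ne h1]
  by_cases h2 : j = i
  · subst h2
    rw [artin_of_self, kill_of_of_ne (by omega)]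
  by_cases h3 : j = i + 1
  · subst h3
    rw [artin_of_succ, _root_.map_mul, _root_.map_mul, _root_.map_inv, kill_of_of_ne (by omega),
      kill_of_of_ne (by omega)]
  · rw [artin_of_of_ne h2 h3, kill_of_of_ne h1]

theorem kill_action_tail {n k l : ℕ} (hkl : k < l) {h : BraidGroup n} (hh : h ∈ tailSubgroup n l)
    (x : FreeGroup ℕ) : kill k (action n h x) = action n h (kill k x) := by
  induction hh using tailSubgroup_induction generalizing x with
  | one => simp
  | mul γ _ j h1 h2 ih =>
    rw [_root_.map_mul, action_bg h2, MulAut.mul_apply, MulAut.mul_apply, ih,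
      kill_artin (by omega)]
  | mul_inv γ _ j h1 h2 ih =>
    rw [_root_.map_mul, _root_.map_inv, action_bg h2, MulAut.mul_apply, MulAut.mul_apply, ih]
    congr 1
    rw [← mulAut_inv_apply_self (artin j) (kill k ((artin j)⁻¹ x)), ← kill_artin (by omega),
      mulAut_apply_inv_self]

/-- The homomorphism sending `t_{j+1}` to the pure braid `c_j σ_j² c_j⁻¹`. -/
def pureHom (n k : ℕ) : FreeGroup ℕ →* BraidGroup n :=
  FreeGroup.lift fun i => if k < i ∧ i < n then pureGen n k (i - 1) else 1

/-- The endomorphism keeping the generators `t_i` with `k < i < n` and killing the others. -/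
def keep (n k : ℕ) : FreeGroup ℕ →* FreeGroup ℕ :=
  FreeGroup.lift fun i => if k < i ∧ i < n then of i else 1

theorem pureHom_of {n k i : ℕ} (h : k < i ∧ i < n) :
    pureHom n k (of i) = pureGen n k (i - 1) := by simp [pureHom, h]

theorem pureHom_of_not {n k i : ℕ} (h : ¬ (k < i ∧ i < n)) :
    pureHom n k (of i) = 1 := by simp [pureHom, h]

theorem keep_of {n k i : ℕ} (h : k < i ∧ i < n) : keep n k (of i) = of i := by simp [keep, h]

theorem keep_of_not {n k i : ℕ} (h : ¬ (k < i ∧ i < n)) : keep n k (of i) = 1 := by simp [keep, h]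

theorem pureHom_keep (n k : ℕ) (w : FreeGroup ℕ) : pureHom n k (keep n k w) = pureHom n k w := by
  refine hom_eq_of_of (f := (pureHom n k).comp (keep n k)) (g := pureHom n k) (fun i => ?_) w
  rw [MonoidHom.comp_apply]
  by_cases h : k < i ∧ i < n
  · rw [keep_of h]
  · rw [keep_of_not h, pureHom_of_not h, _root_.map_one]

theorem exists_pureHom_eq {n k : ℕ} {x : BraidGroup n} (hx : x ∈ pureSubgroup n k) :
    ∃ w, pureHom n k w = x := by
  have : pureSubgroup n k ≤ (pureHom n k).range := by
    rw [pureSubgroup, Subgroup.closure_le]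
    rintro _ ⟨j, h1, h2, rfl⟩
    exact ⟨of (j + 1), by rw [pureHom_of (by omega), Nat.add_sub_cancel]⟩
  exact this hx

theorem kill_action_pureHom {n k : ℕ} (w x : FreeGroup ℕ) :
    kill k (action n (pureHom n k w) x) = kill k x := by
  have hgen : ∀ i y, kill k (action n (pureHom n k (of i)) y) = kill k y := by
    intro i y
    by_cases h : k < i ∧ i < n
    · rw [pureHom_of h, kill_action_pureGen (by omega) (by omega)]
    · rw [pureHom_of_not h, _root_.map_one, MulAut.one_apply]
  induction w using FreeGroup.induction_on generalizing x with
  | C1 => simp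
  | of i => exact hgen i x
  | inv_of i _ =>
    rw [_root_.map_inv, _root_.map_inv, ← hgen i, mulAut_apply_inv_self]
  | mul a b iha ihb => rw [_root_.map_mul, _root_.map_mul, MulAut.mul_apply, iha, ihb]

theorem exists_action_pureHom {n k : ℕ} (w : FreeGroup ℕ) :
    ∃ v, action n (pureHom n k w) (of k) = v⁻¹ * of k * v ∧ kill k v = keep n k w := by
  induction w using FreeGroup.induction_on with
  | C1 => exact ⟨1, by simp⟩
  | of i =>
    by_cases h : k < i ∧ i < n
    · refine ⟨of i, ?_, by rw [keep_of h, kill_of_of_ne (by omega)]⟩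
      rw [pureHom_of h, action_pureGen_of (by omega) (by omega), Nat.sub_add_cancel (by omega)]
    · exact ⟨1, by rw [pureHom_of_not h]; simp, by rw [keep_of_not h, _root_.map_one]⟩
  | inv_of i ih =>
    obtain ⟨v, h1, h2⟩ := ih
    refine ⟨((action n (pureHom n k (of i)))⁻¹ v)⁻¹, ?_, ?_⟩
    · rw [_root_.map_inv, _root_.map_inv, MulAut.inv_apply, MulEquiv.symm_apply_eq, inv_inv,
        _root_.map_mul, _root_.map_mul, _root_.map_inv, mulAut_apply_inv_self, h1]
      group
    · have := kill_action_pureHom (n := n) (k := k) (of i)⁻¹ v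
      rw [_root_.map_inv, _root_.map_inv] at this
      rw [_root_.map_inv, _root_.map_inv, this, h2]
  | mul a b iha ihb =>
    obtain ⟨v, h1, h2⟩ := iha
    obtain ⟨u, h3, h4⟩ := ihb
    refine ⟨v * action n (pureHom n k a) u, ?_, ?_⟩
    · rw [_root_.map_mul, _root_.map_mul, MulAut.mul_apply, h3, _root_.map_mul, _root_.map_mul,
        _root_.map_inv, h1]
      group
    · rw [_root_.map_mul, kill_action_pureHom, h2, h4, _root_.map_mul]

theorem kill_eq_one_of_commute {k : ℕ} {v : FreeGroup ℕ} (h : v⁻¹ * of k * v = of k) :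
    kill k v = 1 := by
  obtain ⟨P, e, h1, h2⟩ := exists_reduced_conjugator k v⁻¹.toWord isReduced_toWord
  rw [mk_toWord] at h1
  have h3 : Conj.val (P, (k, true)) = of k := by
    have : Conj.val (P, (k, true)) = FreeGroup.mk P * of k * (FreeGroup.mk P)⁻¹ := Conj.val_eq _
    have hv : v = (FreeGroup.mk P * of k ^ e)⁻¹ := by rw [← h1, inv_inv]
    rw [this]
    nth_rw 2 [← h]
    rw [hv]
    group
  have h4 := Conj.norm_val h2
  rw [h3, norm_of] at h4
  have h5 : P = [] := by rw [← length_eq_zero_iff]; simpa using h4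
  rw [h5, ← one_eq_mk, one_mul] at h1
  rw [← inv_inv v, h1, _root_.map_inv, _root_.map_zpow, kill_of_self]
  simp

/-- The Artin representation is faithful on the subgroup of the last strands. -/
theorem eq_one_of_action_eq_one {n k : ℕ} (γ : BraidGroup n) (hγ : γ ∈ tailSubgroup n k)
    (h : action n γ = 1) : γ = 1 := by
  induction hd : n - k generalizing k γ with
  | zero =>
    induction hγ using tailSubgroup_induction with
    | one => rfl
    | mul γ _ j h1 h2 ih => omega
    | mul_inv γ _ j h1 h2 ih => omega
  | succ d ih =>
    have hk : k < n := by omega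
    obtain ⟨x, hx, g, hg, j, hkj, hjn, rfl⟩ := exists_coset hk hγ
    obtain ⟨w, rfl⟩ := exists_pureHom_eq hx
    obtain ⟨v, hv1, hv2⟩ := exists_action_pureHom (n := n) (k := k) w
    have hj := DFunLike.congr_fun h (of j)
    rw [_root_.map_mul, _root_.map_mul, MulAut.mul_apply, MulAut.mul_apply, MulAut.one_apply,
      action_rep_of hkj hjn, action_fix_of_lt hg (Nat.lt_succ_self k), hv1] at hj
    obtain rfl : j = k := by
      by_contra hne
      have := congrArg (kill k) hj
      rw [_root_.map_mul, _root_.map_mul, kill_of_self, kill_of_of_ne hne, _root_.map_inv] at this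
      simp at this
    rw [rep_self, mul_one] at h ⊢
    have hact : ∀ y, action n (pureHom n j w) (action n g y) = y := by
      intro y
      rw [← MulAut.mul_apply, ← _root_.map_mul, h, MulAut.one_apply]
    have hg1 : g = 1 := by
      refine ih g hg ?_ (by omega)
      apply mulAut_ext
      intro i
      rw [MulAut.one_apply]
      by_cases hi : i = j
      · rw [hi, action_fix_of_lt hg (Nat.lt_succ_self j)]
      · have := congrArg (kill j) (hact (of i))
        rwa [kill_action_pureHom, kill_action_tail (Nat.lt_succ_self j) hg,
          kill_of_of_ne hi] at this
    rw [hg1, mul_one, ← pureHom_keep, ← hv2, kill_eq_one_of_commute hj, _root_.map_one]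

theorem exists_mirror (n : ℕ) : ∃ φ : BraidGroup n →* BraidGroup n,
    ∀ i, i + 1 < n → φ (bg n i) = (bg n i)⁻¹ := by
  refine exists_hom n (fun i => (bg n i)⁻¹) ?_ ?_
  · intro i j h _
    rw [← mul_inv_rev, ← mul_inv_rev, bg_comm h]
  · intro i h
    rw [← mul_inv_rev, ← mul_inv_rev, ← mul_inv_rev, ← mul_inv_rev, ← mul_assoc, ← mul_assoc,
      bg_braid h]

/-- The mirror automorphism, sending each Artin generator to its inverse. -/
noncomputable def mirror (n : ℕ) : BraidGroup n →* BraidGroup n := (exists_mirror n).choose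

theorem mirror_bg {n i : ℕ} (h : i + 1 < n) : mirror n (bg n i) = (bg n i)⁻¹ :=
  (exists_mirror n).choose_spec i h

theorem mirror_mem_tailSubgroup {n k : ℕ} {γ : BraidGroup n} (hγ : γ ∈ tailSubgroup n k) :
    mirror n γ ∈ tailSubgroup n k := by
  induction hγ using tailSubgroup_induction with
  | one => simp
  | mul γ _ j h1 h2 ih =>
    rw [_root_.map_mul, mirror_bg h2]
    exact mul_mem ih (inv_mem (bg_mem_tailSubgroup h1))
  | mul_inv γ _ j h1 h2 ih =>
    rw [_root_.map_mul, _root_.map_inv, mirror_bg h2, inv_inv]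
    exact mul_mem ih (bg_mem_tailSubgroup h1)

theorem mirror_mirror {n : ℕ} (γ : BraidGroup n) : mirror n (mirror n γ) = γ := by
  have hγ : γ ∈ tailSubgroup n 0 := by simp [tailSubgroup_zero]
  induction hγ using tailSubgroup_induction with
  | one => simp
  | mul γ _ j h1 h2 ih =>
    rw [_root_.map_mul, _root_.map_mul, ih, mirror_bg h2, _root_.map_inv, mirror_bg h2, inv_inv]
  | mul_inv γ _ j h1 h2 ih =>
    rw [_root_.map_mul, _root_.map_mul, ih, _root_.map_inv, mirror_bg h2, inv_inv, mirror_bg h2]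

/-- The reflection of the free group `t_i ↦ (t_k ⋯ t_{i-1}) t_i⁻¹ (t_k ⋯ t_{i-1})⁻¹`. -/
def reflect (k : ℕ) : FreeGroup ℕ →* FreeGroup ℕ :=
  FreeGroup.lift fun i => tprod k (i - k) * (of i)⁻¹ * (tprod k (i - k))⁻¹

theorem reflect_of (k i : ℕ) :
    reflect k (of i) = tprod k (i - k) * (of i)⁻¹ * (tprod k (i - k))⁻¹ := by simp [reflect]

theorem tprod_zero (k : ℕ) : tprod k 0 = 1 := by simp [tprod]

theorem tprod_succ' (k m : ℕ) : tprod k (m + 1) = tprod k m * of (k + m) := by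
  rw [tprod_add, tprod_succ, tprod_zero, mul_one]

theorem reflect_of_le {k i : ℕ} (h : i ≤ k) : reflect k (of i) = (of i)⁻¹ := by
  rw [reflect_of, Nat.sub_eq_zero_of_le h, tprod_zero]
  simp

theorem reflect_tprod (k m : ℕ) : reflect k (tprod k m) = (tprod k m)⁻¹ := by
  induction m with
  | zero => simp [tprod_zero]
  | succ m ih =>
    rw [tprod_succ', _root_.map_mul, ih, reflect_of, Nat.add_sub_cancel_left]
    group

theorem reflect_reflect (k : ℕ) (x : FreeGroup ℕ) : reflect k (reflect k x) = x := by
  refine hom_eq_of_of (f := (reflect k).comp (reflect k)) (g := MonoidHom.id _) (fun i => ?_) x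
  rw [MonoidHom.comp_apply, MonoidHom.id_apply, reflect_of, _root_.map_mul, _root_.map_mul,
    _root_.map_inv, _root_.map_inv, reflect_tprod, reflect_of]
  group

theorem artin_inv_tprod_of_ne {k m j : ℕ} (hk : k ≤ j) (hm : k + m ≠ j + 1) :
    (artin j)⁻¹ (tprod k m) = tprod k m := by
  by_cases h : k + m ≤ j
  · exact map_tprod_of_fix fun i h1 h2 => artin_inv_of_of_ne (by omega) (by omega)
  · rw [MulAut.inv_apply, MulEquiv.symm_apply_eq, artin_tprod hk (by omega)]

theorem reflect_artin {k j : ℕ} (hk : k ≤ j) (x : FreeGroup ℕ) :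
    reflect k (artin j x) = (artin j)⁻¹ (reflect k x) := by
  refine hom_eq_of_of (f := (reflect k).comp (artin j).toMonoidHom)
    (g := ((artin j)⁻¹ : MulAut _).toMonoidHom.comp (reflect k)) (fun i => ?_) x
  change reflect k (artin j (of i)) = (artin j)⁻¹ (reflect k (of i))
  obtain ⟨m, rfl⟩ := Nat.exists_eq_add_of_le hk
  have e1 : k + m + 1 - k = m + 1 := by omega
  have e2 : (artin (k + m))⁻¹ (tprod k m) = tprod k m := artin_inv_tprod_of_ne hk (by omega)
  by_cases h1 : i = k + m
  · subst h1
    rw [artin_of_self, reflect_of, reflect_of, Nat.add_sub_cancel_left, e1, tprod_succ',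
      _root_.map_mul, _root_.map_mul, _root_.map_inv, _root_.map_inv, artin_inv_of_self, e2]
    group
  by_cases h2 : i = k + m + 1
  · subst h2
    rw [artin_of_succ, _root_.map_mul, _root_.map_mul, _root_.map_inv, reflect_of, reflect_of,
      Nat.add_sub_cancel_left, e1, tprod_succ', _root_.map_mul, _root_.map_mul, _root_.map_inv,
      _root_.map_inv, _root_.map_mul, artin_inv_of_self, artin_inv_of_succ, e2]
    group
  rw [artin_of_of_ne h1 h2]
  rcases Nat.le_total i k with h | h
  · rw [reflect_of_le h, _root_.map_inv, artin_inv_of_of_ne h1 h2]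
  · rw [reflect_of, _root_.map_mul, _root_.map_mul, _root_.map_inv, _root_.map_inv,
      artin_inv_of_of_ne h1 h2, artin_inv_tprod_of_ne hk (by omega)]

theorem reflect_action {n k : ℕ} {γ : BraidGroup n} (hγ : γ ∈ tailSubgroup n k)
    (x : FreeGroup ℕ) : reflect k (action n γ x) = action n (mirror n γ) (reflect k x) := by
  induction hγ using tailSubgroup_induction generalizing x with
  | one => simp
  | mul γ _ j h1 h2 ih =>
    rw [_root_.map_mul, _root_.map_mul, _root_.map_mul, mirror_bg h2, _root_.map_inv,
      action_bg h2, MulAut.mul_apply, MulAut.mul_apply, ih, reflect_artin h1]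
  | mul_inv γ _ j h1 h2 ih =>
    have := reflect_artin h1 ((artin j)⁻¹ x)
    rw [mulAut_apply_inv_self] at this
    rw [_root_.map_mul, _root_.map_mul, _root_.map_mul, _root_.map_inv, _root_.map_inv,
      mirror_bg h2, inv_inv, action_bg h2, MulAut.mul_apply, MulAut.mul_apply, ih, this,
      mulAut_apply_inv_self]

theorem action_mem_closure {n k : ℕ} {γ : BraidGroup n} (hγ : γ ∈ tailSubgroup n k) {i : ℕ}
    (hi : k ≤ i) : action n γ (of i) ∈ Subgroup.closure (of '' {i : ℕ | k ≤ i}) := by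
  induction hγ using tailSubgroup_induction generalizing i with
  | one => exact Subgroup.subset_closure ⟨i, hi, by simp⟩
  | mul γ _ j h1 h2 ih =>
    rw [_root_.map_mul, action_bg h2, MulAut.mul_apply]
    by_cases c1 : i = j
    · rw [c1, artin_of_self]
      exact ih (by omega)
    by_cases c2 : i = j + 1
    · rw [c2, artin_of_succ, _root_.map_mul, _root_.map_mul, _root_.map_inv]
      exact mul_mem (mul_mem (inv_mem (ih (by omega))) (ih h1)) (ih (by omega))
    · rw [artin_of_of_ne c1 c2]
      exact ih hi
  | mul_inv γ _ j h1 h2 ih =>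
    rw [_root_.map_mul, _root_.map_inv, action_bg h2, MulAut.mul_apply]
    by_cases c1 : i = j
    · rw [c1, artin_inv_of_self, _root_.map_mul, _root_.map_mul, _root_.map_inv]
      exact mul_mem (mul_mem (ih h1) (ih (by omega))) (inv_mem (ih h1))
    by_cases c2 : i = j + 1
    · rw [c2, artin_inv_of_succ]
      exact ih h1
    · rw [artin_inv_of_of_ne c1 c2]
      exact ih hi

theorem reflect_eq_conj {k : ℕ} {y : FreeGroup ℕ}
    (hy : y ∈ Subgroup.closure (of '' {i : ℕ | k ≤ i})) :
    reflect k y = of k * reflect (k + 1) y * (of k)⁻¹ := by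
  have : Subgroup.closure (of '' {i : ℕ | k ≤ i}) ≤
      (reflect k).eqLocus ((MulAut.conj (of k)).toMonoidHom.comp (reflect (k + 1))) := by
    rw [Subgroup.closure_le]
    rintro _ ⟨i, hi, rfl⟩
    change reflect k (of i) = of k * reflect (k + 1) (of i) * (of k)⁻¹
    rw [Set.mem_ofPred_eq] at hi
    rcases Nat.eq_or_lt_of_le hi with rfl | hi
    · rw [reflect_of_le le_rfl, reflect_of_le (Nat.le_succ k)]
      group
    · obtain ⟨m, rfl⟩ := Nat.exists_eq_add_of_le hi
      rw [reflect_of, reflect_of, Nat.succ_eq_add_one, Nat.add_sub_cancel_left,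
        show k + 1 + m - k = m + 1 by omega, tprod_succ]
      group
  exact this hy

/-- The number of letters `t_k^{±1}` in the reduced word of an element. -/
def letterCount (k : ℕ) (x : FreeGroup ℕ) : ℕ := x.toWord.countP fun p => p.1 = k

theorem letterCount_mk_le (k : ℕ) (L : List (ℕ × Bool)) :
    letterCount k (FreeGroup.mk L) ≤ L.countP fun p => p.1 = k := by
  rw [letterCount, toWord_mk]
  exact (reduce.red (L := L)).sublist.countP_le

theorem letterCount_mk_of_isReduced (k : ℕ) {L : List (ℕ × Bool)} (h : IsReduced L) :
    letterCount k (FreeGroup.mk L) = L.countP fun p => p.1 = k := by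
  rw [letterCount, toWord_mk, h.reduce_eq]

theorem letterCount_mul_le (k : ℕ) (x y : FreeGroup ℕ) :
    letterCount k (x * y) ≤ letterCount k x + letterCount k y := by
  rw [letterCount, letterCount, letterCount, ← countP_append]
  exact (toWord_mul_sublist x y).countP_le

theorem letterCount_inv (k : ℕ) (x : FreeGroup ℕ) : letterCount k x⁻¹ = letterCount k x := by
  rw [letterCount, letterCount, toWord_inv, invRev, countP_reverse, countP_map]
  rfl

theorem letterCount_tprod {k l m : ℕ} (h : k < l) : letterCount k (tprod l m) = 0 := by
  rw [← Nat.le_zero, tprod_eq_mk]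
  refine (letterCount_mk_le _ _).trans (le_of_eq ?_)
  rw [countP_map, countP_eq_zero]
  intro i hi
  rw [List.mem_range'_1] at hi
  simp
  omega

theorem letterCount_of (k i : ℕ) : letterCount k (of i) = if i = k then 1 else 0 := by
  rw [letterCount, toWord_of, countP_singleton]
  simp

theorem letterCount_reflect_of_le (k i : ℕ) :
    letterCount k (reflect (k + 1) (of i)) ≤ if i = k then 1 else 0 := by
  rw [reflect_of]
  refine (letterCount_mul_le _ _ _).trans ?_
  rw [letterCount_inv, letterCount_tprod (Nat.lt_succ_self k), add_zero]
  refine (letterCount_mul_le _ _ _).trans ?_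
  rw [letterCount_inv, letterCount_tprod (Nat.lt_succ_self k), zero_add, letterCount_of]

theorem letterCount_reflect_le (k : ℕ) (x : FreeGroup ℕ) :
    letterCount k (reflect (k + 1) x) ≤ letterCount k x := by
  have key : ∀ L : List (ℕ × Bool), letterCount k (reflect (k + 1) (FreeGroup.mk L))
      ≤ L.countP fun p => p.1 = k := by
    intro L
    induction L with
    | nil => simp [← one_eq_mk, letterCount]
    | cons p L ih =>
      have e : FreeGroup.mk (p :: L) = FreeGroup.mk [p] * FreeGroup.mk L := by simp [mul_mk]
      have h1 : letterCount k (reflect (k + 1) (FreeGroup.mk [p])) ≤ if p.1 = k then 1 else 0 := by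
        obtain ⟨i, b⟩ := p
        cases b
        · have : FreeGroup.mk [(i, false)] = (of i)⁻¹ := by simp [FreeGroup.of, inv_mk, invRev]
          rw [this, _root_.map_inv, letterCount_inv]
          exact letterCount_reflect_of_le k i
        · exact letterCount_reflect_of_le k i
      rw [e, _root_.map_mul, countP_cons]
      refine (letterCount_mul_le _ _ _).trans ?_
      rw [add_comm]
      refine Nat.add_le_add ih (h1.trans (le_of_eq ?_))
      simp
  have := key x.toWord
  rwa [mk_toWord] at this

theorem letterCount_reflect (k : ℕ) (x : FreeGroup ℕ) :
    letterCount k (reflect (k + 1) x) = letterCount k x := by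
  apply (letterCount_reflect_le k x).antisymm
  have := letterCount_reflect_le k (reflect (k + 1) x)
  rwa [reflect_reflect] at this

theorem isReduced_cons_of_not_head {p : ℕ × Bool} {L : List (ℕ × Bool)} (hL : IsReduced L)
    (h : ∀ W, L ≠ (p.1, !p.2) :: W) : IsReduced (p :: L) := by
  cases L with
  | nil => simp [FreeGroup.IsReduced]
  | cons q L =>
    apply isReduced_cons_append_head hL
    rintro rfl
    exact h L rfl

theorem head_of_conj_reflect {k : ℕ} {y : FreeGroup ℕ} (hy : y ≠ 1)
    (hh : ∀ W, y.toWord ≠ (k, true) :: W) :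
    ∃ W, (of k * reflect (k + 1) y * (of k)⁻¹).toWord = (k, true) :: W := by
  set z := reflect (k + 1) y with hz
  have hz1 : z ≠ 1 := by
    intro h
    apply hy
    rw [← reflect_reflect (k + 1) y, ← hz, h, _root_.map_one]
  have hcount : letterCount k (of k * z) = letterCount k z + 1 := by
    have h1 : reflect (k + 1) ((of k)⁻¹ * y) = of k * z := by
      rw [_root_.map_mul, _root_.map_inv, reflect_of_le (Nat.le_succ k), inv_inv]
    rw [← h1, letterCount_reflect, hz, letterCount_reflect]
    have h2 : (of k)⁻¹ * y = FreeGroup.mk ((k, false) :: y.toWord) := by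
      nth_rw 1 [← mk_toWord (x := y)]
      rw [FreeGroup.of, inv_mk, mul_mk]
      rfl
    rw [h2, letterCount_mk_of_isReduced, countP_cons, letterCount]
    · simp
    · exact isReduced_cons_of_not_head isReduced_toWord hh
  have hzw : FreeGroup.mk z.toWord = z := mk_toWord
  have hzr : IsReduced z.toWord := isReduced_toWord
  have hZ : ∀ W, z.toWord ≠ (k, false) :: W := by
    intro W hW
    have h1 : of k * z = FreeGroup.mk W := by
      have : FreeGroup.mk ((k, false) :: W) = (of k)⁻¹ * FreeGroup.mk W := by
        rw [FreeGroup.of, inv_mk, mul_mk]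
        rfl
      rw [← hzw, hW, this, mul_inv_cancel_left]
    have h2 := letterCount_mk_le k W
    rw [← h1, hcount, letterCount, hW, countP_cons] at h2
    simp at h2
  have hred : IsReduced ((k, true) :: z.toWord) := isReduced_cons_of_not_head hzr hZ
  rcases eq_nil_or_concat z.toWord with h | ⟨Z, q, h⟩
  · rw [toWord_eq_nil_iff] at h
    exact absurd h hz1
  have e : of k * z * (of k)⁻¹ = FreeGroup.mk ((k, true) :: Z) * (FreeGroup.mk [q] * (of k)⁻¹) := by
    rw [← hzw, h, FreeGroup.of, mul_mk, ← mul_assoc, mul_mk]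
    simp
  by_cases hq : q = (k, true)
  · refine ⟨Z, ?_⟩
    rw [e, hq]
    change (FreeGroup.mk ((k, true) :: Z) * (of k * (of k)⁻¹)).toWord = _
    rw [mul_inv_cancel, mul_one, toWord_mk, IsReduced.reduce_eq]
    exact hred.infix ⟨[], [q], by simp [h]⟩
  · refine ⟨Z ++ [q] ++ [(k, false)], ?_⟩
    have e2 : of k * z * (of k)⁻¹
        = FreeGroup.mk ((k, true) :: (Z ++ [q] ++ [(k, false)])) := by
      rw [e, FreeGroup.of, inv_mk, mul_mk, mul_mk]
      simp [invRev]
    rw [e2, toWord_mk, IsReduced.reduce_eq]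
    rw [h] at hred
    have h3 : IsReduced ([q] ++ [(k, false)]) := by
      simp only [singleton_append, isReduced_cons_cons]
      refine ⟨fun h1 => ?_, by simp [FreeGroup.IsReduced]⟩
      by_contra h2
      apply hq
      ext
      · exact h1
      · simpa using h2
    have h4 : IsReduced (((k, true) :: Z) ++ [q]) := by simpa using hred
    simpa using IsReduced.append_overlap h4 h3 (by simp)

theorem mirror_mem_negSubmonoid {n k : ℕ} (hk : k < n) (γ : BraidGroup n)
    (h : ∀ i < k, action n γ (of i) = of i)
    (hh : ∀ W, (action n γ (of k)).toWord ≠ (k, true) :: W) : mirror n γ ∈ negSubmonoid n k := by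
  have hinj : ∀ γ : BraidGroup n, action n γ = 1 → γ = 1 := fun γ hγ =>
    eq_one_of_action_eq_one (k := 0) γ (by simp [tailSubgroup_zero]) hγ
  have hγ := mem_tailSubgroup_of_fix hinj hk.le γ h
  apply mem_negSubmonoid_of_head hinj hk
  · exact fun i hi => action_fix_of_lt (mirror_mem_tailSubgroup hγ) hi
  have h1 := reflect_action hγ (of k)
  rw [reflect_of_le le_rfl, _root_.map_inv, ← inv_eq_iff_eq_inv, ← _root_.map_inv] at h1
  rw [← h1, reflect_eq_conj (inv_mem (action_mem_closure hγ le_rfl))]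
  apply head_of_conj_reflect
  · rw [Ne, inv_eq_one, EmbeddingLike.map_eq_one_iff]
    exact of_ne_one k
  · intro W hW
    have hp := item_positive γ k
    have hr := item_isReduced γ k
    rw [← item_val, Conj.val, toWord_inv, toWord_mk, hr.reduce_eq] at hW
    have hh' := hh
    rw [← item_val, Conj.val, toWord_mk, hr.reduce_eq] at hh'
    rw [Conj.word, invRev_append] at hW
    rcases hP : (item γ k).1 with _ | ⟨u, P⟩
    · simp [hP, invRev, hp] at hW
    · apply hh' (P ++ (item γ k).2 :: invRev (item γ k).1)
      rw [Conj.word]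
      simp [hP, invRev] at hW ⊢
      exact hW.1

theorem exists_word_of_mem_tail {n k : ℕ} {γ : BraidGroup n} (hγ : γ ∈ tailSubgroup n k) :
    ∃ w : List (Fin (n - 1) × Bool), wordProd w = γ ∧ ∀ p ∈ w, k ≤ (p.1 : ℕ) := by
  induction hγ using tailSubgroup_induction with
  | one => exact ⟨[], by simp [wordProd]⟩
  | mul γ _ j h1 h2 ih =>
    obtain ⟨w, rfl, hw⟩ := ih
    refine ⟨w ++ [(⟨j, by omega⟩, true)], ?_, ?_⟩
    · simp [wordProd, bg_of_lt (show j < n - 1 by omega)]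
    · simpa [or_imp, forall_and, h1] using hw
  | mul_inv γ _ j h1 h2 ih =>
    obtain ⟨w, rfl, hw⟩ := ih
    refine ⟨w ++ [(⟨j, by omega⟩, false)], ?_, ?_⟩
    · simp [wordProd, bg_of_lt (show j < n - 1 by omega)]
    · simpa [or_imp, forall_and, h1] using hw

theorem wordProd_append {n : ℕ} (v w : List (Fin (n - 1) × Bool)) :
    wordProd (v ++ w) = wordProd v * wordProd w := by simp [wordProd]

theorem wordProd_cons {n : ℕ} (p : Fin (n - 1) × Bool) (w : List (Fin (n - 1) × Bool)) :
    wordProd (p :: w) = wordProd [p] * wordProd w := wordProd_append [p] w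

theorem exists_word_of_mem_neg {n k : ℕ} {γ : BraidGroup n} (hγ : γ ∈ negSubmonoid n k) :
    ∃ w : List (Fin (n - 1) × Bool), wordProd w = γ ∧
      ∀ p ∈ w, k ≤ (p.1 : ℕ) ∧ ((p.1 : ℕ) = k → p.2 = false) := by
  unfold negSubmonoid at hγ
  induction hγ using Submonoid.closure_induction with
  | one => exact ⟨[], by simp [wordProd]⟩
  | mem x hx =>
    rcases hx with hx | rfl
    · obtain ⟨w, h1, h2⟩ := exists_word_of_mem_tail hx
      exact ⟨w, h1, fun p hp => by have := h2 p hp; omega⟩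
    · by_cases hk : k < n - 1
      · refine ⟨[(⟨k, hk⟩, false)], ?_, by simp⟩
        simp [wordProd, bg_of_lt hk]
      · exact ⟨[], by simp [wordProd, bg, hk]⟩
  | mul x y _ _ ihx ihy =>
    obtain ⟨v, rfl, hv⟩ := ihx
    obtain ⟨w, rfl, hw⟩ := ihy
    refine ⟨v ++ w, wordProd_append v w, fun p hp => ?_⟩
    rcases List.mem_append.1 hp with hp | hp
    · exact hv p hp
    · exact hw p hp

theorem wordProd_mem_tail {n k : ℕ} (w : List (Fin (n - 1) × Bool))
    (h : ∀ p ∈ w, k ≤ (p.1 : ℕ)) : wordProd w ∈ tailSubgroup n k := by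
  apply Subgroup.list_prod_mem
  intro x hx
  obtain ⟨p, hp, rfl⟩ := List.mem_map.1 hx
  rw [braidGen_eq]
  have := bg_mem_tailSubgroup (n := n) (h p hp)
  split_ifs
  · exact this
  · exact inv_mem this

/-- The word with all exponents negated. -/
def flipWord {n : ℕ} (w : List (Fin (n - 1) × Bool)) : List (Fin (n - 1) × Bool) :=
  w.map fun p => (p.1, !p.2)

theorem wordProd_flipWord {n : ℕ} (w : List (Fin (n - 1) × Bool)) :
    wordProd (flipWord w) = mirror n (wordProd w) := by
  induction w with
  | nil => simp [wordProd, flipWord]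
  | cons p w ih =>
    obtain ⟨i, b⟩ := p
    have hb : wordProd [(i, !b)] = mirror n (wordProd [(i, b)]) := by
      have := mirror_bg (n := n) (i := i) (by omega)
      rw [← braidGen_eq] at this
      cases b <;> simp [wordProd, this]
    rw [wordProd_cons, _root_.map_mul, ← ih, ← hb, ← wordProd_cons]
    rfl

theorem wordProd_reverse_flipWord {n : ℕ} (w : List (Fin (n - 1) × Bool)) :
    wordProd (flipWord w).reverse = (wordProd w)⁻¹ := by
  induction w with
  | nil => simp [wordProd, flipWord]
  | cons p w ih =>
    obtain ⟨i, b⟩ := p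
    have hb : wordProd [(i, !b)] = (wordProd [(i, b)])⁻¹ := by
      cases b <;> simp [wordProd]
    rw [wordProd_cons, mul_inv_rev, ← ih, ← hb, ← wordProd_append, flipWord, map_cons,
      reverse_cons, flipWord]

theorem sigmaPositive_of_forall {n k : ℕ} {w : List (Fin (n - 1) × Bool)}
    (hw : ∀ p ∈ w, k ≤ (p.1 : ℕ) ∧ ((p.1 : ℕ) = k → p.2 = true))
    (h : wordProd w ∉ tailSubgroup n (k + 1)) : SigmaPositive w := by
  obtain ⟨p, hp, hpk⟩ : ∃ p ∈ w, (p.1 : ℕ) = k := by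
    by_contra hne
    push Not at hne
    exact h (wordProd_mem_tail w fun p hp => (hw p hp).1.lt_of_ne (hne p hp).symm)
  refine ⟨p.1, ⟨p, hp, rfl⟩, fun q hq => ?_, fun q hq hqp => ?_⟩
  · rw [Fin.le_def, hpk]
    exact (hw q hq).1
  · exact (hw q hq).2 (by rw [hqp, hpk])

end BraidOrder

/-- Dehornoy's trichotomy: every non-identity braid `β` in `B_n` is σ-positive or
σ-negative, i.e. either `β` or `β⁻¹` admits a σ-positive word in the Artin generators. -/
theorem braid_sigma_positive_or_negative (n : ℕ) (β : BraidGroup n) (hβ : β ≠ 1) :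
    ∃ w : List (Fin (n - 1) × Bool),
      SigmaPositive w ∧ (wordProd w = β ∨ wordProd w = β⁻¹) := by
  open BraidOrder in
  have hinj : ∀ γ : BraidGroup n, action n γ = 1 → γ = 1 := fun γ hγ =>
    eq_one_of_action_eq_one (k := 0) γ (by simp [tailSubgroup_zero]) hγ
  have hne : ∃ k, action n β (FreeGroup.of k) ≠ FreeGroup.of k := by
    by_contra h
    push Not at h
    exact hβ (hinj β (mulAut_ext h))
  classical
  obtain ⟨k, hk, hmin⟩ : ∃ k, action n β (FreeGroup.of k) ≠ FreeGroup.of k ∧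
      ∀ i < k, action n β (FreeGroup.of i) = FreeGroup.of i :=
    ⟨Nat.find hne, Nat.find_spec hne, fun i hi => not_not.1 (Nat.find_min hne hi)⟩
  have hkn : k < n := by
    by_contra h
    exact hk (action_fix_of_ge β (by omega))
  have htail : β ∉ tailSubgroup n (k + 1) := fun h => hk (action_fix_of_lt h (Nat.lt_succ_self k))
  by_cases hh : ∃ W, (action n β (FreeGroup.of k)).toWord = (k, true) :: W
  · obtain ⟨w, hw, hwl⟩ := exists_word_of_mem_neg (mem_negSubmonoid_of_head hinj hkn β hmin hh)
    have hprod : wordProd (flipWord w).reverse = β⁻¹ := by rw [wordProd_reverse_flipWord, hw]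
    refine ⟨(flipWord w).reverse, sigmaPositive_of_forall (k := k) ?_ ?_, Or.inr hprod⟩
    · intro p hp
      rw [List.mem_reverse, flipWord, List.mem_map] at hp
      obtain ⟨q, hq, rfl⟩ := hp
      simpa using hwl q hq
    · rwa [hprod, inv_mem_iff]
  · push Not at hh
    obtain ⟨w, hw, hwl⟩ := exists_word_of_mem_neg (mirror_mem_negSubmonoid hkn β hmin hh)
    have hprod : wordProd (flipWord w) = β := by rw [wordProd_flipWord, hw, mirror_mirror]
    refine ⟨flipWord w, sigmaPositive_of_forall (k := k) ?_ ?_, Or.inl hprod⟩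
    · intro p hp
      rw [flipWord, List.mem_map] at hp
      obtain ⟨q, hq, rfl⟩ := hp
      simpa using hwl q hq
    · rwa [hprod]
end

section
/- The braid group B_n (n ≥ 2) is left-orderable: there exists a strict total order < on B_n such that for all α, β, γ in B_n, if β < γ then αβ < αγ. -/
/-- The elements `s 0, …, s (N - 1)` of a group satisfy the braid relations. -/
structure IsBraidFamily {G : Type*} [Group G] (s : ℕ → G) (N : ℕ) : Prop where
  comm : ∀ i j, i + 2 ≤ j → j < N → s i * s j = s j * s i
  braid : ∀ i, i + 1 < N → s i * s (i + 1) * s i = s (i + 1) * s i * s (i + 1)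

/-- The product `s 0 * s 1 * ⋯ * s (j - 1)`. -/
def ascProd {G : Type*} [Group G] (s : ℕ → G) : ℕ → G
  | 0 => 1
  | j + 1 => ascProd s j * s j

namespace IsBraidFamily

variable {G : Type*} [Group G] {s : ℕ → G} {N : ℕ}

theorem shift (hs : IsBraidFamily s (N + 1)) : IsBraidFamily (fun i => s (i + 1)) N where
  comm i j hij hj := hs.comm (i + 1) (j + 1) (by omega) (by omega)
  braid i hi := hs.braid (i + 1) (by omega)

theorem commute_ascProd (hs : IsBraidFamily s N) {i j : ℕ} (hij : j < i) (hi : i < N) :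
    Commute (ascProd s j) (s i) := by
  induction j with
  | zero => exact Commute.one_left _
  | succ j ih => exact (ih (by omega)).mul_left (hs.comm j i (by omega) hi)

theorem ascProd_mul (hs : IsBraidFamily s N) {i j : ℕ} (hij : i + 1 < j) (hj : j ≤ N) :
    ascProd s j * s i = s (i + 1) * ascProd s j := by
  induction j with
  | zero => omega
  | succ j ih =>
    rcases Nat.lt_or_ge (i + 1) j with h | h
    · have h₁ : s j * s i = s i * s j := (hs.comm i j (by omega) (by omega)).symm
      simp only [ascProd]
      rw [mul_assoc, h₁, ← mul_assoc, ih h (by omega), mul_assoc]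
    · obtain rfl : j = i + 1 := by omega
      have h₁ := hs.braid i (by omega)
      have h₂ := (hs.commute_ascProd (j := i) (i := i + 1) (by omega) (by omega)).eq
      simp only [ascProd]
      calc ascProd s i * s i * s (i + 1) * s i
          = ascProd s i * (s i * s (i + 1) * s i) := by group
        _ = (ascProd s i * s (i + 1)) * s i * s (i + 1) := by rw [h₁]; group
        _ = _ := by rw [h₂]; group

theorem ascProd_mul_ascProd (hs : IsBraidFamily s (N + 1)) {j : ℕ} (hj : j ≤ N) :
    ascProd s (N + 1) * ascProd s j =
      ascProd (fun i => s (i + 1)) j * ascProd s (N + 1) := by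
  induction j with
  | zero => simp [ascProd]
  | succ j ih =>
    change ascProd s (N + 1) * (ascProd s j * s j) =
      ascProd (fun i => s (i + 1)) j * s (j + 1) * ascProd s (N + 1)
    rw [← mul_assoc, ih (by omega), mul_assoc, hs.ascProd_mul (i := j) (by omega) le_rfl,
      mul_assoc]

theorem ascProd_succ_eq (s : ℕ → G) (j : ℕ) :
    ascProd s (j + 1) = s 0 * ascProd (fun i => s (i + 1)) j := by
  induction j with
  | zero => simp [ascProd]
  | succ j ih =>
    rw [ascProd, ih, ascProd, mul_assoc]

theorem ascProd_sq_mul (hs : IsBraidFamily s (N + 1)) :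
    ascProd s (N + 1) ^ 2 * s N = s 0 * ascProd s (N + 1) ^ 2 := by
  have h₁ := hs.ascProd_mul_ascProd (le_refl N)
  have h₂ := ascProd_succ_eq s N
  have h₃ : ascProd s (N + 1) = ascProd s N * s N := rfl
  calc ascProd s (N + 1) ^ 2 * s N
      = s 0 * (ascProd (fun i => s (i + 1)) N * ascProd s (N + 1)) * s N := by
        rw [pow_two]; nth_rewrite 1 [h₂]; group
    _ = s 0 * ascProd s (N + 1) * (ascProd s N * s N) := by rw [← h₁]; group
    _ = _ := by rw [← h₃, pow_two, mul_assoc]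

theorem ascProd_pow_mul (hs : IsBraidFamily s N) {i : ℕ} (hi : i < N) :
    ascProd s N ^ i * s 0 = s i * ascProd s N ^ i := by
  induction i with
  | zero => simp
  | succ i ih =>
    rw [pow_succ', mul_assoc, ih (by omega), ← mul_assoc, hs.ascProd_mul (by omega) le_rfl,
      mul_assoc]

theorem commute_ascProd_pow (hs : IsBraidFamily s N) {i : ℕ} (hi : i < N) :
    Commute (ascProd s N ^ (N + 1)) (s i) := by
  obtain ⟨N, rfl⟩ : ∃ M, N = M + 1 := ⟨N - 1, by omega⟩
  have h₀ : Commute (ascProd s (N + 1) ^ (N + 1 + 1)) (s 0) := by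
    have h₁ := hs.ascProd_pow_mul (Nat.lt_succ_self N)
    have h₂ := hs.ascProd_sq_mul
    calc ascProd s (N + 1) ^ (N + 1 + 1) * s 0
        = ascProd s (N + 1) ^ 2 * (ascProd s (N + 1) ^ N * s 0) := by
          rw [← mul_assoc, ← pow_add, add_comm 2 N]
      _ = ascProd s (N + 1) ^ 2 * s N * ascProd s (N + 1) ^ N := by rw [h₁, mul_assoc]
      _ = s 0 * ascProd s (N + 1) ^ (N + 1 + 1) := by
          rw [h₂, mul_assoc, ← pow_add, add_comm 2 N]
  have h₁ := hs.ascProd_pow_mul hi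
  have h₂ : s i = ascProd s (N + 1) ^ i * s 0 * (ascProd s (N + 1) ^ i)⁻¹ := by
    rw [h₁, mul_inv_cancel_right]
  rw [h₂]
  exact (((Commute.refl _).pow_pow _ _).mul_right h₀).mul_right
    ((Commute.refl _).pow_pow _ _).inv_right

theorem ascProd_mem {S : Submonoid G} {j : ℕ} (h : ∀ i < j, s i ∈ S) : ascProd s j ∈ S := by
  induction j with
  | zero => exact S.one_mem
  | succ j ih => exact S.mul_mem (ih fun i hi => h i (by omega)) (h j (by omega))

theorem inv_mul_ascProd_pow_mem (hs : IsBraidFamily s N) {i : ℕ} (hi : i < N) :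
    (s i)⁻¹ * ascProd s N ^ (N + 1) ∈ Submonoid.closure (s '' Set.Iio N) := by
  have hmem : ∀ j < N, s j ∈ Submonoid.closure (s '' Set.Iio N) := fun j hj =>
    Submonoid.subset_closure ⟨j, hj, rfl⟩
  obtain ⟨M, rfl⟩ : ∃ M, N = M + 1 := ⟨N - 1, by omega⟩
  have h₁ := hs.ascProd_pow_mul hi
  have h₂ := ascProd_succ_eq s M
  have h₃ : (s i)⁻¹ * ascProd s (M + 1) ^ (M + 1 + 1) =
      ascProd s (M + 1) ^ i * ascProd (fun i => s (i + 1)) M *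
        ascProd s (M + 1) ^ (M + 1 - i) := by
    have h₄ : M + 1 + 1 = i + 1 + (M + 1 - i) := by omega
    rw [inv_mul_eq_iff_eq_mul]
    nth_rewrite 1 [h₄]
    rw [pow_add, pow_succ]
    nth_rewrite 2 [h₂]
    rw [← mul_assoc, h₁]
    group
  rw [h₃]
  have h₅ := ascProd_mem hmem
  exact mul_mem (mul_mem (pow_mem h₅ _) (ascProd_mem fun j hj => hmem _ (by omega)))
    (pow_mem h₅ _)

/-- Every element of the subgroup generated by a braid family is a fraction of positive
elements. -/
theorem exists_fraction (hs : IsBraidFamily s N) {g : G}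
    (hg : g ∈ Subgroup.closure (s '' Set.Iio N)) :
    ∃ a ∈ Submonoid.closure (s '' Set.Iio N), ∃ b ∈ Submonoid.closure (s '' Set.Iio N),
      g = a⁻¹ * b := by
  have hz : ascProd s N ^ (N + 1) ∈ Submonoid.closure (s '' Set.Iio N) :=
    pow_mem (ascProd_mem fun j hj =>
      Submonoid.subset_closure (Set.mem_image_of_mem s (Set.mem_Iio.2 hj))) _
  have hcomm : ∀ b ∈ Submonoid.closure (s '' Set.Iio N),
      Commute (ascProd s N ^ (N + 1)) b := by
    intro b hb
    induction hb using Submonoid.closure_induction with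
    | mem x hx => obtain ⟨i, hi, rfl⟩ := hx; exact hs.commute_ascProd_pow hi
    | one => exact Commute.one_right _
    | mul x y _ _ hx hy => exact hx.mul_right hy
  induction hg using Subgroup.closure_induction_right with
  | one => exact ⟨1, one_mem _, 1, one_mem _, by simp⟩
  | mul_right x _ y hy ih =>
    obtain ⟨a, ha, b, hb, rfl⟩ := ih
    exact ⟨a, ha, b * y, mul_mem hb (Submonoid.subset_closure hy), by rw [mul_assoc]⟩
  | mul_inv_cancel x _ y hy ih =>
    obtain ⟨a, ha, b, hb, rfl⟩ := ih
    obtain ⟨i, hi, rfl⟩ := hy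
    refine ⟨ascProd s N ^ (N + 1) * a, mul_mem hz ha,
      b * ((s i)⁻¹ * ascProd s N ^ (N + 1)), mul_mem hb (hs.inv_mul_ascProd_pow_mem hi), ?_⟩
    have h₁ := (hcomm b hb).eq
    have h₂ := (hs.commute_ascProd_pow hi).inv_right.eq
    rw [← h₂, ← mul_assoc b, ← h₁]
    group

end IsBraidFamily

/-- Pairs of positive rational numbers. -/
abbrev PosPair : Type := {p : ℚ × ℚ // 0 < p.1 ∧ 0 < p.2}

namespace PosPair

/-- The subtraction-free form of the Dynnikov transformation, first output. -/
def dynFst (p q : PosPair) : PosPair :=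
  ⟨(p.1.1 * (1 + p.1.2) + p.1.2 * q.1.1,
    p.1.2 * q.1.2 * q.1.1 / (p.1.2 * q.1.1 + p.1.1 * (1 + p.1.2) * (1 + q.1.2))), by
    obtain ⟨⟨a, b⟩, ha, hb⟩ := p
    obtain ⟨⟨c, d⟩, hc, hd⟩ := q
    dsimp only at *
    constructor <;> positivity⟩

/-- The subtraction-free form of the Dynnikov transformation, second output. -/
def dynSnd (p q : PosPair) : PosPair :=
  ⟨(p.1.1 * q.1.1 * q.1.2 / (q.1.1 + p.1.1 * (1 + q.1.2)),
    (p.1.2 * q.1.1 + p.1.1 * (1 + p.1.2) * (1 + q.1.2)) / q.1.1), by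
    obtain ⟨⟨a, b⟩, ha, hb⟩ := p
    obtain ⟨⟨c, d⟩, hc, hd⟩ := q
    dsimp only at *
    constructor <;> positivity⟩

/-- The inverse of the Dynnikov transformation, first output. -/
def dynInvFst (p q : PosPair) : PosPair :=
  ⟨(p.1.1 * q.1.1 / (q.1.1 * (1 + p.1.2) + p.1.2 * p.1.1),
    p.1.2 * q.1.2 * p.1.1 / (p.1.2 * p.1.1 + (1 + p.1.2) * (1 + q.1.2) * q.1.1)), by
    obtain ⟨⟨a, b⟩, ha, hb⟩ := p
    obtain ⟨⟨c, d⟩, hc, hd⟩ := q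
    dsimp only at *
    constructor <;> positivity⟩

/-- The inverse of the Dynnikov transformation, second output. -/
def dynInvSnd (p q : PosPair) : PosPair :=
  ⟨((p.1.1 + (1 + q.1.2) * q.1.1) / q.1.2,
    (p.1.2 * p.1.1 + (1 + p.1.2) * (1 + q.1.2) * q.1.1) / p.1.1), by
    obtain ⟨⟨a, b⟩, ha, hb⟩ := p
    obtain ⟨⟨c, d⟩, hc, hd⟩ := q
    dsimp only at *
    constructor <;> positivity⟩

theorem fst_lt_dynFst (p q : PosPair) : p.1.1 < (dynFst p q).1.1 := by
  obtain ⟨⟨a, b⟩, ha, hb⟩ := p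
  obtain ⟨⟨c, d⟩, hc, hd⟩ := q
  dsimp only [dynFst] at *
  nlinarith [mul_pos ha hb, mul_pos hb hc]

theorem dynFst_dynInv (p q : PosPair) : dynFst (dynInvFst p q) (dynInvSnd p q) = p := by
  obtain ⟨⟨a, b⟩, ha, hb⟩ := p
  obtain ⟨⟨c, d⟩, hc, hd⟩ := q
  dsimp only [dynFst, dynInvFst, dynInvSnd] at *
  ext <;> dsimp only <;> field_simp <;> ring

theorem dynSnd_dynInv (p q : PosPair) : dynSnd (dynInvFst p q) (dynInvSnd p q) = q := by
  obtain ⟨⟨a, b⟩, ha, hb⟩ := p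
  obtain ⟨⟨c, d⟩, hc, hd⟩ := q
  dsimp only [dynSnd, dynInvFst, dynInvSnd] at *
  ext <;> dsimp only <;> field_simp <;> ring

theorem dynInvFst_dyn (p q : PosPair) : dynInvFst (dynFst p q) (dynSnd p q) = p := by
  obtain ⟨⟨a, b⟩, ha, hb⟩ := p
  obtain ⟨⟨c, d⟩, hc, hd⟩ := q
  dsimp only [dynFst, dynSnd, dynInvFst] at *
  ext <;> dsimp only <;> field_simp <;> ring

theorem dynInvSnd_dyn (p q : PosPair) : dynInvSnd (dynFst p q) (dynSnd p q) = q := by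
  obtain ⟨⟨a, b⟩, ha, hb⟩ := p
  obtain ⟨⟨c, d⟩, hc, hd⟩ := q
  dsimp only [dynFst, dynSnd, dynInvSnd] at *
  ext <;> dsimp only <;> field_simp <;> ring

theorem yangBaxter_fst (p q r : PosPair) :
    dynFst (dynFst p q) (dynFst (dynSnd p q) r) = dynFst p (dynFst q r) := by
  obtain ⟨⟨a, b⟩, ha, hb⟩ := p
  obtain ⟨⟨c, d⟩, hc, hd⟩ := q
  obtain ⟨⟨e, f⟩, he, hf⟩ := r
  dsimp only [dynFst, dynSnd] at *
  ext <;> dsimp only <;> field_simp <;> ring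

theorem dynFst_mul_dynSnd (p q : PosPair) :
    (dynFst p q).1.2 * (dynSnd p q).1.2 = p.1.2 * q.1.2 := by
  obtain ⟨⟨a, b⟩, ha, hb⟩ := p
  obtain ⟨⟨c, d⟩, hc, hd⟩ := q
  dsimp only [dynFst, dynSnd] at *
  field_simp

theorem dynFst_dynSnd_fst (p q r : PosPair) :
    (dynFst (dynSnd p q) r).1.1 =
      (p.1.1 * q.1.1 * q.1.2 * (1 + p.1.2) +
        (p.1.2 * q.1.1 + p.1.1 * (1 + p.1.2) * (1 + q.1.2)) * r.1.1) / q.1.1 := by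
  obtain ⟨⟨a, b⟩, ha, hb⟩ := p
  obtain ⟨⟨c, d⟩, hc, hd⟩ := q
  obtain ⟨⟨e, f⟩, he, hf⟩ := r
  dsimp only [dynFst, dynSnd] at *
  field_simp
  ring

theorem dynFst_dynSnd_snd (p q r : PosPair) :
    (dynFst (dynSnd p q) r).1.2 =
      (p.1.2 * q.1.1 + p.1.1 * (1 + p.1.2) * (1 + q.1.2)) * r.1.2 * r.1.1 /
        ((p.1.2 * q.1.1 + p.1.1 * (1 + p.1.2) * (1 + q.1.2)) * r.1.1 +
          p.1.1 * q.1.1 * q.1.2 * (1 + p.1.2) * (1 + r.1.2)) := by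
  obtain ⟨⟨a, b⟩, ha, hb⟩ := p
  obtain ⟨⟨c, d⟩, hc, hd⟩ := q
  obtain ⟨⟨e, f⟩, he, hf⟩ := r
  dsimp only [dynFst, dynSnd] at *
  field_simp
  ring

theorem dynSnd_dynFst_fst (p q r : PosPair) :
    (dynSnd (dynFst p q) (dynFst (dynSnd p q) r)).1.1 =
      (p.1.1 * (1 + p.1.2) + p.1.2 * q.1.1) * r.1.2 * r.1.1 /
        (r.1.1 + (1 + r.1.2) * q.1.1) := by
  have h (u v : PosPair) : (dynSnd u v).1.1 =
    u.1.1 * v.1.1 * v.1.2 / (v.1.1 + u.1.1 * (1 + v.1.2)) := rfl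
  have h' : (dynFst p q).1.1 = p.1.1 * (1 + p.1.2) + p.1.2 * q.1.1 := rfl
  rw [h, dynFst_dynSnd_fst, dynFst_dynSnd_snd, h']
  obtain ⟨⟨a, b⟩, ha, hb⟩ := p
  obtain ⟨⟨c, d⟩, hc, hd⟩ := q
  obtain ⟨⟨e, f⟩, he, hf⟩ := r
  dsimp only at *
  field_simp
  ring

theorem dynFst_dynSnd_dynFst_fst (p q r : PosPair) :
    (dynFst (dynSnd p (dynFst q r)) (dynSnd q r)).1.1 =
      (p.1.1 * (1 + p.1.2) + p.1.2 * q.1.1) * r.1.2 * r.1.1 /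
        (r.1.1 + (1 + r.1.2) * q.1.1) := by
  have h : (dynSnd q r).1.1 = q.1.1 * r.1.1 * r.1.2 / (r.1.1 + q.1.1 * (1 + r.1.2)) := rfl
  have h₁ : (dynFst q r).1.1 = q.1.1 * (1 + q.1.2) + q.1.2 * r.1.1 := rfl
  have h₂ : (dynFst q r).1.2 = q.1.2 * r.1.2 * r.1.1 /
    (q.1.2 * r.1.1 + q.1.1 * (1 + q.1.2) * (1 + r.1.2)) := rfl
  rw [dynFst_dynSnd_fst, h, h₁, h₂]
  obtain ⟨⟨a, b⟩, ha, hb⟩ := p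
  obtain ⟨⟨c, d⟩, hc, hd⟩ := q
  obtain ⟨⟨e, f⟩, he, hf⟩ := r
  dsimp only at *
  field_simp
  ring

theorem yangBaxter_snd (p q r : PosPair) :
    dynSnd (dynSnd p q) r = dynSnd (dynSnd p (dynFst q r)) (dynSnd q r) := by
  obtain ⟨⟨a, b⟩, ha, hb⟩ := p
  obtain ⟨⟨c, d⟩, hc, hd⟩ := q
  obtain ⟨⟨e, f⟩, he, hf⟩ := r
  dsimp only [dynFst, dynSnd] at *
  ext <;> dsimp only <;> field_simp <;> ring

theorem yangBaxter_mid (p q r : PosPair) :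
    dynSnd (dynFst p q) (dynFst (dynSnd p q) r) =
      dynFst (dynSnd p (dynFst q r)) (dynSnd q r) := by
  ext
  · rw [dynSnd_dynFst_fst, dynFst_dynSnd_dynFst_fst]
  · have h₁ := dynFst_mul_dynSnd (dynFst p q) (dynFst (dynSnd p q) r)
    have h₂ := dynFst_mul_dynSnd p q
    have h₃ := dynFst_mul_dynSnd (dynSnd p q) r
    have h₄ := dynFst_mul_dynSnd (dynSnd p (dynFst q r)) (dynSnd q r)
    have h₅ := dynFst_mul_dynSnd p (dynFst q r)
    have h₆ := dynFst_mul_dynSnd q r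
    rw [yangBaxter_fst] at h₁
    rw [yangBaxter_snd] at h₃
    have hu := (dynFst p (dynFst q r)).2.2
    have hv := (dynSnd (dynSnd p (dynFst q r)) (dynSnd q r)).2.2
    refine mul_left_cancel₀ (mul_pos (mul_pos (mul_pos hu hv)
      (dynSnd p q).2.2) (mul_pos (dynFst q r).2.2 (dynSnd p (dynFst q r)).2.2)).ne' ?_
    generalize (dynFst p (dynFst q r)).1.2 = u at *
    generalize (dynSnd (dynSnd p (dynFst q r)) (dynSnd q r)).1.2 = v at *
    generalize (dynSnd (dynFst p q) (dynFst (dynSnd p q) r)).1.2 = x at *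
    generalize (dynFst (dynSnd p (dynFst q r)) (dynSnd q r)).1.2 = y at *
    generalize (dynSnd p (dynFst q r)).1.2 = s₁ at *
    generalize (dynSnd q r).1.2 = s₂ at *
    generalize (dynFst q r).1.2 = s₃ at *
    generalize (dynFst (dynSnd p q) r).1.2 = s₄ at *
    generalize (dynSnd p q).1.2 = s₅ at *
    generalize (dynFst p q).1.2 = s₆ at *
    grind

end PosPair

namespace IsBraidFamily

variable {G : Type*} [Group G] {s : ℕ → G} {N : ℕ}

/-- The pure braid pushing the first strand around the strand `j + 1`. -/
def pushGen (s : ℕ → G) (j : ℕ) : G := ascProd s j * (s j * s j) * (ascProd s j)⁻¹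

theorem inv_mul_pushGen_mul (hs : IsBraidFamily s N) {j : ℕ} (hj : j + 1 < N) :
    (s (j + 1))⁻¹ * pushGen s j * s (j + 1) = pushGen s (j + 1) := by
  have hc := hs.commute_ascProd (Nat.lt_succ_self j) hj
  have hb := hs.braid j hj
  have h : s (j + 1) * (s j * (s (j + 1) * s (j + 1)) * (s j)⁻¹) = (s j * s j) * s (j + 1) := by
    calc s (j + 1) * (s j * (s (j + 1) * s (j + 1)) * (s j)⁻¹)
        = (s (j + 1) * s j * s (j + 1)) * s (j + 1) * (s j)⁻¹ := by group
      _ = s j * (s (j + 1) * s j * s (j + 1)) * (s j)⁻¹ := by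
        nth_rewrite 1 [← hb]; group
      _ = s j * (s j * s (j + 1) * s j) * (s j)⁻¹ := by rw [← hb]
      _ = (s j * s j) * s (j + 1) := by group
  have h' : s j * (s (j + 1) * s (j + 1)) * (s j)⁻¹ =
      (s (j + 1))⁻¹ * ((s j * s j) * s (j + 1)) := by
    rw [← h, inv_mul_cancel_left]
  have h₁ := hc.eq
  have h₂ := hc.inv_right.eq
  have h₃ := hc.inv_left.eq
  calc (s (j + 1))⁻¹ * pushGen s j * s (j + 1)
      = (s (j + 1))⁻¹ * ascProd s j * (s j * s j) * ((ascProd s j)⁻¹ * s (j + 1)) := by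
        simp only [pushGen, mul_assoc]
    _ = ascProd s j * ((s (j + 1))⁻¹ * ((s j * s j) * s (j + 1))) * (ascProd s j)⁻¹ := by
        rw [h₃, ← h₂]; simp only [mul_assoc]
    _ = pushGen s (j + 1) := by rw [← h']; simp only [pushGen, ascProd]; group

theorem commute_pushGen (hs : IsBraidFamily s N) {i j : ℕ} (hi₀ : 1 ≤ i) (hi : i < N)
    (hj : j < N) (h₁ : i ≠ j) (h₂ : i ≠ j + 1) : Commute (s i) (pushGen s j) := by
  rcases Nat.lt_or_ge j i with h | h
  · have hc := (hs.commute_ascProd h hi).symm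
    have hm : Commute (s i) (s j) := (hs.comm j i (by omega) hi).symm
    exact (hc.mul_right (hm.mul_right hm)).mul_right hc.inv_right
  · obtain ⟨i, rfl⟩ : ∃ m, i = m + 1 := ⟨i - 1, by omega⟩
    have hc : s (i + 1) = ascProd s j * s i * (ascProd s j)⁻¹ := by
      rw [hs.ascProd_mul (by omega) hj.le, mul_inv_cancel_right]
    have hm : Commute (s i) (s j) := hs.comm i j (by omega) hj
    rw [hc, pushGen, Commute.conj_iff]
    exact hm.mul_right hm

theorem commute_pushGen_mul_pushGen (hs : IsBraidFamily s N) {j : ℕ} (hj : j + 1 < N) :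
    Commute (s (j + 1)) (pushGen s (j + 1) * pushGen s j) := by
  have hc := hs.commute_ascProd (Nat.lt_succ_self j) hj
  have hb := hs.braid j hj
  have h : pushGen s (j + 1) * pushGen s j =
      ascProd s j * (s j * s (j + 1) * s (j + 1) * s j) * (ascProd s j)⁻¹ := by
    simp only [pushGen, ascProd]; group
  rw [h]
  refine (hc.symm.mul_right ?_).mul_right hc.symm.inv_right
  change s (j + 1) * (s j * s (j + 1) * s (j + 1) * s j) = _ * s (j + 1)
  calc s (j + 1) * (s j * s (j + 1) * s (j + 1) * s j)
      = (s (j + 1) * s j * s (j + 1)) * s (j + 1) * s j := by group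
    _ = s j * s (j + 1) * (s j * s (j + 1) * s j) := by rw [← hb]; group
    _ = _ := by rw [hb]; group

/-- The subgroup generated by the pure braids that push the first strand. -/
def pushSubgroup (s : ℕ → G) (N : ℕ) : Subgroup G := Subgroup.closure (pushGen s '' Set.Iio N)

theorem pushGen_mem {j : ℕ} (hj : j < N) : pushGen s j ∈ pushSubgroup s N :=
  Subgroup.subset_closure ⟨j, hj, rfl⟩

theorem inv_conj_mem_pushSubgroup (hs : IsBraidFamily s N) {i : ℕ} (hi : i + 1 < N) {a : G}
    (ha : a ∈ pushSubgroup s N) : (s (i + 1))⁻¹ * a * s (i + 1) ∈ pushSubgroup s N := by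
  have key : pushSubgroup s N ≤
      (pushSubgroup s N).comap (MulAut.conj (s (i + 1))⁻¹).toMonoidHom := by
    refine (Subgroup.closure_le _).2 ?_
    rintro _ ⟨j, hj, rfl⟩
    have hj' : j < N := hj
    change (s (i + 1))⁻¹ * pushGen s j * (s (i + 1))⁻¹⁻¹ ∈ pushSubgroup s N
    rw [inv_inv]
    by_cases h₁ : j = i
    · subst h₁
      rw [hs.inv_mul_pushGen_mul hi]
      exact pushGen_mem hi
    by_cases h₂ : j = i + 1
    · subst h₂
      have h₃ := hs.inv_mul_pushGen_mul hi
      have h₄ := (hs.commute_pushGen_mul_pushGen hi).eq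
      have h₅ : (s (i + 1))⁻¹ * pushGen s (i + 1) * s (i + 1) =
          pushGen s (i + 1) * pushGen s i * (pushGen s (i + 1))⁻¹ := by
        rw [eq_mul_inv_iff_mul_eq]
        nth_rewrite 2 [← h₃]
        calc _ = (s (i + 1))⁻¹ * (pushGen s (i + 1) * pushGen s i * s (i + 1)) := by group
          _ = _ := by rw [← h₄, inv_mul_cancel_left]
      rw [h₅]
      exact mul_mem (mul_mem (pushGen_mem hi) (pushGen_mem (by omega)))
        (inv_mem (pushGen_mem hi))
    · have h₃ := hs.commute_pushGen (by omega) hi hj' (Ne.symm h₂) (by omega)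
      rw [h₃.inv_left.eq, inv_mul_cancel_right]
      exact pushGen_mem hj'
  simpa using key ha

theorem conj_mem_pushSubgroup (hs : IsBraidFamily s N) {i : ℕ} (hi : i + 1 < N) {a : G}
    (ha : a ∈ pushSubgroup s N) : s (i + 1) * a * (s (i + 1))⁻¹ ∈ pushSubgroup s N := by
  have key : pushSubgroup s N ≤
      (pushSubgroup s N).comap (MulAut.conj (s (i + 1))).toMonoidHom := by
    refine (Subgroup.closure_le _).2 ?_
    rintro _ ⟨j, hj, rfl⟩
    have hj' : j < N := hj
    change s (i + 1) * pushGen s j * (s (i + 1))⁻¹ ∈ pushSubgroup s N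
    have h₀ : pushGen s i = s (i + 1) * pushGen s (i + 1) * (s (i + 1))⁻¹ := by
      rw [← hs.inv_mul_pushGen_mul hi]; group
    by_cases h₂ : j = i + 1
    · subst h₂
      rw [← h₀]
      exact pushGen_mem (by omega)
    by_cases h₁ : j = i
    · subst h₁
      have h₄ := (hs.commute_pushGen_mul_pushGen hi).eq
      have h₅ : s (j + 1) * pushGen s j * (s (j + 1))⁻¹ =
          (pushGen s j)⁻¹ * (pushGen s (j + 1) * pushGen s j) := by
        rw [eq_inv_mul_iff_mul_eq]
        nth_rewrite 1 [h₀]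
        calc _ = (s (j + 1) * (pushGen s (j + 1) * pushGen s j)) * (s (j + 1))⁻¹ := by group
          _ = _ := by rw [h₄, mul_inv_cancel_right]
      rw [h₅]
      exact mul_mem (inv_mem (pushGen_mem hj')) (mul_mem (pushGen_mem hi) (pushGen_mem hj'))
    · have h₃ := hs.commute_pushGen (by omega) hi hj' (Ne.symm h₂) (by omega)
      rw [h₃.eq, mul_inv_cancel_right]
      exact pushGen_mem hj'
  simpa using key ha

/-- Combing: a braid is the product of a braid on the last strands, of a pure braid pushing the
first strand, and of a coset representative. -/
theorem exists_combing (hs : IsBraidFamily s N) {g : G}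
    (hg : g ∈ Subgroup.closure (s '' Set.Iio N)) :
    ∃ b ∈ Subgroup.closure ((fun i => s (i + 1)) '' Set.Iio (N - 1)),
      ∃ a ∈ pushSubgroup s N, ∃ j ≤ N, g = b * a * ascProd s j := by
  have hB : ∀ i, i + 1 < N → s (i + 1) ∈
      Subgroup.closure ((fun i => s (i + 1)) '' Set.Iio (N - 1)) := fun i hi =>
    Subgroup.subset_closure ⟨i, Set.mem_Iio.2 (by omega), rfl⟩
  induction hg using Subgroup.closure_induction_right with
  | one => exact ⟨1, one_mem _, 1, one_mem _, 0, Nat.zero_le _, by simp [ascProd]⟩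
  | mul_right x _ y hy ih =>
    obtain ⟨b, hb, a, ha, j, hj, rfl⟩ := ih
    obtain ⟨i, hi, rfl⟩ := hy
    replace hi : i < N := hi
    have comb (m : ℕ) (hm : m + 1 < N) (h : ascProd s j * s i = s (m + 1) * ascProd s j) :
        ∃ b' ∈ Subgroup.closure ((fun i => s (i + 1)) '' Set.Iio (N - 1)),
          ∃ a' ∈ pushSubgroup s N, ∃ j' ≤ N,
            b * a * ascProd s j * s i = b' * a' * ascProd s j' := by
      refine ⟨b * s (m + 1), mul_mem hb (hB m hm), _, hs.inv_conj_mem_pushSubgroup hm ha, j, hj,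
        ?_⟩
      rw [mul_assoc, h]
      group
    rcases lt_trichotomy i j with h | h | h
    · by_cases h' : j = i + 1
      · subst h'
        refine ⟨b, hb, a * pushGen s i, mul_mem ha (pushGen_mem hi), i, hi.le, ?_⟩
        simp only [pushGen, ascProd]
        group
      · exact comb i (by omega) (hs.ascProd_mul (by omega) hj)
    · subst h
      exact ⟨b, hb, a, ha, i + 1, hi, by simp only [ascProd, mul_assoc]⟩
    · obtain ⟨i, rfl⟩ : ∃ m, i = m + 1 := ⟨i - 1, by omega⟩
      exact comb i hi (hs.commute_ascProd h hi).eq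
  | mul_inv_cancel x _ y hy ih =>
    obtain ⟨b, hb, a, ha, j, hj, rfl⟩ := ih
    obtain ⟨i, hi, rfl⟩ := hy
    replace hi : i < N := hi
    have comb (m : ℕ) (hm : m + 1 < N) (h : ascProd s j * s i = s (m + 1) * ascProd s j) :
        ∃ b' ∈ Subgroup.closure ((fun i => s (i + 1)) '' Set.Iio (N - 1)),
          ∃ a' ∈ pushSubgroup s N, ∃ j' ≤ N,
            b * a * ascProd s j * (s i)⁻¹ = b' * a' * ascProd s j' := by
      refine ⟨b * (s (m + 1))⁻¹, mul_mem hb (inv_mem (hB m hm)), _,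
        hs.conj_mem_pushSubgroup hm ha, j, hj, ?_⟩
      have h' : ascProd s j * (s i)⁻¹ = (s (m + 1))⁻¹ * ascProd s j := by
        rw [mul_inv_eq_iff_eq_mul, mul_assoc, h, inv_mul_cancel_left]
      rw [mul_assoc, h']
      group
    rcases lt_trichotomy i j with h | h | h
    · by_cases h' : j = i + 1
      · subst h'
        exact ⟨b, hb, a, ha, i, hi.le, by simp only [ascProd]; group⟩
      · exact comb i (by omega) (hs.ascProd_mul (by omega) hj)
    · subst h
      refine ⟨b, hb, a * (pushGen s i)⁻¹, mul_mem ha (inv_mem (pushGen_mem hi)), i + 1, hi, ?_⟩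
      simp only [pushGen, ascProd]
      group
    · obtain ⟨i, rfl⟩ : ∃ m, i = m + 1 := ⟨i - 1, by omega⟩
      exact comb i hi (hs.commute_ascProd h hi).eq

end IsBraidFamily

open FreeGroup in
/-- The action of the `i`-th Artin generator on the free group. -/
def artin (i : ℕ) : MulAut (FreeGroup ℕ) :=
  MonoidHom.toMulEquiv
    (lift fun j => if j = i then of i * of (i + 1) * (of i)⁻¹ else if j = i + 1 then of i else of j)
    (lift fun j => if j = i then of (i + 1) else
      if j = i + 1 then (of (i + 1))⁻¹ * of i * of (i + 1) else of j)
    (by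
      ext j
      by_cases h₁ : j = i
      · simp [h₁]; group
      · by_cases h₂ : j = i + 1 <;> simp [h₁, h₂])
    (by
      ext j
      by_cases h₁ : j = i
      · simp [h₁]
      · by_cases h₂ : j = i + 1
        · simp [h₂]; group
        · simp [h₁, h₂])

namespace FreeGroup

theorem artin_of (i j : ℕ) : artin i (of j) =
    if j = i then of i * of (i + 1) * (of i)⁻¹ else if j = i + 1 then of i else of j := by
  simp [artin]

@[simp] theorem artin_of_self (i : ℕ) : artin i (of i) = of i * of (i + 1) * (of i)⁻¹ := by
  simp [artin_of]

@[simp] theorem artin_of_succ (i : ℕ) : artin i (of (i + 1)) = of i := by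
  simp [artin_of]

theorem artin_of_of_ne {i j : ℕ} (h₁ : j ≠ i) (h₂ : j ≠ i + 1) : artin i (of j) = of j := by
  simp [artin_of, h₁, h₂]

theorem mulAut_ext {α : Type*} {f g : MulAut (FreeGroup α)} (h : ∀ a, f (of a) = g (of a)) :
    f = g := by
  have h' : f.toMonoidHom = g.toMonoidHom := by ext a; exact h a
  ext x
  exact DFunLike.congr_fun h' x

theorem isBraidFamily_artin (N : ℕ) : IsBraidFamily artin N where
  comm i j hij _ := by
    refine mulAut_ext fun m => ?_
    have h₁ : artin j (of i) = of i := artin_of_of_ne (by omega) (by omega)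
    have h₂ : artin j (of (i + 1)) = of (i + 1) := artin_of_of_ne (by omega) (by omega)
    have h₃ : artin i (of j) = of j := artin_of_of_ne (by omega) (by omega)
    have h₄ : artin i (of (j + 1)) = of (j + 1) := artin_of_of_ne (by omega) (by omega)
    simp only [MulAut.mul_apply]
    by_cases hi : m = i
    · subst hi; simp [h₁, h₂]
    by_cases hi' : m = i + 1
    · subst hi'; simp [h₁, h₂]
    by_cases hj : m = j
    · subst hj; simp [h₃, h₄]
    by_cases hj' : m = j + 1
    · subst hj'; simp [h₃, h₄]
    rw [artin_of_of_ne hi hi', artin_of_of_ne hj hj', artin_of_of_ne hi hi']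
  braid i _ := by
    refine mulAut_ext fun m => ?_
    have h₁ : artin (i + 1) (of i) = of i := artin_of_of_ne (by omega) (by omega)
    have h₂ : artin i (of (i + 1 + 1)) = of (i + 1 + 1) := artin_of_of_ne (by omega) (by omega)
    simp only [MulAut.mul_apply]
    by_cases hi : m = i
    · subst hi; simp [h₁, h₂, mul_assoc]
    by_cases hi' : m = i + 1
    · subst hi'; simp [h₁, h₂, mul_assoc]
    by_cases hj' : m = i + 1 + 1
    · subst hj'; simp [h₁, h₂]
    rw [artin_of_of_ne hi hi', artin_of_of_ne hi' hj', artin_of_of_ne hi hi', artin_of_of_ne hi' hj']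

/-- The endomorphism killing the `k`-th generator. -/
def erase (k : ℕ) : FreeGroup ℕ →* FreeGroup ℕ := lift fun j => if j = k then 1 else of j

@[simp] theorem erase_of_self (k : ℕ) : erase k (of k) = 1 := by simp [erase]

theorem erase_of_of_ne {k j : ℕ} (h : j ≠ k) : erase k (of j) = of j := by simp [erase, h]

@[simp] theorem erase_of_succ (k : ℕ) : erase k (of (k + 1)) = of (k + 1) :=
  erase_of_of_ne (by omega)

theorem erase_artin {k i : ℕ} (h : k < i) (x : FreeGroup ℕ) :
    erase k (artin i x) = artin i (erase k x) := by
  have h' : (erase k).comp (artin i).toMonoidHom = (artin i).toMonoidHom.comp (erase k) := by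
    ext j
    change erase k (artin i (of j)) = artin i (erase k (of j))
    have h₁ : erase k (of i) = of i := erase_of_of_ne (by omega)
    have h₂ : erase k (of (i + 1)) = of (i + 1) := erase_of_of_ne (by omega)
    by_cases hi : j = i
    · subst hi; simp [h₁, h₂]
    by_cases hi' : j = i + 1
    · subst hi'; simp [h₁, h₂]
    rw [artin_of_of_ne hi hi']
    by_cases hk : j = k
    · subst hk; simp
    · rw [erase_of_of_ne hk, artin_of_of_ne hi hi']
  exact DFunLike.congr_fun h' x

theorem erase_artin_inv {k i : ℕ} (h : k < i) (x : FreeGroup ℕ) :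
    erase k ((artin i)⁻¹ x) = (artin i)⁻¹ (erase k x) := by
  apply (artin i).injective
  rw [← erase_artin h, MulAut.apply_inv_self, MulAut.apply_inv_self]

theorem erase_artin_artin (k : ℕ) (x : FreeGroup ℕ) :
    erase k (artin k (artin k x)) = erase k x := by
  have h' : (erase k).comp ((artin k).toMonoidHom.comp (artin k).toMonoidHom) = erase k := by
    ext j
    change erase k (artin k (artin k (of j))) = erase k (of j)
    by_cases hi : j = k
    · subst hi; simp
    by_cases hi' : j = k + 1
    · subst hi'; simp
    rw [artin_of_of_ne hi hi', artin_of_of_ne hi hi']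
  exact DFunLike.congr_fun h' x

theorem erase_eq_one_of_conj {k : ℕ} {W : FreeGroup ℕ} (h : W * of k * W⁻¹ = of k) :
    erase k W = 1 := by
  let θ : FreeGroup ℕ →* Equiv.Perm (FreeGroup ℕ × Bool) := lift fun j =>
    if j = k then Equiv.swap (1, true) (1, false)
    else (Equiv.mulLeft (of j)).prodCongr (Equiv.refl Bool)
  have hfst : ∀ (x : FreeGroup ℕ) (z : FreeGroup ℕ × Bool), (θ x z).1 = erase k x * z.1 := by
    have hof : ∀ (j : ℕ) (z : FreeGroup ℕ × Bool), (θ (of j) z).1 = erase k (of j) * z.1 := by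
      intro j z
      by_cases hj : j = k
      · subst hj
        simp only [θ, lift_apply_of, if_true, erase_of_self, one_mul]
        rw [Equiv.swap_apply_def]
        split_ifs with h₁ h₂
        · rw [h₁]
        · rw [h₂]
        · rfl
      · simp [θ, hj, erase]
    intro x
    induction x using FreeGroup.induction_on with
    | C1 => intro z; simp
    | of j => exact hof j
    | inv_of j _ =>
      intro z
      have h₁ := hof j ((θ (of j))⁻¹ z)
      rw [← Equiv.Perm.mul_apply, mul_inv_cancel, Equiv.Perm.one_apply] at h₁
      rw [_root_.map_inv, _root_.map_inv, h₁, inv_mul_cancel_left]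
    | mul x y hx hy =>
      intro z
      rw [_root_.map_mul, _root_.map_mul, Equiv.Perm.mul_apply, hx, hy, mul_assoc]
  have hk : θ (of k) = Equiv.swap (1, true) (1, false) := by simp [θ]
  have h₁ := congrArg θ h
  rw [_root_.map_mul, _root_.map_mul, _root_.map_inv, hk, ← Equiv.swap_apply_apply] at h₁
  have h₂ := DFunLike.congr_fun h₁ (θ W (1, true))
  rw [Equiv.swap_apply_left] at h₂
  by_contra hW
  have h₃ : (θ W (1, true)).1 ≠ 1 := by simpa [hfst] using hW
  rw [Equiv.swap_apply_of_ne_of_ne (by intro h; simp [h] at h₃) (by intro h; simp [h] at h₃)] at h₂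
  have h₄ := (θ W).injective h₂
  simp at h₄

end FreeGroup

namespace IsBraidFamily

open FreeGroup (of erase)

variable {G : Type*} [Group G] {s : ℕ → G} {N k : ℕ} {π : G →* MulAut (FreeGroup ℕ)}

theorem pushGen_spec (hs : IsBraidFamily s N) (hπ : ∀ i < N, π (s i) = artin (k + i)) {j : ℕ}
    (hj : j < N) :
    (∀ x, erase k (π (pushGen s j) x) = erase k x) ∧
      ∃ W, π (pushGen s j) (of k) = W * of k * W⁻¹ ∧ erase k W = of (k + 1 + j) := by
  induction j with
  | zero =>
    have h₁ : ∀ x, π (pushGen s 0) x = artin k (artin k x) := by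
      intro x
      simp [pushGen, ascProd, hπ 0 hj]
    refine ⟨fun x => by rw [h₁, FreeGroup.erase_artin_artin], of k * of (k + 1), ?_, ?_⟩
    · rw [h₁]; simp; group
    · simp
  | succ j ih =>
    obtain ⟨h₁, W, h₂, h₃⟩ := ih (by omega)
    have h₄ : ∀ x, π (pushGen s (j + 1)) x =
        (artin (k + (j + 1)))⁻¹ (π (pushGen s j) (artin (k + (j + 1)) x)) := by
      intro x
      rw [← hs.inv_mul_pushGen_mul hj, map_mul, map_mul, map_inv, hπ _ hj]
      rfl
    have hlt : k < k + (j + 1) := by omega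
    have hk : artin (k + (j + 1)) (of k) = of k :=
      FreeGroup.artin_of_of_ne (by omega) (by omega)
    have hk' : (artin (k + (j + 1)))⁻¹ (of k) = of k := by
      nth_rewrite 1 [← hk]; rw [MulAut.inv_apply_self]
    refine ⟨fun x => ?_, (artin (k + (j + 1)))⁻¹ W, ?_, ?_⟩
    · rw [h₄, FreeGroup.erase_artin_inv hlt, h₁, ← FreeGroup.erase_artin_inv hlt,
        MulAut.inv_apply_self]
    · rw [h₄, hk, h₂]
      simp only [map_mul, map_inv, hk']
    · rw [FreeGroup.erase_artin_inv hlt, h₃]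
      apply (artin (k + (j + 1))).injective
      rw [MulAut.apply_inv_self]
      have h := FreeGroup.artin_of_succ (k + (j + 1))
      rw [show k + 1 + (j + 1) = k + (j + 1) + 1 by omega, h]
      congr 1; omega

theorem pushSubgroup_spec (hs : IsBraidFamily s N) (hπ : ∀ i < N, π (s i) = artin (k + i))
    {a : G} (ha : a ∈ pushSubgroup s N) :
    (∀ x, erase k (π a x) = erase k x) ∧
      ∃ W w, π a (of k) = W * of k * W⁻¹ ∧ erase k W = FreeGroup.map (fun j => k + 1 + j) w ∧
        a⁻¹ = FreeGroup.lift (fun j => (pushGen s j)⁻¹) w := by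
  induction ha using Subgroup.closure_induction with
  | mem x hx =>
    obtain ⟨j, hj, rfl⟩ := hx
    obtain ⟨h₁, W, h₂, h₃⟩ := hs.pushGen_spec hπ hj
    exact ⟨h₁, W, of j, h₂, by simpa using h₃, by simp⟩
  | one => exact ⟨by simp, 1, 1, by simp, by simp, by simp⟩
  | mul a b _ _ iha ihb =>
    obtain ⟨h₁, W, w, h₂, h₃, h₄⟩ := iha
    obtain ⟨h₁', W', w', h₂', h₃', h₄'⟩ := ihb
    refine ⟨fun x => by rw [map_mul, MulAut.mul_apply, h₁, h₁'], π a W' * W, w' * w, ?_, ?_, ?_⟩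
    · rw [map_mul, MulAut.mul_apply, h₂', map_mul, map_mul, map_inv, h₂]; group
    · rw [map_mul, h₁, h₃, h₃', map_mul]
    · rw [mul_inv_rev, h₄, h₄', map_mul]
  | inv a _ iha =>
    obtain ⟨h₁, W, w, h₂, h₃, h₄⟩ := iha
    have h₅ : ∀ x, erase k (π a⁻¹ x) = erase k x := by
      intro x
      rw [← h₁, ← MulAut.mul_apply, ← map_mul]; simp
    refine ⟨h₅, π a⁻¹ W⁻¹, w⁻¹, ?_, ?_, ?_⟩
    · have h₆ := congrArg (π a⁻¹) h₂
      rw [← MulAut.mul_apply, ← map_mul] at h₆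
      simp only [inv_mul_cancel, map_one, MulAut.one_apply, map_mul, map_inv] at h₆ ⊢
      nth_rewrite 2 [h₆]
      group
    · rw [h₅, map_inv, h₃, map_inv]
    · rw [map_inv, ← h₄]

theorem fixes_of_mem_closure_shift (hπ : ∀ i < N, π (s i) = artin (k + i)) {b : G}
    (hb : b ∈ Subgroup.closure ((fun i => s (i + 1)) '' Set.Iio (N - 1))) :
    π b (of k) = of k := by
  have key : Subgroup.closure ((fun i => s (i + 1)) '' Set.Iio (N - 1)) ≤
      (MulAction.stabilizer (MulAut (FreeGroup ℕ)) (of k)).comap π := by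
    refine (Subgroup.closure_le _).2 ?_
    rintro _ ⟨i, hi, rfl⟩
    have hi' : i < N - 1 := hi
    change π (s (i + 1)) (of k) = of k
    rw [hπ _ (by omega)]
    exact FreeGroup.artin_of_of_ne (by omega) (by omega)
  exact key hb

/-- Faithfulness of the Artin representation. -/
theorem eq_one_of_artin (hs : IsBraidFamily s N) (hπ : ∀ i < N, π (s i) = artin (k + i)) {g : G}
    (hg : g ∈ Subgroup.closure (s '' Set.Iio N)) (h : π g = 1) : g = 1 := by
  induction N generalizing s k g with
  | zero => simpa using hg
  | succ N ih =>
    obtain ⟨b, hb, a, ha, j, hj, rfl⟩ := hs.exists_combing hg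
    have hbk := fixes_of_mem_closure_shift hπ hb
    obtain ⟨h₁, W, w, h₂, h₃, h₄⟩ := hs.pushSubgroup_spec hπ ha
    have h₅ : π a (π (ascProd s j) (of k)) = of k := by
      apply (π b).injective
      rw [hbk, ← MulAut.mul_apply, ← MulAut.mul_apply, ← map_mul, ← map_mul, h, MulAut.one_apply]
    rcases j with _ | j
    · have h₆ : erase k W = 1 := by
        apply FreeGroup.erase_eq_one_of_conj
        rw [← h₂]
        simpa [ascProd] using h₅
      have h₇ : w = 1 := by
        have hinj : Function.Injective fun j => k + 1 + j := fun x y hxy => by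
          simpa using hxy
        apply FreeGroup.map_injective hinj
        rw [← h₃, h₆, map_one]
      have h₈ : a = 1 := by rw [← inv_eq_one, h₄, h₇, map_one]
      subst h₈
      simp only [ascProd, mul_one] at h ⊢
      exact ih hs.shift (k := k + 1) (fun i hi => by rw [hπ _ (by omega)]; congr 1; omega) hb h
    · have hc : π (ascProd (fun i => s (i + 1)) j) (of k) = of k := by
        refine fixes_of_mem_closure_shift hπ ?_
        exact ascProd_mem (S := (Subgroup.closure _).toSubmonoid) fun i hi =>
          Subgroup.subset_closure ⟨i, Set.mem_Iio.2 (by omega), rfl⟩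
      have h₆ := congrArg (erase k) h₅
      rw [h₁, ascProd_succ_eq, map_mul, MulAut.mul_apply, hc, hπ 0 (by omega)] at h₆
      simp [FreeGroup.of_ne_one] at h₆

end IsBraidFamily

/-- The action of the `i`-th Artin generator on sequences by Dynnikov's formulas. -/
def dynPerm (i : ℕ) : Equiv.Perm (ℕ → PosPair) where
  toFun v j := if j = i then PosPair.dynFst (v i) (v (i + 1)) else
    if j = i + 1 then PosPair.dynSnd (v i) (v (i + 1)) else v j
  invFun v j := if j = i then PosPair.dynInvFst (v i) (v (i + 1)) else
    if j = i + 1 then PosPair.dynInvSnd (v i) (v (i + 1)) else v j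
  left_inv v := by
    funext j
    by_cases h₁ : j = i
    · subst h₁; simp [PosPair.dynInvFst_dyn]
    by_cases h₂ : j = i + 1
    · subst h₂; simp [PosPair.dynInvSnd_dyn]
    simp [h₁, h₂]
  right_inv v := by
    funext j
    by_cases h₁ : j = i
    · subst h₁; simp [PosPair.dynFst_dynInv]
    by_cases h₂ : j = i + 1
    · subst h₂; simp [PosPair.dynSnd_dynInv]
    simp [h₁, h₂]

namespace dynPerm

theorem apply_self (i : ℕ) (v : ℕ → PosPair) :
    dynPerm i v i = PosPair.dynFst (v i) (v (i + 1)) := by simp [dynPerm]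

theorem apply_succ (i : ℕ) (v : ℕ → PosPair) :
    dynPerm i v (i + 1) = PosPair.dynSnd (v i) (v (i + 1)) := by simp [dynPerm]

theorem apply_of_ne {i j : ℕ} (v : ℕ → PosPair) (h₁ : j ≠ i) (h₂ : j ≠ i + 1) :
    dynPerm i v j = v j := by simp [dynPerm, h₁, h₂]

theorem isBraidFamily (N : ℕ) : IsBraidFamily dynPerm N where
  comm i j hij _ := by
    ext1 v
    funext m
    simp only [Equiv.Perm.mul_apply]
    have h₁ (v) : dynPerm j v i = v i := apply_of_ne v (by omega) (by omega)
    have h₂ (v) : dynPerm j v (i + 1) = v (i + 1) := apply_of_ne v (by omega) (by omega)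
    have h₃ (v) : dynPerm i v j = v j := apply_of_ne v (by omega) (by omega)
    have h₄ (v) : dynPerm i v (j + 1) = v (j + 1) := apply_of_ne v (by omega) (by omega)
    by_cases hi : m = i
    · subst hi; simp only [h₁, h₂, apply_self]
    by_cases hi' : m = i + 1
    · subst hi'; simp only [h₁, h₂, apply_succ]
    by_cases hj : m = j
    · subst hj; simp only [h₃, h₄, apply_self]
    by_cases hj' : m = j + 1
    · subst hj'; simp only [h₃, h₄, apply_succ]
    simp only [apply_of_ne _ hi hi', apply_of_ne _ hj hj']
  braid i _ := by
    ext1 v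
    funext m
    simp only [Equiv.Perm.mul_apply]
    have h₁ (v) : dynPerm (i + 1) v i = v i := apply_of_ne v (by omega) (by omega)
    have h₂ (v) : dynPerm i v (i + 1 + 1) = v (i + 1 + 1) :=
      apply_of_ne v (by omega) (by omega)
    by_cases hi : m = i
    · subst hi
      simp only [h₁, h₂, apply_self, apply_succ]
      exact PosPair.yangBaxter_fst _ _ _
    by_cases hi' : m = i + 1
    · subst hi'
      simp only [h₁, h₂, apply_self, apply_succ]
      exact PosPair.yangBaxter_mid _ _ _
    by_cases hj' : m = i + 1 + 1
    · subst hj'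
      simp only [h₁, h₂, apply_self, apply_succ]
      exact PosPair.yangBaxter_snd _ _ _
    simp only [apply_of_ne _ hi hi', apply_of_ne _ hi' hj']

end dynPerm

/-- The braid relations on infinitely many strands. -/
def infBraidRels : Set (FreeGroup ℕ) :=
  {r | (∃ i j : ℕ, i + 2 ≤ j ∧
        r = FreeGroup.of i * FreeGroup.of j * (FreeGroup.of i)⁻¹ * (FreeGroup.of j)⁻¹) ∨
       (∃ i : ℕ, r = FreeGroup.of i * FreeGroup.of (i + 1) * FreeGroup.of i *
            (FreeGroup.of (i + 1) * FreeGroup.of i * FreeGroup.of (i + 1))⁻¹)}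

/-- The braid group on infinitely many strands. -/
abbrev InfBraidGroup := PresentedGroup infBraidRels

namespace InfBraidGroup

/-- The Artin generators. -/
def σ (i : ℕ) : InfBraidGroup := PresentedGroup.of i

theorem isBraidFamily_σ (N : ℕ) : IsBraidFamily σ N where
  comm i j hij _ := by
    have h : (PresentedGroup.mk infBraidRels) _ = 1 :=
      PresentedGroup.one_of_mem (Or.inl ⟨i, j, hij, rfl⟩)
    simp only [map_mul, map_inv] at h
    rw [mul_inv_eq_one, mul_inv_eq_iff_eq_mul] at h
    exact h
  braid i _ := by
    have h : (PresentedGroup.mk infBraidRels) _ = 1 :=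
      PresentedGroup.one_of_mem (Or.inr ⟨i, rfl⟩)
    simp only [map_mul, map_inv, mul_inv_eq_one] at h
    exact h

variable {G : Type*} [Group G]

/-- The homomorphism defined by an infinite braid family. -/
def lift (f : ℕ → G) (hf : ∀ N, IsBraidFamily f N) : InfBraidGroup →* G :=
  PresentedGroup.toGroup (f := f) <| by
    rintro r (⟨i, j, hij, rfl⟩ | ⟨i, rfl⟩)
    · have h := (hf (j + 1)).comm i j hij (by omega)
      simp [h]
    · have h := (hf (i + 2)).braid i (by omega)
      simp only [map_mul, map_inv, FreeGroup.lift_apply_of, mul_inv_eq_one]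
      exact h

@[simp] theorem lift_σ (f : ℕ → G) (hf : ∀ N, IsBraidFamily f N) (i : ℕ) :
    lift f hf (σ i) = f i := PresentedGroup.toGroup.of _

/-- The shift endomorphism. -/
def shift : InfBraidGroup →* InfBraidGroup :=
  lift (fun i => σ (i + 1)) fun N => (isBraidFamily_σ (N + 1)).shift

@[simp] theorem shift_σ (i : ℕ) : shift (σ i) = σ (i + 1) := lift_σ _ _ i

theorem closure_range_σ : Subgroup.closure (Set.range σ) = ⊤ :=
  PresentedGroup.closure_range_of _

@[elab_as_elim]
theorem induction {p : InfBraidGroup → Prop} (g : InfBraidGroup) (one : p 1)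
    (mul_σ : ∀ g i, p g → p (g * σ i)) (mul_σ_inv : ∀ g i, p g → p (g * (σ i)⁻¹)) : p g := by
  have hg : g ∈ Subgroup.closure (Set.range σ) := by rw [closure_range_σ]; trivial
  induction hg using Subgroup.closure_induction_right with
  | one => exact one
  | mul_right x _ y hy ih => obtain ⟨i, rfl⟩ := hy; exact mul_σ x i ih
  | mul_inv_cancel x _ y hy ih => obtain ⟨i, rfl⟩ := hy; exact mul_σ_inv x i ih

/-- The action on sequences by Dynnikov's formulas. -/
def dynAct : InfBraidGroup →* Equiv.Perm (ℕ → PosPair) := lift dynPerm dynPerm.isBraidFamily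

theorem dynAct_shift_zero (g : InfBraidGroup) (v : ℕ → PosPair) :
    dynAct (shift g) v 0 = v 0 := by
  have hσ (i : ℕ) (v : ℕ → PosPair) : dynAct (σ (i + 1)) v 0 = v 0 := by
    rw [dynAct, lift_σ, dynPerm.apply_of_ne v (by omega) (by omega)]
  induction g using induction generalizing v with
  | one => simp
  | mul_σ g i ih => rw [map_mul, map_mul, Equiv.Perm.mul_apply, ih, shift_σ, hσ]
  | mul_σ_inv g i ih =>
    rw [map_mul, map_mul, Equiv.Perm.mul_apply, ih, map_inv, map_inv, shift_σ,
      ← hσ i ((dynAct (σ (i + 1)))⁻¹ v), ← Equiv.Perm.mul_apply, mul_inv_cancel,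
      Equiv.Perm.one_apply]

theorem dynAct_shift_succ (g : InfBraidGroup) (v : ℕ → PosPair) (k : ℕ) :
    dynAct (shift g) v (k + 1) = dynAct g (fun j => v (j + 1)) k := by
  have hσ (i : ℕ) (v : ℕ → PosPair) :
      (fun k => dynAct (σ (i + 1)) v (k + 1)) = dynAct (σ i) fun j => v (j + 1) := by
    funext k
    simp [dynAct, dynPerm]
  induction g using induction generalizing v with
  | one => simp
  | mul_σ g i ih =>
    rw [map_mul, map_mul, Equiv.Perm.mul_apply, ih, shift_σ, hσ, map_mul, Equiv.Perm.mul_apply]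
  | mul_σ_inv g i ih =>
    have h : (fun k => (dynAct (σ (i + 1)))⁻¹ v (k + 1)) =
        (dynAct (σ i))⁻¹ fun j => v (j + 1) := by
      rw [Equiv.Perm.eq_inv_iff_eq, ← hσ, ← Equiv.Perm.mul_apply, mul_inv_cancel,
        Equiv.Perm.one_apply]
    rw [map_mul, map_mul, Equiv.Perm.mul_apply, ih, map_inv, map_inv, shift_σ, h, map_mul,
      Equiv.Perm.mul_apply, map_inv]

/-- The `σ`-positive braids whose main generator is the first one. -/
inductive IsPos : InfBraidGroup → Prop
  | base (a b : InfBraidGroup) : IsPos (shift a * σ 0 * shift b)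
  | mul {g h : InfBraidGroup} : IsPos g → IsPos h → IsPos (g * h)

theorem IsPos.shift_mul {g : InfBraidGroup} (hg : IsPos g) (a : InfBraidGroup) :
    IsPos (shift a * g) := by
  induction hg with
  | base b c => rw [mul_assoc, ← mul_assoc, ← map_mul, ← mul_assoc]; exact .base _ _
  | mul hg hh ihg _ => rw [← mul_assoc]; exact ihg.mul hh

theorem IsPos.mul_shift {g : InfBraidGroup} (hg : IsPos g) (a : InfBraidGroup) :
    IsPos (g * shift a) := by
  induction hg with
  | base b c => rw [mul_assoc, ← map_mul]; exact .base _ _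
  | mul hg hh _ ihh => rw [mul_assoc]; exact hg.mul ihh

/-- The `σ`-positive braids. -/
inductive SigmaPos : InfBraidGroup → Prop
  | of_isPos {g : InfBraidGroup} : IsPos g → SigmaPos g
  | shift {g : InfBraidGroup} : SigmaPos g → SigmaPos (shift g)

theorem SigmaPos.mul {g h : InfBraidGroup} (hg : SigmaPos g) (hh : SigmaPos h) :
    SigmaPos (g * h) := by
  induction hg generalizing h with
  | of_isPos hg =>
    cases hh with
    | of_isPos hh => exact .of_isPos (hg.mul hh)
    | shift hh => exact .of_isPos (hg.mul_shift _)
  | shift hg ih =>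
    cases hh with
    | of_isPos hh => exact .of_isPos (hh.shift_mul _)
    | shift hh => rw [← map_mul]; exact .shift (ih hh)

theorem IsPos.lt_dynAct {g : InfBraidGroup} (hg : IsPos g) (v : ℕ → PosPair) :
    (v 0).1.1 < (dynAct g v 0).1.1 := by
  induction hg generalizing v with
  | base a b =>
    rw [map_mul, map_mul, Equiv.Perm.mul_apply, Equiv.Perm.mul_apply, dynAct_shift_zero,
      ← dynAct_shift_zero b v]
    nth_rewrite 2 [dynAct]
    rw [lift_σ, dynPerm.apply_self]
    exact PosPair.fst_lt_dynFst _ _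
  | mul _ _ ihg ihh =>
    rw [map_mul, Equiv.Perm.mul_apply]
    exact (ihh v).trans (ihg _)

theorem SigmaPos.exists_lt_dynAct {g : InfBraidGroup} (hg : SigmaPos g) :
    ∃ k, ∀ v : ℕ → PosPair, (v k).1.1 < (dynAct g v k).1.1 := by
  induction hg with
  | of_isPos hg => exact ⟨0, hg.lt_dynAct⟩
  | shift _ ih =>
    obtain ⟨k, hk⟩ := ih
    exact ⟨k + 1, fun v => by rw [dynAct_shift_succ]; exact hk fun j => v (j + 1)⟩

/-- A `σ`-positive braid is nontrivial. -/
theorem not_sigmaPos_one : ¬ SigmaPos 1 := by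
  intro h
  obtain ⟨k, hk⟩ := h.exists_lt_dynAct
  have h := hk fun _ => ⟨(1, 1), by norm_num, by norm_num⟩
  simp at h

/-- The Artin representation. -/
def artinRep : InfBraidGroup →* MulAut (FreeGroup ℕ) := lift artin FreeGroup.isBraidFamily_artin

end InfBraidGroup

open Relation (ReflTransGen)

/-- Terms in one variable for a binary operation. -/
inductive LDTerm : Type
  | x : LDTerm
  | mul : LDTerm → LDTerm → LDTerm

namespace LDTerm

/-- One expansion step for the left self-distributivity law. -/
inductive Step : LDTerm → LDTerm → Prop
  | ld (a b c : LDTerm) : Step (a.mul (b.mul c)) ((a.mul b).mul (a.mul c))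
  | left {a a' : LDTerm} (b : LDTerm) : Step a a' → Step (a.mul b) (a'.mul b)
  | right (a : LDTerm) {b b' : LDTerm} : Step b b' → Step (a.mul b) (a.mul b')

/-- Iterated expansion. -/
abbrev Red : LDTerm → LDTerm → Prop := ReflTransGen Step

theorem Red.mul {a a' b b' : LDTerm} (ha : Red a a') (hb : Red b b') :
    Red (a.mul b) (a'.mul b') :=
  (ha.lift (fun a => a.mul b) fun _ _ => Step.left b).trans
    (hb.lift a'.mul fun _ _ => Step.right a')

/-- The uniform distribution of `s` over the leaves of a term. -/
def dist (s : LDTerm) : LDTerm → LDTerm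
  | x => s.mul x
  | mul a b => (dist s a).mul (dist s b)

theorem red_dist (s t : LDTerm) : Red (s.mul t) (dist s t) := by
  induction t with
  | x => exact .refl
  | mul a b iha ihb => exact .head (.ld s a b) (iha.mul ihb)

theorem Step.dist_right (s : LDTerm) {t t' : LDTerm} (h : Step t t') :
    Step (dist s t) (dist s t') := by
  induction h with
  | ld a b c => exact .ld _ _ _
  | left b _ ih => exact .left _ ih
  | right a _ ih => exact .right _ ih

theorem Red.dist {s s' t t' : LDTerm} (hs : Red s s') (ht : Red t t') :
    Red (dist s t) (dist s' t') := by
  refine Relation.ReflTransGen.trans (b := LDTerm.dist s' t) ?_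
    (ht.lift (LDTerm.dist s') fun _ _ => Step.dist_right s')
  clear ht
  induction t with
  | x => exact hs.mul .refl
  | mul a b iha ihb => exact Red.mul iha ihb

theorem red_dist_dist (s t u : LDTerm) :
    Red (dist s (dist t u)) (dist (dist s t) (dist s u)) := by
  induction u with
  | x => exact red_dist (dist s t) (dist s x)
  | mul a b iha ihb => exact iha.mul ihb

/-- The full expansion of a term. -/
def expand : LDTerm → LDTerm
  | x => x
  | mul a b => dist (expand a) (expand b)

theorem red_expand (t : LDTerm) : Red t (expand t) := by
  induction t with
  | x => exact .refl
  | mul a b iha ihb => exact (iha.mul ihb).trans (red_dist _ _)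

theorem Step.red_expand {t t' : LDTerm} (h : Step t t') : Red t' (expand t) := by
  induction h with
  | ld a b c =>
    have hd (b : LDTerm) : Red (a.mul b) (LDTerm.dist (expand a) (expand b)) :=
      LDTerm.red_expand (a.mul b)
    exact ((hd b).mul (hd c)).trans (Red.dist .refl (red_dist (expand b) (expand c)))
  | left b _ ih => exact (ih.mul (LDTerm.red_expand b)).trans (red_dist _ _)
  | right a _ ih => exact ((LDTerm.red_expand a).mul ih).trans (red_dist _ _)

theorem Step.expand {t t' : LDTerm} (h : Step t t') : Red (expand t) (expand t') := by
  induction h with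
  | ld a b c => exact red_dist_dist _ _ _
  | left b _ ih => exact ih.dist .refl
  | right a _ ih => exact Red.dist .refl ih

theorem Red.expand_iterate {t t' : LDTerm} (h : Red t t') (m : ℕ) :
    Red (expand^[m] t) (expand^[m] t') := by
  induction m with
  | zero => exact h
  | succ m ih =>
    rw [Function.iterate_succ_apply', Function.iterate_succ_apply']
    exact Relation.ReflTransGen.trans_induction_on (motive := fun {a b} _ =>
      Red (LDTerm.expand a) (LDTerm.expand b)) ih (fun _ => .refl) (fun h => h.expand)
      fun _ _ h₁ h₂ => h₁.trans h₂

theorem red_expand_iterate (t : LDTerm) (m : ℕ) : Red t (expand^[m] t) := by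
  induction m with
  | zero => exact .refl
  | succ m ih =>
    rw [Function.iterate_succ_apply']
    exact ih.trans (red_expand _)

/-- The congruence generated by left self-distributivity. -/
abbrev Conv : LDTerm → LDTerm → Prop := ReflTransGen fun a b => Step a b ∨ Step b a

theorem Conv.symm {a b : LDTerm} (h : Conv a b) : Conv b a :=
  by
  induction h with
  | refl => exact .refl
  | tail _ h ih => exact .head h.symm ih

theorem Conv.mul_right (a : LDTerm) {b b' : LDTerm} (h : Conv b b') :
    Conv (a.mul b) (a.mul b') :=
  h.lift a.mul fun _ _ => Or.imp (.right a) (.right a)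

theorem Conv.exists_red {t t' : LDTerm} (h : Conv t t') : ∃ m, Red t (expand^[m] t') := by
  induction h with
  | refl => exact ⟨0, .refl⟩
  | tail _ h ih =>
    obtain ⟨m, hm⟩ := ih
    rcases h with h | h
    · exact ⟨m, hm.trans (Red.expand_iterate (.single h) m)⟩
    · exact ⟨m + 1, hm.trans (h.red_expand.expand_iterate m)⟩

/-- The right powers of the variable. -/
def pow : ℕ → LDTerm
  | 0 => x
  | n + 1 => x.mul (pow n)

theorem exists_conv_pow (t : LDTerm) : ∃ m, ∀ n ≥ m, Conv (t.mul (pow n)) (pow (n + 1)) := by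
  induction t with
  | x => exact ⟨0, fun n _ => .refl⟩
  | mul a b iha ihb =>
    obtain ⟨p, hp⟩ := iha
    obtain ⟨q, hq⟩ := ihb
    refine ⟨p + q + 1, fun n hn => ?_⟩
    obtain ⟨n, rfl⟩ : ∃ k, n = k + 1 := ⟨n - 1, by omega⟩
    exact (((hp n (by omega)).symm.mul_right (a.mul b)).tail (.inr (.ld a b (pow n)))).trans
      (((hq n (by omega)).mul_right a).trans (hp (n + 1) (by omega)))

/-- The iterated left subterm relation. -/
inductive LSub : LDTerm → LDTerm → Prop
  | base (a b : LDTerm) : LSub a (a.mul b)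
  | step {a b : LDTerm} (c : LDTerm) : LSub a b → LSub a (b.mul c)

theorem LSub.exists_of_step {a t s : LDTerm} (h : LSub a t) (hs : Step t s) :
    ∃ a', Red a a' ∧ LSub a' s := by
  induction h generalizing s with
  | base b =>
    cases hs with
    | ld u v => exact ⟨a, .refl, .step _ (.base _ _)⟩
    | left _ h => exact ⟨_, .single h, .base _ _⟩
    | right _ h => exact ⟨a, .refl, .base _ _⟩
  | step c h ih =>
    cases hs with
    | ld u v => exact ⟨a, .refl, .step _ (.step _ h)⟩
    | left _ hs =>
      obtain ⟨a', h₁, h₂⟩ := ih hs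
      exact ⟨a', h₁, .step _ h₂⟩
    | right _ hs => exact ⟨a, .refl, .step _ h⟩

theorem LSub.exists_of_red {a t s : LDTerm} (h : LSub a t) (hs : Red t s) :
    ∃ a', Red a a' ∧ LSub a' s := by
  induction hs with
  | refl => exact ⟨a, .refl, h⟩
  | tail _ hs ih =>
    obtain ⟨b, hb, h'⟩ := ih
    obtain ⟨c, hc, h''⟩ := h'.exists_of_step hs
    exact ⟨c, hb.trans hc, h''⟩

theorem LSub.trichotomy {a b t : LDTerm} (ha : LSub a t) (hb : LSub b t) :
    LSub a b ∨ a = b ∨ LSub b a := by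
  induction ha with
  | base c =>
    cases hb with
    | base => exact .inr (.inl rfl)
    | step _ h => exact .inr (.inr h)
  | step c h ih =>
    cases hb with
    | base => exact .inl h
    | step _ h' => exact ih h'

/-- Any two terms admit expansions that are comparable for the left subterm relation. -/
theorem exists_red_trichotomy (t t' : LDTerm) :
    ∃ a a', Red t a ∧ Red t' a' ∧ (LSub a a' ∨ a = a' ∨ LSub a' a) := by
  obtain ⟨p, hp⟩ := exists_conv_pow t
  obtain ⟨q, hq⟩ := exists_conv_pow t'
  obtain ⟨m, hm⟩ := (hp (p + q) (by omega)).exists_red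
  obtain ⟨m', hm'⟩ := (hq (p + q) (by omega)).exists_red
  replace hm := hm.trans (red_expand_iterate _ m')
  replace hm' := hm'.trans (red_expand_iterate _ m)
  rw [← Function.iterate_add_apply] at hm hm'
  rw [add_comm m'] at hm
  obtain ⟨a, ha, h⟩ := (LSub.base _ _).exists_of_red hm
  obtain ⟨a', ha', h'⟩ := (LSub.base _ _).exists_of_red hm'
  exact ⟨a, a', ha, ha', h.trichotomy h'⟩

end LDTerm

namespace InfBraidGroup

theorem commute_σ_zero_shift_shift (g : InfBraidGroup) : Commute (σ 0) (shift (shift g)) := by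
  have hσ (i : ℕ) : Commute (σ 0) (shift (shift (σ i))) := by
    rw [shift_σ, shift_σ]
    exact (isBraidFamily_σ (i + 3)).comm 0 (i + 1 + 1) (by omega) (by omega)
  induction g using induction with
  | one => simp
  | mul_σ g i ih => rw [map_mul, map_mul]; exact ih.mul_right (hσ i)
  | mul_σ_inv g i ih =>
    rw [map_mul, map_mul, map_inv, map_inv]; exact ih.mul_right (hσ i).inv_right

/-- Dehornoy's left self-distributive operation on braids. -/
def ldOp (a b : InfBraidGroup) : InfBraidGroup := a * shift b * σ 0 * (shift a)⁻¹

theorem ldOp_ldOp (a b c : InfBraidGroup) :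
    ldOp a (ldOp b c) = ldOp (ldOp a b) (ldOp a c) := by
  have hb := (commute_σ_zero_shift_shift b).inv_right.eq
  have hc := (commute_σ_zero_shift_shift c).eq
  have ha := (commute_σ_zero_shift_shift a).eq
  have hσ : σ 0 * σ 1 * σ 0 = σ 1 * σ 0 * σ 1 := (isBraidFamily_σ 2).braid 0 (by omega)
  simp only [ldOp, map_mul, map_inv, shift_σ, zero_add, mul_inv_rev, inv_inv]
  symm
  calc _ = a * shift b * (σ 0 * shift (shift c)) * σ 1 * (shift (shift a))⁻¹ *
        (σ 0 * shift (shift a)) * (σ 1)⁻¹ * (shift (shift b))⁻¹ * (shift a)⁻¹ := by group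
    _ = a * shift b * shift (shift c) * (σ 0 * σ 1 * σ 0) * (σ 1)⁻¹ *
        (shift (shift b))⁻¹ * (shift a)⁻¹ := by rw [hc, ha]; group
    _ = a * shift b * shift (shift c) * σ 1 * (σ 0 * (shift (shift b))⁻¹) * (shift a)⁻¹ := by
      rw [hσ]; group
    _ = _ := by rw [hb]; group

/-- The evaluation of a term at the trivial braid. -/
def eval : LDTerm → InfBraidGroup
  | .x => 1
  | .mul a b => ldOp (eval a) (eval b)

theorem eval_eq_of_step {t t' : LDTerm} (h : LDTerm.Step t t') : eval t = eval t' := by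
  induction h with
  | ld a b c => exact ldOp_ldOp _ _ _
  | left b _ ih => simp only [eval, ih]
  | right a _ ih => simp only [eval, ih]

theorem eval_eq_of_red {t t' : LDTerm} (h : LDTerm.Red t t') : eval t = eval t' := by
  induction h with
  | refl => rfl
  | tail _ h ih => exact ih.trans (eval_eq_of_step h)

theorem isPos_of_lSub {t t' : LDTerm} (h : LDTerm.LSub t t') : IsPos ((eval t)⁻¹ * eval t') := by
  have hop (a b : InfBraidGroup) : IsPos (a⁻¹ * ldOp a b) := by
    have h := IsPos.base b a⁻¹
    rw [map_inv] at h
    simpa only [ldOp, mul_assoc, inv_mul_cancel_left] using h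
  induction h with
  | base b => exact hop _ _
  | @step b c _ ih =>
    have h := ih.mul (hop (eval b) (eval c))
    rwa [mul_assoc, mul_inv_cancel_left] at h

theorem eval_trichotomy (t t' : LDTerm) :
    IsPos ((eval t)⁻¹ * eval t') ∨ eval t = eval t' ∨ IsPos ((eval t')⁻¹ * eval t) := by
  obtain ⟨a, a', ha, ha', h⟩ := LDTerm.exists_red_trichotomy t t'
  rw [eval_eq_of_red ha, eval_eq_of_red ha']
  exact h.imp isPos_of_lSub (Or.imp (congrArg eval) isPos_of_lSub)

/-- The shifted product of the evaluations of a list of terms. -/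
def shiftProd : List LDTerm → InfBraidGroup
  | [] => 1
  | t :: l => eval t * shift (shiftProd l)

theorem exists_shiftProd_mul_σ {i : ℕ} {l : List LDTerm} (h : i + 1 < l.length) :
    ∃ l' : List LDTerm, l'.length = l.length ∧ shiftProd l' = shiftProd l * σ i := by
  induction i generalizing l with
  | zero =>
    obtain _ | ⟨a, _ | ⟨b, l⟩⟩ := l
    · simp at h
    · simp at h
    refine ⟨a.mul b :: a :: l, rfl, ?_⟩
    have hc := (commute_σ_zero_shift_shift (shiftProd l)).eq
    simp only [shiftProd, eval, ldOp, map_mul, mul_assoc, inv_mul_cancel_left, hc]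
  | succ i ih =>
    obtain _ | ⟨a, l⟩ := l
    · simp at h
    obtain ⟨l', h₁, h₂⟩ := ih (l := l) (by simpa using h)
    refine ⟨a :: l', by simp [h₁], ?_⟩
    simp only [shiftProd, h₂, map_mul, shift_σ, mul_assoc]

theorem exists_shiftProd_eq {N : ℕ} {g : InfBraidGroup}
    (hg : g ∈ Submonoid.closure (σ '' Set.Iio N)) :
    ∃ l : List LDTerm, l.length = N + 1 ∧ shiftProd l = g := by
  induction hg using Submonoid.closure_induction_right with
  | one =>
    refine ⟨List.replicate (N + 1) .x, List.length_replicate, ?_⟩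
    generalize N + 1 = m
    induction m with
    | zero => rfl
    | succ m ih => rw [List.replicate_succ, shiftProd, ih]; simp [eval]
  | mul_right g _ y hy ih =>
    obtain ⟨i, hi, rfl⟩ := hy
    obtain ⟨l, hl, rfl⟩ := ih
    obtain ⟨l', h₁, h₂⟩ := exists_shiftProd_mul_σ (i := i) (l := l)
      (by rw [hl]; exact Nat.succ_lt_succ hi)
    exact ⟨l', h₁.trans hl, h₂⟩

theorem shiftProd_trichotomy {l l' : List LDTerm} (h : l.length = l'.length) :
    SigmaPos ((shiftProd l)⁻¹ * shiftProd l') ∨ shiftProd l = shiftProd l' ∨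
      SigmaPos ((shiftProd l')⁻¹ * shiftProd l) := by
  have key (a b p q : InfBraidGroup) (h : IsPos (a⁻¹ * b)) :
      SigmaPos ((a * shift p)⁻¹ * (b * shift q)) := by
    have h := (h.shift_mul p⁻¹).mul_shift q
    rw [map_inv] at h
    exact .of_isPos (by simpa only [mul_inv_rev, mul_assoc] using h)
  induction l generalizing l' with
  | nil =>
    obtain rfl : l' = [] := by simpa using h.symm
    exact .inr (.inl rfl)
  | cons t l ih =>
    obtain _ | ⟨t', l'⟩ := l'
    · simp at h
    simp only [shiftProd]
    rcases eval_trichotomy t t' with ht | ht | ht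
    · exact .inl (key _ _ _ _ ht)
    · have hs (p q : InfBraidGroup) (h : SigmaPos (p⁻¹ * q)) :
          SigmaPos ((eval t' * shift p)⁻¹ * (eval t' * shift q)) := by
        have h := h.shift
        rw [map_mul, map_inv] at h
        simpa only [mul_inv_rev, mul_assoc, inv_mul_cancel_left] using h
      rw [ht]
      exact (ih (by simpa using h)).imp (hs _ _) (Or.imp (fun h => by rw [h]) (hs _ _))
    · exact .inr (.inr (key _ _ _ _ ht))

/-- A braid on finitely many strands is `σ`-positive, trivial or `σ`-negative. -/
theorem sigmaPos_trichotomy {N : ℕ} {g : InfBraidGroup}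
    (hg : g ∈ Subgroup.closure (σ '' Set.Iio N)) : SigmaPos g ∨ g = 1 ∨ SigmaPos g⁻¹ := by
  obtain ⟨a, ha, b, hb, rfl⟩ := (isBraidFamily_σ N).exists_fraction hg
  obtain ⟨l, hl, rfl⟩ := exists_shiftProd_eq ha
  obtain ⟨l', hl', rfl⟩ := exists_shiftProd_eq hb
  rw [mul_inv_rev, inv_inv, inv_mul_eq_one]
  exact shiftProd_trichotomy (hl.trans hl'.symm)

end InfBraidGroup

namespace BraidGroup

/-- The Artin generators of `B_n`, extended by `1`. -/
def gen (n i : ℕ) : BraidGroup n := if h : i < n - 1 then PresentedGroup.of ⟨i, h⟩ else 1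

theorem isBraidFamily_gen (n : ℕ) : IsBraidFamily (gen n) (n - 1) where
  comm i j hij hj := by
    have hi : i < n - 1 := by omega
    have h : PresentedGroup.mk (braidRels n) _ = 1 :=
      PresentedGroup.one_of_mem (Or.inl ⟨⟨i, hi⟩, ⟨j, hj⟩, hij, rfl⟩)
    simp only [map_mul, map_inv] at h
    rw [mul_inv_eq_one, mul_inv_eq_iff_eq_mul] at h
    simp only [gen, dif_pos hi, dif_pos hj]
    exact h
  braid i hj := by
    have hi : i < n - 1 := by omega
    have h : PresentedGroup.mk (braidRels n) _ = 1 :=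
      PresentedGroup.one_of_mem (Or.inr ⟨⟨i, hi⟩, ⟨i + 1, hj⟩, rfl, rfl⟩)
    simp only [map_mul, map_inv, mul_inv_eq_one] at h
    simp only [gen, dif_pos hi, dif_pos hj]
    exact h

theorem closure_gen (n : ℕ) : Subgroup.closure (gen n '' Set.Iio (n - 1)) = ⊤ := by
  rw [← PresentedGroup.closure_range_of (braidRels n)]
  congr 1
  ext g
  constructor
  · rintro ⟨i, hi, rfl⟩
    exact ⟨⟨i, hi⟩, by rw [gen, dif_pos (show i < n - 1 from hi)]⟩
  · rintro ⟨i, rfl⟩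
    exact ⟨i, i.2, by rw [gen, dif_pos i.2]⟩

/-- The map adding infinitely many strands. -/
def toInf (n : ℕ) : BraidGroup n →* InfBraidGroup :=
  PresentedGroup.toGroup (f := fun i : Fin (n - 1) => InfBraidGroup.σ i) <| by
    rintro r (⟨i, j, hij, rfl⟩ | ⟨i, j, hij, rfl⟩)
    · have h := (InfBraidGroup.isBraidFamily_σ (j + 1)).comm i j hij (by omega)
      simp [h]
    · have h := (InfBraidGroup.isBraidFamily_σ (i + 2)).braid i (by omega)
      simp only [map_mul, map_inv, FreeGroup.lift_apply_of, mul_inv_eq_one, ← hij]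
      exact h

theorem toInf_gen {n i : ℕ} (hi : i < n - 1) : toInf n (gen n i) = InfBraidGroup.σ i := by
  rw [gen, dif_pos hi]
  exact PresentedGroup.toGroup.of _

theorem toInf_mem (n : ℕ) (g : BraidGroup n) :
    toInf n g ∈ Subgroup.closure (InfBraidGroup.σ '' Set.Iio (n - 1)) := by
  have hg : g ∈ Subgroup.closure (gen n '' Set.Iio (n - 1)) := by rw [closure_gen]; trivial
  have h := Subgroup.mem_map_of_mem (toInf n) hg
  rw [MonoidHom.map_closure, ← Set.image_comp] at h
  convert h using 2
  exact Set.image_congr fun i hi => (toInf_gen hi).symm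

theorem toInf_eq_one {n : ℕ} {g : BraidGroup n} (h : toInf n g = 1) : g = 1 := by
  refine (isBraidFamily_gen n).eq_one_of_artin (k := 0)
    (π := InfBraidGroup.artinRep.comp (toInf n)) (fun i hi => ?_) (by rw [closure_gen]; trivial)
    (by simp [h])
  rw [MonoidHom.comp_apply, toInf_gen hi, InfBraidGroup.artinRep, InfBraidGroup.lift_σ, zero_add]

end BraidGroup

/-- The braid group `B_n` (`n ≥ 2`) is left-orderable: it admits a strict total order
invariant under left multiplication. -/
theorem braidGroup_leftOrderable (n : ℕ) (hn : 2 ≤ n) :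
    ∃ r : BraidGroup n → BraidGroup n → Prop,
      IsStrictTotalOrder (BraidGroup n) r ∧
        ∀ α β γ : BraidGroup n, r β γ → r (α * β) (α * γ) := by
  refine ⟨fun β γ => InfBraidGroup.SigmaPos (BraidGroup.toInf n (β⁻¹ * γ)),
    { trichotomous := fun β γ h₁ h₂ => ?_
      irrefl := fun β h => ?_
      trans := fun α β γ h₁ h₂ => ?_ },
    fun α β γ h => ?_⟩
  · rcases InfBraidGroup.sigmaPos_trichotomy (BraidGroup.toInf_mem n (β⁻¹ * γ)) with h | h | h
    · exact absurd h h₁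
    · exact inv_mul_eq_one.1 (BraidGroup.toInf_eq_one h)
    · rw [← map_inv, mul_inv_rev, inv_inv] at h
      exact absurd h h₂
  · rw [inv_mul_cancel, map_one] at h
    exact InfBraidGroup.not_sigmaPos_one h
  · have h := h₁.mul h₂
    rwa [← map_mul, mul_assoc, mul_inv_cancel_left] at h
  · simpa only [mul_inv_rev, mul_assoc, inv_mul_cancel_left] using h
end
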